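/- arXiv:1609.03511 — 3 statements merged into one kernel-verified Lean document; each statement's English description precedes it below -/
import Mathlib

section
/- Let μ be a probability measure on ℝ with mean 0, variance 1, and finite fourth moment. Let (d_n) be a sequence of positive integers with d_n/n³ → 0 as n → ∞. Then TV(𝒲_{n,d_n}, 𝒢_n) → 1 as n → ∞. -/
open MeasureTheory ProbabilityTheory Filter
open scoped BigOperators ENNReal Topology

/-- The total variation distance between two measures. -/
noncomputable def tvDist {Ω : Type*} [MeasurableSpace Ω] (μ ν : Measure Ω) : ℝ :=
  ⨆ A : {A : Set Ω // MeasurableSet A}, |(μ A).toReal - (ν A).toReal|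

/-- The law of `𝒲_{n,d} = (1/√d)(XXᵀ - diag(XXᵀ))`, the scaled Wishart matrix with zeroed
diagonal, where `X` is an `n × d` matrix with i.i.d. entries of law `μ`. -/
noncomputable def scaledWishartLaw (μ : Measure ℝ) (n d : ℕ) : Measure (Fin n → Fin n → ℝ) :=
  Measure.map
    (fun X : Fin n → Fin d → ℝ => fun i j =>
      if i = j then 0 else (∑ k, X i k * X j k) / Real.sqrt d)
    (Measure.pi fun _ : Fin n => Measure.pi fun _ : Fin d => μ)

/-- The law of `𝒢_n`: the symmetric `n × n` random matrix with zero diagonal and i.i.d.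
standard Gaussian entries above the diagonal (GOE with zeroed diagonal). -/
noncomputable def goeZeroDiagLaw (n : ℕ) : Measure (Fin n → Fin n → ℝ) :=
  Measure.map
    (fun u : {q : Fin n × Fin n // q.1 < q.2} → ℝ => fun i j =>
      if h : i < j then u ⟨(i, j), h⟩ else if h : j < i then u ⟨(j, i), h⟩ else 0)
    (Measure.pi fun _ : {q : Fin n × Fin n // q.1 < q.2} => gaussianReal 0 1)


section Generic

set_option linter.unusedSectionVars false

lemma indep_curry {ι Ω : Type*} {κ : ι → Type*} {𝓧 : (i : ι) → κ i → Type*}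
    {mΩ : MeasurableSpace Ω} {P : Measure Ω} [IsProbabilityMeasure P]
    {m𝓧 : ∀ i j, MeasurableSpace (𝓧 i j)}
    {X : (i : ι) → (j : κ i) → Ω → 𝓧 i j} (mX : ∀ i j, Measurable (X i j))
    (h : iIndepFun (fun (p : (i : ι) × (κ i)) ω ↦ X p.1 p.2 ω) P) :
    iIndepFun (fun i ω ↦ (X i · ω)) P := by
  have i1 : ∀ i j, IsProbabilityMeasure (P.map (X i j)) :=
    fun i j ↦ Measure.isProbabilityMeasure_map (mX i j).aemeasurable
  have i2 : ∀ i, IsProbabilityMeasure (P.map (fun ω ↦ (X i · ω))) :=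
    fun i ↦ Measure.isProbabilityMeasure_map (Measurable.aemeasurable (by fun_prop))
  have h2 : ∀ i, iIndepFun (X i) P := fun i => by
    have := h.precomp (g := fun j : κ i => (⟨i, j⟩ : (i : ι) × (κ i))) sigma_mk_injective
    exact this
  have e : (MeasurableEquiv.piCurry 𝓧) ∘ (fun ω p ↦ X p.1 p.2 ω) = fun ω i j ↦ X i j ω := by
    ext; simp [Sigma.curry]
  rw [iIndepFun_iff_map_fun_eq_infinitePi_map (by fun_prop)]
  rw [iIndepFun_iff_map_fun_eq_infinitePi_map (by fun_prop)] at h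
  rw [← e, ← Measure.map_map (by fun_prop) (by fun_prop), h,
    Measure.infinitePi_map_piCurry (fun i j => P.map (X i j))]
  congr 1
  ext1 i
  exact ((iIndepFun_iff_map_fun_eq_infinitePi_map (by fun_prop)).1 (h2 i)).symm

lemma indep_integrable_prod {L Ω : Type*} [Fintype L] {𝓧 : L → Type*}
    {mΩ : MeasurableSpace Ω} {P : Measure Ω} [IsProbabilityMeasure P]
    {m𝓧 : ∀ i, MeasurableSpace (𝓧 i)}
    {X : (i : L) → Ω → 𝓧 i} (mX : ∀ i, Measurable (X i)) (h : iIndepFun X P)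
    (f : (i : L) → 𝓧 i → ℝ) (hf : ∀ i, Measurable (f i))
    (hi : ∀ i, Integrable (fun ω => f i (X i ω)) P) :
    Integrable (fun ω => ∏ i, f i (X i ω)) P := by
  have i1 : ∀ i, IsProbabilityMeasure (P.map (X i)) :=
    fun i ↦ Measure.isProbabilityMeasure_map (mX i).aemeasurable
  have h1 := h.map_fun_eq_pi_map (fun i => (mX i).aemeasurable)
  have h2 : Integrable (fun x : (i : L) → 𝓧 i => ∏ i, f i (x i))
      (Measure.pi fun i => P.map (X i)) := by
    apply Integrable.fintype_prod_dep
    intro i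
    exact (integrable_map_measure (hf i).aestronglyMeasurable (mX i).aemeasurable).2 (hi i)
  rw [← h1] at h2
  exact h2.comp_measurable (by fun_prop)

variable {ι Ω : Type*} [Fintype ι] {mΩ : MeasurableSpace Ω}

/-- the index triple -/
def tri (t : ι × ι × ι) : Fin 3 → ι × ι := ![(t.2.2, t.1), (t.1, t.2.1), (t.2.1, t.2.2)]

/-- trace-like statistic -/
def Tstat (S : Fin 3 → ι × ι → Ω → ℝ) (ω : Ω) : ℝ :=
  ∑ t : ι × ι × ι, ∏ l, S l (tri t l) ω

variable {P : Measure Ω} [IsProbabilityMeasure P] {S : Fin 3 → ι × ι → Ω → ℝ}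

lemma Tstat_pair_integrable
    (mS : ∀ l p, Measurable (S l p)) (hL : ∀ l p, MemLp (S l p) 2 P)
    (hS : iIndepFun (fun l ω p => S l p ω) P) (s t : ι × ι × ι) :
    Integrable (fun ω => ∏ l, (S l (tri s l) ω * S l (tri t l) ω)) P := by
  apply indep_integrable_prod (X := fun l ω p => S l p ω) (by fun_prop) hS
    (fun l x => x (tri s l) * x (tri t l)) (by fun_prop)
  intro l
  exact (hL l _).integrable_mul (hL l _)

lemma Tstat_memLp
    (mS : ∀ l p, Measurable (S l p)) (hL : ∀ l p, MemLp (S l p) 2 P)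
    (hS : iIndepFun (fun l ω p => S l p ω) P) : MemLp (Tstat S) 2 P := by
  have : Tstat S = fun ω => ∑ t : ι × ι × ι, ∏ l, S l (tri t l) ω := rfl
  rw [this]
  apply memLp_finsetSum
  intro t _
  rw [memLp_two_iff_integrable_sq]
  · have := Tstat_pair_integrable mS hL hS t t
    refine this.congr (ae_of_all _ fun ω => ?_)
    simp only [Finset.prod_mul_distrib]; ring
  · apply Measurable.aestronglyMeasurable
    fun_prop

lemma Tstat_integral
    (mS : ∀ l p, Measurable (S l p)) (hL : ∀ l p, MemLp (S l p) 2 P)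
    (hS : iIndepFun (fun l ω p => S l p ω) P) : ∫ ω, Tstat S ω ∂P = ∑ t : ι × ι × ι, ∏ l, ∫ ω, S l (tri t l) ω ∂P := by
  unfold Tstat
  rw [integral_finsetSum]
  · refine Finset.sum_congr rfl fun t _ => ?_
    exact hS.integral_fun_prod_comp (f := fun l x => x (tri t l)) (by fun_prop)
      (fun l => Measurable.aestronglyMeasurable (by fun_prop))
  · intro t _
    apply indep_integrable_prod (X := fun l ω p => S l p ω) (by fun_prop) hS
      (fun l x => x (tri t l)) (by fun_prop)
    intro l
    exact (hL l _).integrable (by norm_num)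

lemma Tstat_sq
    (mS : ∀ l p, Measurable (S l p)) (hL : ∀ l p, MemLp (S l p) 2 P)
    (hS : iIndepFun (fun l ω p => S l p ω) P) : ∫ ω, Tstat S ω ^ 2 ∂P = ∑ s : ι × ι × ι, ∑ t : ι × ι × ι,
    ∏ l, ∫ ω, S l (tri s l) ω * S l (tri t l) ω ∂P := by
  have : ∀ ω, Tstat S ω ^ 2 = ∑ s : ι × ι × ι, ∑ t : ι × ι × ι,
      ∏ l, (S l (tri s l) ω * S l (tri t l) ω) := fun ω => by
    simp only [Finset.prod_mul_distrib, sq, Tstat, Finset.sum_mul_sum]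
  simp_rw [this]
  rw [integral_finsetSum]
  · refine Finset.sum_congr rfl fun s _ => ?_
    rw [integral_finsetSum]
    · refine Finset.sum_congr rfl fun t _ => ?_
      exact hS.integral_fun_prod_comp (f := fun l x => x (tri s l) * x (tri t l)) (by fun_prop)
        (fun l => Measurable.aestronglyMeasurable (by fun_prop))
    · exact fun t _ => Tstat_pair_integrable mS hL hS s t
  · exact fun s _ => integrable_finsetSum _ fun t _ => Tstat_pair_integrable mS hL hS s t

end Generic

section Comb

variable {ι : Type*} [Fintype ι] [DecidableEq ι]

/-- both index pairs are diagonal -/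
def Dg (p q : ι × ι) : Prop := p.1 = p.2 ∧ q.1 = q.2

/-- the four indices can be paired up -/
def Pg (p q : ι × ι) : Prop :=
  (p.1 = p.2 ∧ q.1 = q.2) ∨ (p.1 = q.1 ∧ p.2 = q.2) ∨ (p.1 = q.2 ∧ p.2 = q.1)

instance (p q : ι × ι) : Decidable (Dg p q) := by unfold Dg; infer_instance
instance (p q : ι × ι) : Decidable (Pg p q) := by unfold Pg; infer_instance

lemma sum_ind_le {τ σ : Type*} [Fintype τ] [Fintype σ] [DecidableEq τ] (c : τ → Prop)
    [DecidablePred c] (f : σ → τ) (h : ∀ x, c x → ∃ y, f y = x) :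
    ∑ x, (if c x then (1 : ℝ) else 0) ≤ Fintype.card σ := by
  rw [Finset.sum_boole]
  have : (Finset.univ.filter c) ⊆ Finset.univ.image f := by
    intro x hx
    simp only [Finset.mem_filter, Finset.mem_univ, true_and] at hx
    obtain ⟨y, hy⟩ := h x hx
    exact Finset.mem_image.2 ⟨y, Finset.mem_univ _, hy⟩
  exact_mod_cast (Finset.card_le_card this).trans Finset.card_image_le

abbrev T2 (ι : Type*) := (ι × ι × ι) × (ι × ι × ι)

def Zc (x : T2 ι) : Prop := ∀ l, Dg (tri x.1 l) (tri x.2 l)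
def Xc (x : T2 ι) : Prop := ∀ l, Pg (tri x.1 l) (tri x.2 l)
def Yc (x : T2 ι) : Prop := Xc x ∧ ∃ l, Dg (tri x.1 l) (tri x.2 l)

instance : DecidablePred (Zc (ι := ι)) := fun x => by unfold Zc; infer_instance
instance : DecidablePred (Xc (ι := ι)) := fun x => by unfold Xc; infer_instance
instance : DecidablePred (Yc (ι := ι)) := fun x => by unfold Yc; infer_instance

lemma Zc_iff (a b c a' b' c' : ι) : Zc ((a, b, c), (a', b', c')) ↔
    (c = a ∧ c' = a') ∧ (a = b ∧ a' = b') ∧ (b = c ∧ b' = c') := by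
  simp [Zc, Dg, tri, Fin.forall_fin_succ]

lemma Xc_iff (a b c a' b' c' : ι) : Xc ((a, b, c), (a', b', c')) ↔
    ((c = a ∧ c' = a') ∨ (c = c' ∧ a = a') ∨ (c = a' ∧ a = c')) ∧
    ((a = b ∧ a' = b') ∨ (a = a' ∧ b = b') ∨ (a = b' ∧ b = a')) ∧
    ((b = c ∧ b' = c') ∨ (b = b' ∧ c = c') ∨ (b = c' ∧ c = b')) := by
  simp [Xc, Pg, tri, Fin.forall_fin_succ]

lemma Yc_iff (a b c a' b' c' : ι) : Yc ((a, b, c), (a', b', c')) ↔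
    Xc ((a, b, c), (a', b', c')) ∧
    ((c = a ∧ c' = a') ∨ (a = b ∧ a' = b') ∨ (b = c ∧ b' = c')) := by
  simp [Yc, Dg, tri, Fin.exists_fin_succ]

lemma sumZ : ∑ x : T2 ι, (if Zc x then (1 : ℝ) else 0) ≤ (Fintype.card ι : ℝ) ^ 2 := by
  have := sum_ind_le (Zc (ι := ι)) (fun p : ι × ι => ((p.1, p.1, p.1), (p.2, p.2, p.2))) (by
    rintro ⟨⟨a, b, c⟩, ⟨a', b', c'⟩⟩ h
    rw [Zc_iff] at h
    obtain ⟨⟨rfl, rfl⟩, ⟨rfl, rfl⟩, _⟩ := h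
    exact ⟨(_, _), rfl⟩)
  simpa [sq] using this

/-- the seven degenerate patterns -/
def Yf (p : Fin 7 × ι × ι) : T2 ι :=
  let x := p.2.1
  let y := p.2.2
  ![((x, x, x), (y, y, y)),
    ((x, y, x), (x, y, x)), ((x, y, x), (y, x, y)),
    ((x, x, y), (x, x, y)), ((x, x, y), (y, y, x)),
    ((y, x, x), (y, x, x)), ((y, x, x), (x, y, y))] p.1

lemma Yc_pat (x : T2 ι) (h : Yc x) : ∃ y, Yf y = x := by
  obtain ⟨⟨a, b, c⟩, ⟨a', b', c'⟩⟩ := x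
  rw [Yc_iff, Xc_iff] at h
  obtain ⟨⟨h0, h1, h2⟩, h3⟩ := h
  have : (a = b ∧ b = c ∧ a' = b' ∧ b' = c') ∨
     (a = c ∧ a' = c' ∧ ((a = a' ∧ b = b') ∨ (a = b' ∧ b = a'))) ∨
     (a = b ∧ a' = b' ∧ ((a = a' ∧ c = c') ∨ (a = c' ∧ c = a'))) ∨
     (b = c ∧ b' = c' ∧ ((b = b' ∧ a = a') ∨ (b = a' ∧ a = b'))) := by
    grind
  rcases this with ⟨rfl, rfl, rfl, rfl⟩ | ⟨rfl, rfl, ⟨rfl, rfl⟩ | ⟨rfl, rfl⟩⟩ |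
    ⟨rfl, rfl, ⟨rfl, rfl⟩ | ⟨rfl, rfl⟩⟩ | ⟨rfl, rfl, ⟨rfl, rfl⟩ | ⟨rfl, rfl⟩⟩
  · exact ⟨(0, _, _), rfl⟩
  · exact ⟨(1, _, _), rfl⟩
  · exact ⟨(2, _, _), rfl⟩
  · exact ⟨(3, _, _), rfl⟩
  · exact ⟨(4, _, _), rfl⟩
  · exact ⟨(5, _, _), rfl⟩
  · exact ⟨(6, _, _), rfl⟩

lemma sumY : ∑ x : T2 ι, (if Yc x then (1 : ℝ) else 0) ≤ 7 * (Fintype.card ι : ℝ) ^ 2 := by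
  have := sum_ind_le (Yc (ι := ι)) Yf Yc_pat
  simpa [sq] using this

lemma Xc_pat (x : T2 ι) (h : Xc x) : Yc x ∨ x.1 = x.2 := by
  obtain ⟨⟨a, b, c⟩, ⟨a', b', c'⟩⟩ := x
  rw [Yc_iff]
  refine (or_iff_not_imp_left).2 fun hn => ?_
  have hn : ¬ ((c = a ∧ c' = a') ∨ (a = b ∧ a' = b') ∨ (b = c ∧ b' = c')) := fun h' => hn ⟨h, h'⟩
  rw [Xc_iff] at h
  simp only [Prod.mk.injEq]
  grind

lemma sumX : ∑ x : T2 ι, (if Xc x then (1 : ℝ) else 0) ≤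
    7 * (Fintype.card ι : ℝ) ^ 2 + (Fintype.card ι : ℝ) ^ 3 := by
  have h1 := sumY (ι := ι)
  have h2 := sum_ind_le (fun x : T2 ι => x.1 = x.2) (fun s : ι × ι × ι => (s, s)) (by
    rintro ⟨a, b⟩ h
    exact ⟨a, by simpa using h⟩)
  have h3 : ∑ x : T2 ι, (if Xc x then (1 : ℝ) else 0) ≤
      ∑ x : T2 ι, (if Yc x then (1 : ℝ) else 0) +
      ∑ x : T2 ι, (if x.1 = x.2 then (1 : ℝ) else 0) := by
    rw [← Finset.sum_add_distrib]
    refine Finset.sum_le_sum fun x _ => ?_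
    have := Xc_pat x
    by_cases hX : Xc x
    · rcases this hX with h | h
      · simp only [hX, h, if_true]; split_ifs <;> norm_num
      · simp only [hX, h, if_true]; split_ifs <;> norm_num
    · simp only [hX, if_false]; split_ifs <;> norm_num
  have h4 : ((Fintype.card (ι × ι × ι) : ℕ) : ℝ) = (Fintype.card ι : ℝ) ^ 3 := by
    simp only [Fintype.card_prod]; push_cast; ring
  linarith

lemma sum_prod_le (M : Fin 3 → ι × ι → ι × ι → ℝ) {A B : ℝ} (hA : 0 ≤ A) (hB : 0 ≤ B)
    (hM : ∀ l p q, |M l p q| ≤ A * (if Dg p q then 1 else 0) + B * (if Pg p q then 1 else 0)) :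
    ∑ s : ι × ι × ι, ∑ t : ι × ι × ι, ∏ l, M l (tri s l) (tri t l) ≤
      (A ^ 3 + 3 * A ^ 2 * B) * (Fintype.card ι : ℝ) ^ 2
      + 3 * A * B ^ 2 * (7 * (Fintype.card ι : ℝ) ^ 2)
      + B ^ 3 * (7 * (Fintype.card ι : ℝ) ^ 2 + (Fintype.card ι : ℝ) ^ 3) := by
  rw [← Fintype.sum_prod_type' (f := fun s t => ∏ l, M l (tri s l) (tri t l))]
  have key : ∀ x : T2 ι, ∏ l, M l (tri x.1 l) (tri x.2 l) ≤
      (A ^ 3 + 3 * A ^ 2 * B) * (if Zc x then 1 else 0) + 3 * A * B ^ 2 * (if Yc x then 1 else 0)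
      + B ^ 3 * (if Xc x then 1 else 0) := by
    intro x
    refine (le_abs_self _).trans ?_
    rw [Finset.abs_prod]
    refine (Finset.prod_le_prod (fun l _ => abs_nonneg _) (fun l _ => hM l _ _)).trans ?_
    by_cases hX : Xc x
    · have hP : ∀ l, Pg (tri x.1 l) (tri x.2 l) := hX
      have hY : Yc x ↔ ∃ l, Dg (tri x.1 l) (tri x.2 l) := by simp [Yc, hX]
      have hZ : ∀ l l' : Fin 3, l ≠ l' → Dg (tri x.1 l) (tri x.2 l) →
          Dg (tri x.1 l') (tri x.2 l') → Zc x := by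
        obtain ⟨⟨a, b, c⟩, ⟨a', b', c'⟩⟩ := x
        rw [Zc_iff]
        intro l l'
        fin_cases l <;> fin_cases l' <;> simp [tri, Dg] <;> grind
      have hZ' : Zc x ↔ ∀ l, Dg (tri x.1 l) (tri x.2 l) := Iff.rfl
      have z01 := hZ 0 1 (by decide)
      have z02 := hZ 0 2 (by decide)
      have z12 := hZ 1 2 (by decide)
      simp only [hX, hP, if_true, Fin.prod_univ_three, hY, Fin.exists_fin_succ, Fin.forall_fin_succ]
        at *
      simp only [Fin.succ_zero_eq_one, Fin.succ_one_eq_two] at *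
      have := mul_nonneg hA hB
      have := mul_nonneg (mul_nonneg hA hB) hB
      have := mul_nonneg (mul_nonneg hA hA) hB
      by_cases h0 : Dg (tri x.1 0) (tri x.2 0) <;> by_cases h1 : Dg (tri x.1 1) (tri x.2 1) <;>
        by_cases h2 : Dg (tri x.1 2) (tri x.2 2) <;>
        simp_all <;> nlinarith
    · have hZ : ¬ Zc x := fun h => hX fun l => Or.inl (h l)
      have hY : ¬ Yc x := fun h => hX h.1
      obtain ⟨l, hl⟩ := not_forall.1 hX
      have hD : ¬ Dg (tri x.1 l) (tri x.2 l) := fun h => hl (Or.inl h)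
      rw [Finset.prod_eq_zero (Finset.mem_univ l) (by simp [hl, hD])]
      simp [hX, hZ, hY]
  refine (Finset.sum_le_sum fun x _ => key x).trans ?_
  rw [Finset.sum_add_distrib, Finset.sum_add_distrib, ← Finset.mul_sum, ← Finset.mul_sum,
    ← Finset.mul_sum]
  gcongr
  · exact sumZ
  · exact sumY
  · exact sumX

end Comb

section Moments

variable {κ : Type*} [Fintype κ] [DecidableEq κ] (μ : Measure ℝ) [IsProbabilityMeasure μ]

/-- law of a row -/
noncomputable abbrev rowLaw (κ : Type*) [Fintype κ] (μ : Measure ℝ) : Measure (κ → ℝ) :=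
  Measure.pi fun _ : κ => μ

lemma row_integral (a : κ) (f : ℝ → ℝ) (hf : Measurable f) :
    ∫ x, f (x a) ∂(rowLaw κ μ) = ∫ y, f y ∂μ :=
  integral_comp_eval (μ := fun _ : κ => μ) hf.aestronglyMeasurable

lemma row_integrable (a : κ) (f : ℝ → ℝ) (hf : Integrable f μ) :
    Integrable (fun x => f (x a)) (rowLaw κ μ) :=
  integrable_comp_eval (μ := fun _ : κ => μ) hf

lemma prod_pow_ind (x : κ → ℝ) (a : κ) : ∏ k, x k ^ (if a = k then 1 else 0) = x a := by
  simp

lemma row_single_zero (hmean : ∫ x, x ∂μ = 0) (a b c e : κ) (hb : a ≠ b) (hc : a ≠ c)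
    (he : a ≠ e) : ∫ x, x a * (x b * (x c * x e)) ∂(rowLaw κ μ) = 0 := by
  have : ∀ x : κ → ℝ, x a * (x b * (x c * x e)) = ∏ k, (x k ^ (if a = k then 1 else 0) *
    (x k ^ (if b = k then 1 else 0) * (x k ^ (if c = k then 1 else 0) *
      x k ^ (if e = k then 1 else 0)))) := by
    intro x
    simp only [Finset.prod_mul_distrib, prod_pow_ind]
  simp_rw [this]
  rw [integral_fintype_prod_eq_prod (f := fun k y => (y ^ (if a = k then 1 else 0) *
    (y ^ (if b = k then 1 else 0) * (y ^ (if c = k then 1 else 0) *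
      y ^ (if e = k then 1 else 0)))))]
  apply Finset.prod_eq_zero (Finset.mem_univ a)
  simp [hb.symm, hc.symm, he.symm, hmean]

lemma row_mom2 (hmean : ∫ x, x ∂μ = 0) (hvar : ∫ x, x ^ 2 ∂μ = 1) (a b : κ) :
    ∫ x, x a * x b ∂(rowLaw κ μ) = if a = b then 1 else 0 := by
  split_ifs with h
  · subst h
    rw [← hvar, ← row_integral μ a (fun y => y ^ 2) (by fun_prop)]
    simp only [sq]
  · have : ∀ x : κ → ℝ, x a * x b = ∏ k, (x k ^ (if a = k then 1 else 0) *
      (x k ^ (if b = k then 1 else 0))) := by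
      intro x
      simp only [Finset.prod_mul_distrib, prod_pow_ind]
    simp_rw [this]
    rw [integral_fintype_prod_eq_prod (f := fun k y => (y ^ (if a = k then 1 else 0) *
      (y ^ (if b = k then 1 else 0))))]
    apply Finset.prod_eq_zero (Finset.mem_univ a)
    simp [Ne.symm h, hmean]

lemma amgm4 (x y z w : ℝ) : |x * y * (z * w)| ≤ (x ^ 4 + y ^ 4 + z ^ 4 + w ^ 4) / 4 := by
  rw [abs_le]
  constructor <;>
  nlinarith [sq_nonneg (x * y - z * w), sq_nonneg (x * y + z * w), sq_nonneg (x ^ 2 - y ^ 2),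
    sq_nonneg (z ^ 2 - w ^ 2)]

lemma row_integrable4 (hmom4 : Integrable (fun x => x ^ 4) μ) (a b c e : κ) :
    Integrable (fun x => x a * x b * (x c * x e)) (rowLaw κ μ) := by
  have h := fun a : κ => row_integrable μ a (fun y => y ^ 4) hmom4
  refine Integrable.mono' ((((h a).add (h b)).add (h c)).add (h e) |>.div_const 4)
    (Measurable.aestronglyMeasurable (by fun_prop)) (ae_of_all _ fun x => ?_)
  exact amgm4 _ _ _ _

lemma row_mom4 (hmean : ∫ x, x ∂μ = 0) (hmom4 : Integrable (fun x => x ^ 4) μ) (p q : κ × κ) :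
    |∫ x, x p.1 * x p.2 * (x q.1 * x q.2) ∂(rowLaw κ μ)| ≤
      (∫ x, x ^ 4 ∂μ) * (if Pg p q then 1 else 0) := by
  obtain ⟨a, b⟩ := p
  obtain ⟨c, e⟩ := q
  have hInt := fun a : κ => row_integrable μ a (fun y => y ^ 4) hmom4
  have hval := fun a : κ => row_integral μ a (fun y => y ^ 4) (by fun_prop)
  split_ifs with h
  · refine (abs_integral_le_integral_abs).trans ?_
    have h1 : ∫ x, |x a * x b * (x c * x e)| ∂(rowLaw κ μ) ≤
        ∫ x, (x a ^ 4 + x b ^ 4 + x c ^ 4 + x e ^ 4) / 4 ∂(rowLaw κ μ) := by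
      apply integral_mono
      · exact (row_integrable4 μ hmom4 a b c e).abs
      · exact ((((hInt a).add (hInt b)).add (hInt c)).add (hInt e)).div_const 4
      · intro x; exact amgm4 _ _ _ _
    refine h1.trans (le_of_eq ?_)
    rw [integral_div, integral_add, integral_add, integral_add, hval, hval, hval, hval]
    · ring
    · exact hInt a
    · exact hInt b
    · exact (hInt a).add (hInt b)
    · exact hInt c
    · exact ((hInt a).add (hInt b)).add (hInt c)
    · exact hInt e
  · have hz := fun a b c e => row_single_zero (κ := κ) μ hmean a b c e
    have : (a ≠ b ∧ a ≠ c ∧ a ≠ e) ∨ (b ≠ a ∧ b ≠ c ∧ b ≠ e) ∨ (c ≠ a ∧ c ≠ b ∧ c ≠ e) ∨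
        (e ≠ a ∧ e ≠ b ∧ e ≠ c) := by
      simp only [Pg] at h
      grind
    have : ∫ x, x a * x b * (x c * x e) ∂(rowLaw κ μ) = 0 := by
      rcases this with h | h | h | h
      · rw [← hz a b c e h.1 h.2.1 h.2.2]; congr 1; ext x; ring
      · rw [← hz b a c e h.1 h.2.1 h.2.2]; congr 1; ext x; ring
      · rw [← hz c a b e h.1 h.2.1 h.2.2]; congr 1; ext x; ring
      · rw [← hz e a b c h.1 h.2.1 h.2.2]; congr 1; ext x; ring
    simp [this]

lemma row_memLp (hmom4 : Integrable (fun x => x ^ 4) μ) (a b : κ) :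
    MemLp (fun x => x a * x b) 2 (rowLaw κ μ) := by
  rw [memLp_two_iff_integrable_sq (Measurable.aestronglyMeasurable (by fun_prop))]
  simpa only [sq] using row_integrable4 μ hmom4 a b a b

lemma one_le_mom4 (hvar : ∫ x, x ^ 2 ∂μ = 1) (hmom4 : Integrable (fun x => x ^ 4) μ) :
    1 ≤ ∫ x, x ^ 4 ∂μ := by
  have h2 : Integrable (fun x : ℝ => x ^ 2) μ := by
    by_contra h
    rw [integral_undef h] at hvar
    norm_num at hvar
  have h : 0 ≤ ∫ x, (x ^ 4 - 2 * x ^ 2 + 1) ∂μ :=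
    integral_nonneg fun x => by
      have := sq_nonneg (x ^ 2 - 1)
      show (0 : ℝ) ≤ x ^ 4 - 2 * x ^ 2 + 1
      nlinarith
  rw [integral_add (f := fun x : ℝ => x ^ 4 - 2 * x ^ 2) (hmom4.sub (h2.const_mul 2)) (integrable_const _),
    integral_sub hmom4 (h2.const_mul 2), integral_const_mul, hvar] at h
  simp at h
  linarith

variable {n m : ℕ} (g : Fin 3 → Fin m → Fin n)

/-- block covariance matrices -/
def SW (g : Fin 3 → Fin m → Fin n) (l : Fin 3) (p : κ × κ) (X : Fin n → κ → ℝ) : ℝ :=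
  ∑ i, X (g l i) p.1 * X (g l i) p.2

/-- law of the data matrix -/
noncomputable abbrev dataLaw (κ : Type*) [Fintype κ] (μ : Measure ℝ) (n : ℕ) :
    Measure (Fin n → κ → ℝ) := Measure.pi fun _ : Fin n => rowLaw κ μ

lemma SW_meas (l : Fin 3) (p : κ × κ) : Measurable (SW g l p) := by
  unfold SW; fun_prop

lemma data_memLp (hmom4 : Integrable (fun x => x ^ 4) μ) (r : Fin n) (a b : κ) :
    MemLp (fun X : Fin n → κ → ℝ => X r a * X r b) 2 (dataLaw κ μ n) :=
  (row_memLp μ hmom4 a b).comp_measurePreserving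
    (measurePreserving_eval (fun _ : Fin n => rowLaw κ μ) r)

lemma data_integral (r : Fin n) (f : (κ → ℝ) → ℝ) (hf : Measurable f) :
    ∫ X, f (X r) ∂(dataLaw κ μ n) = ∫ x, f x ∂(rowLaw κ μ) :=
  integral_comp_eval (μ := fun _ : Fin n => rowLaw κ μ) hf.aestronglyMeasurable

lemma SW_memLp (hmom4 : Integrable (fun x => x ^ 4) μ) (l : Fin 3) (p : κ × κ) :
    MemLp (SW g l p) 2 (dataLaw κ μ n) := by
  unfold SW
  exact memLp_finsetSum _ fun i _ => data_memLp μ hmom4 (g l i) p.1 p.2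

lemma data_indep : iIndepFun (fun r (X : Fin n → κ → ℝ) => X r) (dataLaw κ μ n) :=
  iIndepFun_pi (X := fun _ x => x) (fun _ => aemeasurable_id)

lemma SW_indep (hg : Function.Injective (fun p : (_ : Fin 3) × Fin m => g p.1 p.2)) :
    iIndepFun (fun l X p => SW g l p X) (dataLaw κ μ n) := by
  have h := (data_indep (κ := κ) (n := n) μ).precomp hg
  have h2 := indep_curry (X := fun l i (X : Fin n → κ → ℝ) => X (g l i)) (by fun_prop) h
  exact h2.comp (fun l Y (p : κ × κ) => ∑ i, Y i p.1 * Y i p.2) (by fun_prop)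

lemma SW_mean (hmean : ∫ x, x ∂μ = 0) (hvar : ∫ x, x ^ 2 ∂μ = 1)
    (hmom4 : Integrable (fun x => x ^ 4) μ) (l : Fin 3) (p : κ × κ) :
    ∫ X, SW g l p X ∂(dataLaw κ μ n) = m * (if p.1 = p.2 then 1 else 0) := by
  unfold SW
  rw [integral_finsetSum _ fun i _ => (data_memLp μ hmom4 (g l i) p.1 p.2).integrable (by norm_num)]
  have : ∀ i, ∫ X : Fin n → κ → ℝ, X (g l i) p.1 * X (g l i) p.2 ∂(dataLaw κ μ n) =
      if p.1 = p.2 then 1 else 0 := fun i => by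
    rw [data_integral μ (g l i) (fun x => x p.1 * x p.2) (by fun_prop), row_mom2 μ hmean hvar]
  simp [this]

lemma SW_cov (hmean : ∫ x, x ∂μ = 0) (hvar : ∫ x, x ^ 2 ∂μ = 1)
    (hmom4 : Integrable (fun x => x ^ 4) μ) (l : Fin 3) (hg : Function.Injective (g l))
    (p q : κ × κ) :
    |∫ X, SW g l p X * SW g l q X ∂(dataLaw κ μ n)| ≤
      (m : ℝ) ^ 2 * (if Dg p q then 1 else 0) +
        (m * ∫ x, x ^ 4 ∂μ) * (if Pg p q then 1 else 0) := by
  have hi : ∀ i j, Integrable (fun X : Fin n → κ → ℝ => X (g l i) p.1 * X (g l i) p.2 *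
      (X (g l j) q.1 * X (g l j) q.2)) (dataLaw κ μ n) := fun i j =>
    (data_memLp μ hmom4 (g l i) p.1 p.2).integrable_mul (data_memLp μ hmom4 (g l j) q.1 q.2)
  have hK : 0 ≤ (∫ x, x ^ 4 ∂μ) * (if Pg p q then 1 else 0) := by
    have := one_le_mom4 μ hvar hmom4
    split_ifs <;> linarith
  have hD : 0 ≤ (if Dg p q then (1 : ℝ) else 0) := by split_ifs <;> norm_num
  have key : ∀ i j, |∫ X : Fin n → κ → ℝ, X (g l i) p.1 * X (g l i) p.2 *
      (X (g l j) q.1 * X (g l j) q.2) ∂(dataLaw κ μ n)| ≤ (if Dg p q then 1 else 0) +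
      if i = j then (∫ x, x ^ 4 ∂μ) * (if Pg p q then 1 else 0) else 0 := by
    intro i j
    by_cases hij : i = j
    · subst hij
      rw [data_integral μ (g l i) (fun x => x p.1 * x p.2 * (x q.1 * x q.2)) (by fun_prop)]
      have := row_mom4 μ hmean hmom4 p q
      simp only [if_true]
      linarith
    · have hne : g l i ≠ g l j := fun h => hij (hg h)
      have hind := (data_indep (κ := κ) (n := n) μ).indepFun hne
      have h2 := hind.comp (φ := fun x => x p.1 * x p.2) (ψ := fun x => x q.1 * x q.2)
        (by fun_prop) (by fun_prop)
      have h3 := h2.integral_fun_mul_eq_mul_integral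
        (Measurable.aestronglyMeasurable (by fun_prop))
        (Measurable.aestronglyMeasurable (by fun_prop))
      simp only [Function.comp_def] at h3
      rw [h3, data_integral μ (g l i) (fun x => x p.1 * x p.2) (by fun_prop),
        data_integral μ (g l j) (fun x => x q.1 * x q.2) (by fun_prop),
        row_mom2 μ hmean hvar, row_mom2 μ hmean hvar]
      simp only [hij, if_false, Dg]
      split_ifs <;> simp_all
  have : ∀ X, SW g l p X * SW g l q X = ∑ i, ∑ j, X (g l i) p.1 * X (g l i) p.2 *
      (X (g l j) q.1 * X (g l j) q.2) := fun X => by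
    simp only [SW, Finset.sum_mul_sum]
  simp_rw [this]
  rw [integral_finsetSum _ fun i _ => integrable_finsetSum _ fun j _ => hi i j]
  refine (Finset.abs_sum_le_sum_abs _ _).trans ?_
  have h5 : ∀ i, |∫ X : Fin n → κ → ℝ, ∑ j, X (g l i) p.1 * X (g l i) p.2 *
      (X (g l j) q.1 * X (g l j) q.2) ∂(dataLaw κ μ n)| ≤ ∑ j, ((if Dg p q then 1 else 0) +
      if i = j then (∫ x, x ^ 4 ∂μ) * (if Pg p q then 1 else 0) else 0) := by
    intro i
    rw [integral_finsetSum _ fun j _ => hi i j]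
    exact (Finset.abs_sum_le_sum_abs _ _).trans (Finset.sum_le_sum fun j _ => key i j)
  refine (Finset.sum_le_sum fun i _ => h5 i).trans (le_of_eq ?_)
  simp only [Finset.sum_add_distrib, Finset.sum_ite_eq, Finset.mem_univ, if_true,
    Finset.sum_const, Finset.card_univ, Fintype.card_fin, nsmul_eq_mul]
  ring

lemma W_mean (hmean : ∫ x, x ∂μ = 0) (hvar : ∫ x, x ^ 2 ∂μ = 1)
    (hmom4 : Integrable (fun x => x ^ 4) μ)
    (hg : Function.Injective (fun p : (_ : Fin 3) × Fin m => g p.1 p.2)) :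
    ∫ X, Tstat (SW (κ := κ) g) X ∂(dataLaw κ μ n) = (m : ℝ) ^ 3 * Fintype.card κ := by
  rw [Tstat_integral (SW_meas g) (SW_memLp μ g hmom4) (SW_indep μ g hg)]
  simp only [SW_mean μ g hmean hvar hmom4, Finset.prod_mul_distrib, Finset.prod_const,
    Finset.card_univ, Fintype.card_fin, ← Finset.mul_sum]
  congr 1
  have : ∀ t : κ × κ × κ, ∏ l, (if (tri t l).1 = (tri t l).2 then (1 : ℝ) else 0) =
      if t.1 = t.2.1 then (if t.1 = t.2.2 then 1 else 0) else 0 := by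
    rintro ⟨a, b, c⟩
    simp only [Fin.prod_univ_three, tri, Matrix.cons_val]
    by_cases h1 : a = b
    · subst h1
      by_cases h2 : a = c
      · subst h2; simp
      · simp [h2]
    · simp [h1]
  simp only [this, Fintype.sum_prod_type]
  simp [Finset.sum_ite_eq]

lemma W_sq (hmean : ∫ x, x ∂μ = 0) (hvar : ∫ x, x ^ 2 ∂μ = 1)
    (hmom4 : Integrable (fun x => x ^ 4) μ)
    (hg : Function.Injective (fun p : (_ : Fin 3) × Fin m => g p.1 p.2))
    (hm : 1 ≤ m) (hκ : 1 ≤ Fintype.card κ) :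
    ∫ X, Tstat (SW (κ := κ) g) X ^ 2 ∂(dataLaw κ μ n) ≤ (m : ℝ) ^ 6 * (Fintype.card κ : ℝ) ^ 2 +
      24 * (∫ x, x ^ 4 ∂μ) ^ 3 * ((m : ℝ) ^ 5 * (Fintype.card κ : ℝ) ^ 2 +
        (m : ℝ) ^ 3 * (Fintype.card κ : ℝ) ^ 3) := by
  rw [Tstat_sq (SW_meas g) (SW_memLp μ g hmom4) (SW_indep μ g hg)]
  have hK := one_le_mom4 μ hvar hmom4
  have hgl : ∀ l, Function.Injective (g l) := fun l i j h => by
    have := @hg ⟨l, i⟩ ⟨l, j⟩ h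
    simpa using this
  refine (sum_prod_le (fun l p q => ∫ X, SW g l p X * SW g l q X ∂(dataLaw κ μ n))
    (A := (m : ℝ) ^ 2) (B := m * ∫ x, x ^ 4 ∂μ) (by positivity) (by positivity)
    (fun l p q => SW_cov μ g hmean hvar hmom4 l (hgl l) p q)).trans ?_
  set K := ∫ x, x ^ 4 ∂μ
  have hm' : (1 : ℝ) ≤ m := by exact_mod_cast hm
  have hd' : (1 : ℝ) ≤ Fintype.card κ := by exact_mod_cast hκ
  generalize (m : ℝ) = M at *
  generalize (Fintype.card κ : ℝ) = D at *
  have e1 : K ≤ K ^ 3 := le_self_pow₀ hK (by norm_num)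
  have e2 : K ^ 2 ≤ K ^ 3 := pow_le_pow_right₀ hK (by norm_num)
  have e3 : M ^ 4 ≤ M ^ 5 := pow_le_pow_right₀ hm' (by norm_num)
  have e4 : D ^ 2 ≤ D ^ 3 := pow_le_pow_right₀ hd' (by norm_num)
  have f1 : M ^ 5 * D ^ 2 * K ≤ M ^ 5 * D ^ 2 * K ^ 3 := by gcongr
  have f2 : M ^ 4 * D ^ 2 * K ^ 2 ≤ M ^ 5 * D ^ 2 * K ^ 3 := by gcongr
  have f3 : M ^ 3 * D ^ 2 * K ^ 3 ≤ M ^ 3 * D ^ 3 * K ^ 3 := by gcongr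
  have f4 : 0 ≤ M ^ 3 * D ^ 3 * K ^ 3 := by positivity
  nlinarith

end Moments

section Gauss

variable {n m : ℕ} (g : Fin 3 → Fin m → Fin n)
  (hlt : ∀ l l' i j, l < l' → g l i < g l' j)

/-- coordinates of the Gaussian matrix -/
abbrev QQ (n : ℕ) := {q : Fin n × Fin n // q.1 < q.2}

/-- the three blocks of coordinates -/
def eG (g : Fin 3 → Fin m → Fin n) (hlt : ∀ l l' i j, l < l' → g l i < g l' j) :
    Fin 3 → Fin m × Fin m → QQ n :=
  ![fun p => ⟨(g 0 p.2, g 2 p.1), hlt _ _ _ _ (by decide)⟩,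
    fun p => ⟨(g 0 p.1, g 1 p.2), hlt _ _ _ _ (by decide)⟩,
    fun p => ⟨(g 1 p.1, g 2 p.2), hlt _ _ _ _ (by decide)⟩]

def SG (g : Fin 3 → Fin m → Fin n) (hlt : ∀ l l' i j, l < l' → g l i < g l' j)
    (l : Fin 3) (p : Fin m × Fin m) (u : QQ n → ℝ) : ℝ := u (eG g hlt l p)

lemma eG_inj (hg : Function.Injective (fun p : (_ : Fin 3) × Fin m => g p.1 p.2)) :
    Function.Injective (fun p : (_ : Fin 3) × (Fin m × Fin m) => eG g hlt p.1 p.2) := by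
  have h : ∀ l l' i j, g l i = g l' j → l = l' ∧ i = j := fun l l' i j h => by
    have := @hg ⟨l, i⟩ ⟨l', j⟩ h
    simpa using this
  rintro ⟨l, ⟨a, b⟩⟩ ⟨l', ⟨a', b'⟩⟩ he
  fin_cases l <;> fin_cases l' <;> simp [eG] at he ⊢ <;>
    (have h1 := h _ _ _ _ he.1; have h2 := h _ _ _ _ he.2; simp at h1 h2) <;> simp [h1, h2]

noncomputable abbrev gLaw (n : ℕ) : Measure (QQ n → ℝ) := rowLaw (QQ n) (gaussianReal 0 1)

lemma gauss_sq : ∫ x, x ^ 2 ∂(gaussianReal 0 1) = 1 := by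
  have h := variance_id_gaussianReal (μ := 0) (v := 1)
  rw [variance_eq_sub (memLp_id_gaussianReal 2)] at h
  simpa using h

lemma SG_memLp (l : Fin 3) (p : Fin m × Fin m) : MemLp (SG g hlt l p) 2 (gLaw n) :=
  (memLp_id_gaussianReal 2).comp_measurePreserving
    (measurePreserving_eval (fun _ : QQ n => gaussianReal 0 1) (eG g hlt l p))

lemma SG_meas (l : Fin 3) (p : Fin m × Fin m) : Measurable (SG g hlt l p) := by
  unfold SG; fun_prop

lemma SG_indep (hg : Function.Injective (fun p : (_ : Fin 3) × Fin m => g p.1 p.2)) :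
    iIndepFun (fun l u p => SG g hlt l p u) (gLaw n) := by
  have h0 : iIndepFun (fun r (X : QQ n → ℝ) => X r) (gLaw n) :=
    iIndepFun_pi (X := fun _ x => x) (fun _ => aemeasurable_id)
  have h := h0.precomp (eG_inj g hlt hg)
  exact indep_curry (X := fun l p (u : QQ n → ℝ) => SG g hlt l p u) (SG_meas g hlt) h

lemma G_sq (hg : Function.Injective (fun p : (_ : Fin 3) × Fin m => g p.1 p.2)) :
    ∫ u, Tstat (SG g hlt) u ^ 2 ∂(gLaw n) ≤ (m : ℝ) ^ 3 := by
  rw [Tstat_sq (SG_meas g hlt) (SG_memLp g hlt) (SG_indep g hlt hg)]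
  have h1 : ∀ l p q, ∫ u, SG g hlt l p u * SG g hlt l q u ∂(gLaw n) =
      if p = q then 1 else 0 := by
    intro l p q
    unfold SG
    rw [row_mom2 (κ := QQ n) (gaussianReal 0 1) (by simp) gauss_sq]
    have : eG g hlt l p = eG g hlt l q ↔ p = q := by
      constructor
      · intro h
        have := @eG_inj _ _ g hlt hg ⟨l, p⟩ ⟨l, q⟩ h
        simpa using this
      · rintro rfl; rfl
    simp only [this]
  simp only [h1]
  have h2 : ∀ s t : Fin m × Fin m × Fin m, ∏ l, (if tri s l = tri t l then (1 : ℝ) else 0) =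
      if s = t then 1 else 0 := by
    intro s t
    split_ifs with h
    · subst h; simp
    · have : ∃ l, tri s l ≠ tri t l := by
        by_contra hc
        push Not at hc
        apply h
        have a1 := hc 0
        have a2 := hc 1
        obtain ⟨a, b, c⟩ := s
        obtain ⟨a', b', c'⟩ := t
        simp [tri] at a1 a2
        simp [a1, a2]
      obtain ⟨l, hl⟩ := this
      exact Finset.prod_eq_zero (Finset.mem_univ l) (by simp [hl])
  simp only [h2]
  simp only [Finset.sum_ite_eq, Finset.mem_univ, if_true, Finset.sum_const, Finset.card_univ,
    Fintype.card_prod, Fintype.card_fin, nsmul_eq_mul, mul_one]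
  push_cast
  apply le_of_eq; ring

/-- the test statistic on matrices -/
def stat (g : Fin 3 → Fin m → Fin n) (w : Fin n → Fin n → ℝ) : ℝ :=
  ∑ t : Fin m × Fin m × Fin m,
    w (g 2 t.2.2) (g 0 t.1) * w (g 0 t.1) (g 1 t.2.1) * w (g 1 t.2.1) (g 2 t.2.2)

lemma stat_meas : Measurable (stat g) := by
  unfold stat; fun_prop

lemma stat_G (u : QQ n → ℝ) :
    stat g (fun i j => if h : i < j then u ⟨(i, j), h⟩ else if h : j < i then u ⟨(j, i), h⟩ else 0)
      = Tstat (SG g hlt) u := by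
  unfold stat Tstat
  refine Finset.sum_congr rfl fun t _ => ?_
  have h01 := hlt 0 1 t.1 t.2.1 (by decide)
  have h12 := hlt 1 2 t.2.1 t.2.2 (by decide)
  have h02 := hlt 0 2 t.1 t.2.2 (by decide)
  simp [Fin.prod_univ_three, SG, eG, tri, h01, h12, h02, h02.not_gt]

lemma sum3 {α : Type*} [Fintype α] (f g h : α → ℝ) : (∑ i, f i) * (∑ i, g i) * (∑ i, h i) =
    ∑ t : α × α × α, f t.1 * g t.2.1 * h t.2.2 := by
  simp only [Fintype.sum_prod_type, mul_assoc, Finset.sum_mul_sum, ← Finset.mul_sum]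

lemma stat_W (hlt : ∀ l l' i j, l < l' → g l i < g l' j) (d : ℕ) (X : Fin n → Fin d → ℝ) :
    stat g (fun i j => if i = j then 0 else (∑ k, X i k * X j k) / Real.sqrt d) =
      Tstat (SW g) X / Real.sqrt d ^ 3 := by
  have h01 := fun i j => (hlt 0 1 i j (by decide))
  have h12 := fun i j => (hlt 1 2 i j (by decide))
  have h02 := fun i j => (hlt 0 2 i j (by decide))
  have e1 : stat g (fun i j => if i = j then 0 else (∑ k, X i k * X j k) / Real.sqrt d) =
      ∑ t : Fin m × Fin m × Fin m, (∑ c, X (g 2 t.2.2) c * X (g 0 t.1) c) *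
        (∑ a, X (g 0 t.1) a * X (g 1 t.2.1) a) * (∑ b, X (g 1 t.2.1) b * X (g 2 t.2.2) b) /
          Real.sqrt d ^ 3 := by
    unfold stat
    refine Finset.sum_congr rfl fun t _ => ?_
    simp only [(h01 _ _).ne, (h12 _ _).ne, (h02 _ _).ne', if_false]
    ring
  rw [e1, ← Finset.sum_div]
  congr 1
  have e2 : Tstat (SW g) X = ∑ t : Fin d × Fin d × Fin d,
      (∑ i, X (g 0 i) t.2.2 * X (g 0 i) t.1) * (∑ i, X (g 1 i) t.1 * X (g 1 i) t.2.1) *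
        (∑ i, X (g 2 i) t.2.1 * X (g 2 i) t.2.2) := by
    unfold Tstat SW
    simp [Fin.prod_univ_three, tri]
  rw [e2]
  have e3 : ∀ t : Fin m × Fin m × Fin m, (∑ c, X (g 2 t.2.2) c * X (g 0 t.1) c) *
        (∑ a, X (g 0 t.1) a * X (g 1 t.2.1) a) * (∑ b, X (g 1 t.2.1) b * X (g 2 t.2.2) b) =
        (∑ a, X (g 0 t.1) a * X (g 1 t.2.1) a) * (∑ b, X (g 1 t.2.1) b * X (g 2 t.2.2) b) *
        (∑ c, X (g 2 t.2.2) c * X (g 0 t.1) c) := fun t => by ring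
  simp only [e3, sum3]
  rw [Finset.sum_comm]
  refine Finset.sum_congr rfl fun t _ => Finset.sum_congr rfl fun s _ => ?_
  ring

end Gauss

section Main

lemma cheb {Ω : Type*} {mΩ : MeasurableSpace Ω} {P : Measure Ω} [IsProbabilityMeasure P]
    {Y : Ω → ℝ} (hY : MemLp Y 2 P) {c : ℝ} (hc : 0 < c) :
    P.real {ω | c ≤ |Y ω|} ≤ (∫ ω, Y ω ^ 2 ∂P) / c ^ 2 := by
  have h := mul_meas_ge_le_integral_of_nonneg (μ := P) (f := fun ω => Y ω ^ 2)
    (ae_of_all _ fun ω => sq_nonneg _) hY.integrable_sq (c ^ 2)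
  rw [le_div_iff₀ (by positivity), mul_comm]
  have e : {ω | c ≤ |Y ω|} = {ω | c ^ 2 ≤ Y ω ^ 2} := by
    apply Set.ext
    intro ω
    show c ≤ |Y ω| ↔ c ^ 2 ≤ Y ω ^ 2
    rw [← sq_abs (Y ω)]
    exact (pow_le_pow_iff_left₀ hc.le (abs_nonneg _) (by norm_num)).symm
  rw [e]
  exact h

lemma tv_le_one {Ω : Type*} [MeasurableSpace Ω] (μ ν : Measure Ω) [IsProbabilityMeasure μ]
    [IsProbabilityMeasure ν] (A : Set Ω) : |(μ A).toReal - (ν A).toReal| ≤ 1 := by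
  have h1 : (μ A).toReal ≤ 1 := measureReal_le_one
  have h2 : (ν A).toReal ≤ 1 := measureReal_le_one
  have h3 : 0 ≤ (μ A).toReal := ENNReal.toReal_nonneg
  have h4 : 0 ≤ (ν A).toReal := ENNReal.toReal_nonneg
  rw [abs_le]; constructor <;> linarith

lemma tvDist_le_one {Ω : Type*} [MeasurableSpace Ω] (μ ν : Measure Ω) [IsProbabilityMeasure μ]
    [IsProbabilityMeasure ν] : tvDist μ ν ≤ 1 := by
  have : Nonempty {A : Set Ω // MeasurableSet A} := ⟨⟨∅, MeasurableSet.empty⟩⟩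
  exact ciSup_le fun A => tv_le_one μ ν A

lemma le_tvDist {Ω : Type*} [MeasurableSpace Ω] (μ ν : Measure Ω) [IsProbabilityMeasure μ]
    [IsProbabilityMeasure ν] (A : Set Ω) (hA : MeasurableSet A) :
    μ.real A - ν.real A ≤ tvDist μ ν := by
  refine (le_abs_self _).trans ?_
  refine le_ciSup (f := fun A : {A : Set Ω // MeasurableSet A} =>
    |(μ A).toReal - (ν A).toReal|) ⟨1, ?_⟩ ⟨A, hA⟩
  rintro _ ⟨B, rfl⟩
  exact tv_le_one μ ν B

lemma W_map_meas (n d : ℕ) : Measurable (fun X : Fin n → Fin d → ℝ => fun i j =>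
      if i = j then 0 else (∑ k, X i k * X j k) / Real.sqrt d) := by
  refine measurable_pi_lambda _ fun i => measurable_pi_lambda _ fun j => ?_
  split_ifs <;> fun_prop

lemma G_map_meas (n : ℕ) : Measurable (fun u : QQ n → ℝ => fun i j =>
      if h : i < j then u ⟨(i, j), h⟩ else if h : j < i then u ⟨(j, i), h⟩ else 0) := by
  refine measurable_pi_lambda _ fun i => measurable_pi_lambda _ fun j => ?_
  split_ifs <;> fun_prop

instance (μ : Measure ℝ) [IsProbabilityMeasure μ] (n d : ℕ) :
    IsProbabilityMeasure (scaledWishartLaw μ n d) :=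
  Measure.isProbabilityMeasure_map (W_map_meas n d).aemeasurable

instance (n : ℕ) : IsProbabilityMeasure (goeZeroDiagLaw n) :=
  Measure.isProbabilityMeasure_map (G_map_meas n).aemeasurable

lemma tv_lower (μ : Measure ℝ) [IsProbabilityMeasure μ]
    (hmean : ∫ x, x ∂μ = 0) (hvar : ∫ x, x ^ 2 ∂μ = 1)
    (hmom4 : Integrable (fun x => x ^ 4) μ) {n m d : ℕ} (hm : 1 ≤ m) (hd : 1 ≤ d)
    (hnm : 3 * m ≤ n) :
    1 - (96 * (∫ x, x ^ 4 ∂μ) ^ 3 * (1 / m + d / (m : ℝ) ^ 3) + 4 * (d / (m : ℝ) ^ 3)) ≤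
      tvDist (scaledWishartLaw μ n d) (goeZeroDiagLaw n) := by
  let g : Fin 3 → Fin m → Fin n := fun l i => ⟨l.1 * m + i.1, by
    have h1 := l.2
    have h2 := i.2
    have h3 : l.1 * m ≤ 2 * m := Nat.mul_le_mul_right _ (by omega)
    omega⟩
  have hlt : ∀ l l' i j, l < l' → g l i < g l' j := by
    intro l l' i j h
    have h' : l.1 + 1 ≤ l'.1 := h
    have h3 : (l.1 + 1) * m ≤ l'.1 * m := Nat.mul_le_mul_right _ h'
    have h2 := i.2
    show l.1 * m + i.1 < l'.1 * m + j.1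
    rw [add_mul] at h3
    omega
  have hg : Function.Injective (fun p : (_ : Fin 3) × Fin m => g p.1 p.2) := by
    rintro ⟨l, i⟩ ⟨l', j⟩ h
    simp only at h
    rcases lt_trichotomy l l' with h1 | h1 | h1
    · exact absurd h (hlt _ _ _ _ h1).ne
    · subst h1
      have : l.1 * m + i.1 = l.1 * m + j.1 := congrArg Fin.val h
      have : i = j := Fin.ext (by omega)
      rw [this]
    · exact absurd h (hlt _ _ _ _ h1).ne'
  have hd0 : (0 : ℝ) < d := by exact_mod_cast hd
  have hm0 : (0 : ℝ) < m := by exact_mod_cast hm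
  have hs : 0 < Real.sqrt d := Real.sqrt_pos.2 hd0
  set τ : ℝ := (m : ℝ) ^ 3 * d / 2 / Real.sqrt d ^ 3 with hτ
  have hτ0 : 0 < τ := by positivity
  have hA : MeasurableSet {w | τ < stat g w} := measurableSet_lt measurable_const (stat_meas g)
  refine le_trans ?_ (le_tvDist _ _ {w | τ < stat g w} hA)
  -- Gaussian side
  have hG : (goeZeroDiagLaw n).real {w | τ < stat g w} ≤ 4 * (d / (m : ℝ) ^ 3) := by
    have h1 : (goeZeroDiagLaw n).real {w | τ < stat g w} =
        (gLaw n).real {u | τ < Tstat (SG g hlt) u} := by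
      unfold goeZeroDiagLaw
      rw [map_measureReal_apply (G_map_meas n) hA]
      simp only [Set.preimage_ofPred_eq, stat_G g hlt]
    rw [h1]
    have h2 : (gLaw n).real {u | τ < Tstat (SG g hlt) u} ≤
        (gLaw n).real {u | τ ≤ |Tstat (SG g hlt) u|} :=
      measureReal_mono fun u (hu : τ < _) => (hu.le.trans (le_abs_self _))
    have h3 := cheb (Tstat_memLp (SG_meas g hlt) (SG_memLp g hlt) (SG_indep g hlt hg)) hτ0
    refine h2.trans (h3.trans ?_)
    refine (div_le_div_of_nonneg_right (G_sq g hlt hg) (by positivity)).trans (le_of_eq ?_)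
    have h4 : τ ^ 2 = (m : ℝ) ^ 6 / (4 * d) := by
      have : (Real.sqrt d ^ 3) ^ 2 = (d : ℝ) ^ 3 := by
        rw [← pow_mul, mul_comm, pow_mul, Real.sq_sqrt hd0.le]
      rw [hτ, div_pow, this]
      field_simp
      ring
    rw [h4]
    field_simp
  -- Wishart side
  have hW : 1 - 96 * (∫ x, x ^ 4 ∂μ) ^ 3 * (1 / m + d / (m : ℝ) ^ 3) ≤
      (scaledWishartLaw μ n d).real {w | τ < stat g w} := by
    have h1 : (scaledWishartLaw μ n d).real {w | τ < stat g w} =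
        (dataLaw (Fin d) μ n).real {X | (m : ℝ) ^ 3 * d / 2 < Tstat (SW g) X} := by
      unfold scaledWishartLaw
      rw [map_measureReal_apply (W_map_meas n d) hA]
      simp only [Set.preimage_ofPred_eq, stat_W g hlt, hτ]
      congr 1
      ext X
      simp only [Set.mem_ofPred_eq]
      exact div_lt_div_iff_of_pos_right (by positivity)
    have hT := Tstat_memLp (SW_meas (κ := Fin d) g) (SW_memLp μ g hmom4) (SW_indep μ g hg)
    have hTm : Measurable (Tstat (SW (κ := Fin d) g)) := by
      have := SW_meas (κ := Fin d) g
      unfold Tstat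
      fun_prop
    set e : ℝ := (m : ℝ) ^ 3 * d with he
    have he0 : 0 < e := by positivity
    have hmn : ∫ X, Tstat (SW (κ := Fin d) g) X ∂(dataLaw (Fin d) μ n) = e := by
      rw [W_mean μ g hmean hvar hmom4 hg, Fintype.card_fin]
    have hsq := W_sq (κ := Fin d) μ g hmean hvar hmom4 hg hm (by simpa using hd)
    rw [Fintype.card_fin] at hsq
    have hY : MemLp (fun X => Tstat (SW (κ := Fin d) g) X - e) 2 (dataLaw (Fin d) μ n) :=
      hT.sub (memLp_const e)
    have hc := cheb hY (c := e / 2) (by positivity)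
    have hv : ∫ X, (Tstat (SW (κ := Fin d) g) X - e) ^ 2 ∂(dataLaw (Fin d) μ n) =
        ∫ X, Tstat (SW (κ := Fin d) g) X ^ 2 ∂(dataLaw (Fin d) μ n) - e ^ 2 := by
      have : ∀ X, (Tstat (SW (κ := Fin d) g) X - e) ^ 2 =
          Tstat (SW (κ := Fin d) g) X ^ 2 - (2 * e * Tstat (SW (κ := Fin d) g) X - e ^ 2) :=
        fun X => by ring
      simp_rw [this]
      have hi := hT.integrable (by norm_num)
      rw [integral_sub (g := fun X => 2 * e * Tstat (SW (κ := Fin d) g) X - e ^ 2)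
        hT.integrable_sq ((hi.const_mul _).sub (integrable_const _)),
        integral_sub (hi.const_mul _) (integrable_const _), integral_const_mul, hmn]
      simp
      ring
    have hcompl : (dataLaw (Fin d) μ n).real {X | e / 2 < Tstat (SW g) X} =
        1 - (dataLaw (Fin d) μ n).real {X | e / 2 < Tstat (SW g) X}ᶜ := by
      rw [probReal_compl_eq_one_sub (measurableSet_lt measurable_const hTm)]
      ring
    have hsub : (dataLaw (Fin d) μ n).real {X | e / 2 < Tstat (SW g) X}ᶜ ≤
        (dataLaw (Fin d) μ n).real {X | e / 2 ≤ |Tstat (SW g) X - e|} := by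
      refine measureReal_mono (fun X hX => ?_) (measure_ne_top _ _)
      simp only [Set.mem_compl_iff, Set.mem_ofPred_eq, not_lt] at hX ⊢
      rw [abs_sub_comm]
      exact le_trans (by linarith) (le_abs_self _)
    rw [h1, hcompl]
    have hfin : (∫ X, (Tstat (SW (κ := Fin d) g) X - e) ^ 2 ∂(dataLaw (Fin d) μ n)) / (e / 2) ^ 2 ≤
        96 * (∫ x, x ^ 4 ∂μ) ^ 3 * (1 / m + d / (m : ℝ) ^ 3) := by
      rw [div_le_iff₀ (by positivity), hv]
      have : 96 * (∫ x, x ^ 4 ∂μ) ^ 3 * (1 / m + d / (m : ℝ) ^ 3) * (e / 2) ^ 2 =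
          24 * (∫ x, x ^ 4 ∂μ) ^ 3 * ((m : ℝ) ^ 5 * (d : ℝ) ^ 2 + (m : ℝ) ^ 3 * (d : ℝ) ^ 3) := by
        rw [he]
        field_simp
        ring
      rw [this]
      have : e ^ 2 = (m : ℝ) ^ 6 * (d : ℝ) ^ 2 := by rw [he]; ring
      linarith
    linarith
  linarith

end Main
/-- If `μ` is a probability measure on `ℝ` with mean 0, variance 1 and finite fourth
moment, and `d_n/n³ → 0`, then `TV(𝒲_{n,d_n}, 𝒢_n) → 1`. -/
theorem tv_scaled_wishart_goe_tendsto_one (μ : Measure ℝ) [IsProbabilityMeasure μ]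
    (hmean : ∫ x, x ∂μ = 0) (hvar : ∫ x, x ^ 2 ∂μ = 1)
    (hmom4 : Integrable (fun x => x ^ 4) μ)
    (d : ℕ → ℕ) (hd : ∀ n, 0 < d n)
    (hdim : Tendsto (fun n => (d n : ℝ) / (n : ℝ) ^ 3) atTop (𝓝 0)) :
    Tendsto (fun n => tvDist (scaledWishartLaw μ n (d n)) (goeZeroDiagLaw n)) atTop (𝓝 1) := by
  set K := ∫ x, x ^ 4 ∂μ with hK
  have hmT : Tendsto (fun n : ℕ => n / 3) atTop atTop :=
    Nat.tendsto_div_const_atTop (by norm_num)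
  have t1 : Tendsto (fun n : ℕ => 1 / ((n / 3 : ℕ) : ℝ)) atTop (𝓝 0) :=
    (tendsto_const_nhds (x := (1 : ℝ))).div_atTop (tendsto_natCast_atTop_atTop.comp hmT)
  have hge : ∀ᶠ n : ℕ in atTop, 3 ≤ n := eventually_ge_atTop 3
  have t2 : Tendsto (fun n : ℕ => (d n : ℝ) / ((n / 3 : ℕ) : ℝ) ^ 3) atTop (𝓝 0) := by
    have h216 : Tendsto (fun n => 216 * ((d n : ℝ) / (n : ℝ) ^ 3)) atTop (𝓝 0) := by
      simpa using hdim.const_mul 216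
    refine squeeze_zero' (Eventually.of_forall fun n => by positivity) ?_ h216
    filter_upwards [hge] with n hn
    have h1 : 1 ≤ n / 3 := by omega
    have h2 : n ≤ 6 * (n / 3) := by omega
    have h1' : (1 : ℝ) ≤ ((n / 3 : ℕ) : ℝ) := by exact_mod_cast h1
    have h2' : (n : ℝ) ≤ 6 * ((n / 3 : ℕ) : ℝ) := by exact_mod_cast h2
    have h3 : (0 : ℝ) < n := by exact_mod_cast (by omega : 0 < n)
    have h4 : (n : ℝ) ^ 3 ≤ (6 * ((n / 3 : ℕ) : ℝ)) ^ 3 := by gcongr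
    rw [← mul_div_assoc, div_le_div_iff₀ (by positivity) (by positivity)]
    have h5 : (d n : ℝ) * (n : ℝ) ^ 3 ≤ d n * (6 * ((n / 3 : ℕ) : ℝ)) ^ 3 := by gcongr
    nlinarith
  have t3 : Tendsto (fun n : ℕ => 1 - (96 * K ^ 3 * (1 / ((n / 3 : ℕ) : ℝ) +
      (d n : ℝ) / ((n / 3 : ℕ) : ℝ) ^ 3) + 4 * ((d n : ℝ) / ((n / 3 : ℕ) : ℝ) ^ 3))) atTop (𝓝 1) := by
    have := (((t1.add t2).const_mul (96 * K ^ 3)).add (t2.const_mul 4)).const_sub 1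
    simpa using this
  refine tendsto_of_tendsto_of_tendsto_of_le_of_le' t3 tendsto_const_nhds ?_
    (Eventually.of_forall fun n => tvDist_le_one _ _)
  filter_upwards [hge] with n hn
  exact tv_lower μ hmean hvar hmom4 (m := n / 3) (by omega) (hd n) (by omega)
end

section
/- Entropic central limit theorem: let Z₁, Z₂, … be i.i.d. real-valued random variables with law μ, mean 0, variance 1, and KL(μ ‖ γ₁) < ∞, where γ₁ is the standard Gaussian measure on ℝ. Let S_m = (Z₁ + ⋯ + Z_m)/√m and let μ_m denote the law of S_m. Then KL(μ_m ‖ γ₁) → 0 as m → ∞, and moreover KL(μ_{m+1} ‖ γ₁) ≤ KL(μ_m ‖ γ₁) for every m ≥ 1 (equivalently, the differential entropy of S_m increases monotonically to that of the standard Gaussian). -/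
open MeasureTheory ProbabilityTheory Filter
open scoped BigOperators ENNReal Topology Classical

/-- The Kullback–Leibler divergence `KL(ν ‖ λ) = ∫ log(dν/dλ) dν` when `ν ≪ λ` and the
log-likelihood ratio is integrable, and `+∞` otherwise. -/
noncomputable def klDiv {Ω : Type*} [MeasurableSpace Ω] (ν lam : Measure Ω) : ℝ≥0∞ :=
  if ν ≪ lam ∧ Integrable (fun x => Real.log (ν.rnDeriv lam x).toReal) ν then
    ENNReal.ofReal (∫ x, Real.log (ν.rnDeriv lam x).toReal ∂ν)
  else ⊤

/-- The law of `S_m = (Z₁ + ⋯ + Z_m)/√m` for `Z₁,…,Z_m` i.i.d. with law `μ`. -/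
noncomputable def normalizedSumLaw (μ : Measure ℝ) (m : ℕ) : Measure ℝ :=
  Measure.map (fun z : Fin m → ℝ => (∑ i, z i) / Real.sqrt m)
    (Measure.pi fun _ : Fin m => μ)

namespace ECLT

lemma integrable_of_sq {Ω : Type*} [MeasurableSpace Ω] {P : Measure Ω} [IsFiniteMeasure P]
    {f : Ω → ℝ} (hm : AEStronglyMeasurable f P) (h : Integrable (fun x => f x ^ 2) P) :
    Integrable f P :=
  ((memLp_two_iff_integrable_sq hm).2 h).integrable (by norm_num)

lemma var_identity {Ω : Type*} [MeasurableSpace Ω] {P : Measure Ω} [IsProbabilityMeasure P]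
    {f : Ω → ℝ} (hm : AEStronglyMeasurable f P) (h : Integrable (fun x => f x ^ 2) P) (c : ℝ) :
    ∫ x, (f x - c) ^ 2 ∂P = ∫ x, f x ^ 2 ∂P - 2 * c * ∫ x, f x ∂P + c ^ 2 := by
  have h1 := integrable_of_sq hm h
  have : ∀ x, (f x - c) ^ 2 = f x ^ 2 - 2 * c * f x + c ^ 2 := fun x => by ring
  have h3 : Integrable (fun x => f x ^ 2 - 2 * c * f x) P := h.sub (h1.const_mul _)
  simp_rw [this]
  rw [integral_add h3 (integrable_const _), integral_sub h (h1.const_mul _), integral_const_mul]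
  simp

lemma sq_integral_le {Ω : Type*} [MeasurableSpace Ω] {P : Measure Ω} [IsProbabilityMeasure P]
    {f : Ω → ℝ} (hm : AEStronglyMeasurable f P) (h : Integrable (fun x => f x ^ 2) P) :
    (∫ x, f x ∂P) ^ 2 ≤ ∫ x, f x ^ 2 ∂P := by
  have := var_identity hm h (∫ x, f x ∂P)
  have h2 : 0 ≤ ∫ x, (f x - ∫ x, f x ∂P) ^ 2 ∂P := integral_nonneg fun x => sq_nonneg _
  nlinarith

lemma integrable_sq_integral {α β : Measure ℝ} [IsProbabilityMeasure α] [IsProbabilityMeasure β]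
    {F : ℝ × ℝ → ℝ} (hF : Measurable F) (h : Integrable (fun p => F p ^ 2) (α.prod β)) :
    Integrable (fun x => (∫ y, F (x, y) ∂β) ^ 2) α := by
  have h2 : Integrable (fun x => ∫ y, F (x, y) ^ 2 ∂β) α := h.integral_prod_left
  refine h2.mono' ?_ ?_
  · exact (hF.stronglyMeasurable.integral_prod_right'.pow 2).aestronglyMeasurable
  · filter_upwards [h.prod_right_ae] with x hx
    rw [Real.norm_eq_abs, abs_of_nonneg (sq_nonneg _)]
    exact sq_integral_le (hF.comp (by fun_prop)).aestronglyMeasurable hx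

lemma two_var {α β : Measure ℝ} [IsProbabilityMeasure α] [IsProbabilityMeasure β]
    {F : ℝ × ℝ → ℝ} (hF : Measurable F) (h : Integrable (fun p => F p ^ 2) (α.prod β)) :
    ∫ y, (∫ x, F (x, y) ∂α) ^ 2 ∂β - (∫ x, ∫ y, F (x, y) ∂β ∂α) ^ 2 ≤
      ∫ x, ∫ y, F (x, y) ^ 2 ∂β ∂α - ∫ x, (∫ y, F (x, y) ∂β) ^ 2 ∂α := by
  set a : ℝ → ℝ := fun x => ∫ y, F (x, y) ∂β with ha
  set b : ℝ → ℝ := fun y => ∫ x, F (x, y) ∂α with hb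
  set M := ∫ x, a x ∂α with hM
  have hFi : Integrable F (α.prod β) := integrable_of_sq hF.aestronglyMeasurable h
  have ham : Measurable a := (hF.stronglyMeasurable.integral_prod_right').measurable
  have hbm : Measurable b := (hF.stronglyMeasurable.integral_prod_left').measurable
  have ha2 : Integrable (fun x => a x ^ 2) α := integrable_sq_integral hF h
  have hai := integrable_of_sq ham.aestronglyMeasurable ha2
  have hb2 : Integrable (fun x => b x ^ 2) β :=
    integrable_sq_integral (F := fun p => F (p.2, p.1)) (hF.comp (by fun_prop)) h.swap
  have hMb : ∫ y, b y ∂β = M := (integral_integral_swap (f := fun x y => F (x, y)) hFi).symm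
  have e1 : ∫ y, (b y) ^ 2 ∂β - M ^ 2 = ∫ y, (b y - M) ^ 2 ∂β := by
    rw [var_identity hbm.aestronglyMeasurable hb2, hMb]; ring
  have hG2 : Integrable (fun p : ℝ × ℝ => (F p - a p.1) ^ 2) (α.prod β) := by
    have h1 : MemLp F 2 (α.prod β) := (memLp_two_iff_integrable_sq hF.aestronglyMeasurable).2 h
    have h2 : MemLp (fun p : ℝ × ℝ => a p.1) 2 (α.prod β) :=
      (memLp_two_iff_integrable_sq (ham.comp measurable_fst).aestronglyMeasurable).2
        (ha2.comp_fst β)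
    exact (h1.sub h2).integrable_sq
  have hGm : Measurable (fun p : ℝ × ℝ => F p - a p.1) := hF.sub (ham.comp measurable_fst)
  have e2 : ∫ x, ∫ y, F (x, y) ^ 2 ∂β ∂α - ∫ x, a x ^ 2 ∂α
      = ∫ x, ∫ y, (F (x, y) - a x) ^ 2 ∂β ∂α := by
    rw [← integral_sub h.integral_prod_left ha2]
    refine integral_congr_ae ?_
    filter_upwards [h.prod_right_ae] with x hx
    rw [var_identity (f := fun y => F (x, y)) (hF.comp (by fun_prop)).aestronglyMeasurable hx]
    simp only [ha]; ring
  rw [e1, e2, integral_integral_swap (f := fun x y => (F (x, y) - a x) ^ 2) hG2]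
  refine integral_mono_ae ?_ hG2.integral_prod_right ?_
  · exact ((memLp_two_iff_integrable_sq hbm.aestronglyMeasurable).2 hb2).sub
      (memLp_const M) |>.integrable_sq
  · filter_upwards [hG2.prod_left_ae, hFi.prod_left_ae] with y hy hy2
    have : b y - M = ∫ x, (F (x, y) - a x) ∂α := by
      rw [integral_sub hy2 hai]
    rw [this]
    exact sq_integral_le (hGm.comp (by fun_prop : Measurable fun x => (x, y))).aestronglyMeasurable hy

/-- Convolution powers. -/
noncomputable def cp (ν : Measure ℝ) : ℕ → Measure ℝ
  | 0 => Measure.dirac 0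
  | n + 1 => cp ν n ∗ ν

instance cp_prob (ν : Measure ℝ) [IsProbabilityMeasure ν] (n : ℕ) :
    IsProbabilityMeasure (cp ν n) := by
  induction n with
  | zero => unfold cp; infer_instance
  | succ n ih => unfold cp; infer_instance

lemma cp_one (ν : Measure ℝ) [IsProbabilityMeasure ν] : cp ν 1 = ν := by
  simp [cp]

lemma integrable_conv_prod {α β : Measure ℝ} [IsProbabilityMeasure α] [IsProbabilityMeasure β]
    {g : ℝ → ℝ} (hi : Integrable g (α ∗ β)) :
    Integrable (fun p : ℝ × ℝ => g (p.1 + p.2)) (α.prod β) := by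
  unfold Measure.conv at hi
  exact (integrable_map_measure hi.1 (by fun_prop)).mp hi

lemma dks (ν : Measure ℝ) [IsProbabilityMeasure ν] (n : ℕ) : ∀ (g : ℝ → ℝ), Measurable g →
    Integrable (fun x => g x ^ 2) (cp ν (n + 1)) →
    ∫ x, g x ^ 2 ∂(cp ν (n + 1)) - (∫ x, g x ∂(cp ν (n + 1))) ^ 2 ≤
      (n + 1) * (∫ x, g x ^ 2 ∂(cp ν (n + 1)) -
        ∫ w, (∫ y, g (w + y) ∂ν) ^ 2 ∂(cp ν n)) := by
  induction n with
  | zero =>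
    intro g hg hi
    rw [zero_add, cp_one]
    have : cp ν 0 = Measure.dirac 0 := rfl
    rw [this, integral_dirac]
    simp
  | succ n ih =>
    intro g hg hi
    set α := cp ν (n + 1) with hα
    have hdef : cp ν (n + 1 + 1) = α ∗ ν := rfl
    rw [hdef] at hi ⊢
    have hgi : Integrable g (α ∗ ν) := integrable_of_sq hg.aestronglyMeasurable hi
    have hFm : Measurable (fun p : ℝ × ℝ => g (p.1 + p.2)) := hg.comp (by fun_prop)
    have hp := integrable_conv_prod hi
    have h2 := two_var hFm hp
    rw [integral_conv hi, integral_conv hgi]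
    -- integrate the induction hypothesis
    have hae : ∀ᵐ y ∂ν, Integrable (fun x => g (x + y) ^ 2) α := hp.prod_left_ae
    have hB : Integrable (fun w => (∫ y, g (w + y) ∂ν) ^ 2) α :=
      integrable_sq_integral hFm hp
    have hBp := integrable_conv_prod (α := cp ν n) (β := ν) hB
    have e1 : ∫ x, ∫ y, g (x + y) ^ 2 ∂ν ∂α = ∫ y, ∫ x, g (x + y) ^ 2 ∂α ∂ν :=
      integral_integral_swap (f := fun x y => g (x + y) ^ 2) hp
    have e2 : ∫ w, (∫ y, g (w + y) ∂ν) ^ 2 ∂α =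
        ∫ y, ∫ w, (∫ z, g (w + y + z) ∂ν) ^ 2 ∂(cp ν n) ∂ν := by
      have : α = cp ν n ∗ ν := rfl
      rw [this, integral_conv hB]
      exact integral_integral_swap (f := fun w y => (∫ z, g (w + y + z) ∂ν) ^ 2) hBp
    have hC : Integrable (fun y => (∫ x, g (x + y) ∂α) ^ 2) ν :=
      integrable_sq_integral (F := fun p => g (p.2 + p.1)) (hg.comp (by fun_prop)) hp.swap
    have hA : Integrable (fun y => ∫ x, g (x + y) ^ 2 ∂α) ν := hp.integral_prod_right
    have hBB : Integrable (fun y => ∫ w, (∫ z, g (w + y + z) ∂ν) ^ 2 ∂(cp ν n)) ν :=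
      hBp.integral_prod_right
    have key : ∫ y, ((∫ x, g (x + y) ^ 2 ∂α) - (∫ x, g (x + y) ∂α) ^ 2) ∂ν ≤
        ∫ y, ((n : ℝ) + 1) * ((∫ x, g (x + y) ^ 2 ∂α) -
          ∫ w, (∫ z, g (w + y + z) ∂ν) ^ 2 ∂(cp ν n)) ∂ν := by
      refine integral_mono_ae (hA.sub hC) ((hA.sub hBB).const_mul _) ?_
      filter_upwards [hae] with y hy
      have := ih (fun x => g (x + y)) (hg.comp (by fun_prop)) hy
      simp only [add_right_comm _ _ y] at this ⊢
      exact this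
    rw [integral_sub hA hC, integral_const_mul, integral_sub hA hBB, ← e1, ← e2] at key
    push_cast
    simp only at h2
    linarith

end ECLT

namespace ECLT

/-- Gaussian kernel of variance `s`. -/
noncomputable def k0 (s x : ℝ) : ℝ := (Real.sqrt (2 * Real.pi * s))⁻¹ * Real.exp (-x ^ 2 / (2 * s))
noncomputable def k1 (s x : ℝ) : ℝ := -(x / s) * k0 s x
noncomputable def k2 (s x : ℝ) : ℝ := (x ^ 2 / s ^ 2 - 1 / s) * k0 s x
noncomputable def kq (s x : ℝ) : ℝ := (x ^ 2 / s ^ 2) * k0 s x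
/-- Dominating function. -/
noncomputable def W (b x : ℝ) : ℝ := (1 + x ^ 2) * Real.exp (-x ^ 2 / (2 * b))
noncomputable def Ac (a : ℝ) : ℝ := (Real.sqrt (2 * Real.pi * a))⁻¹ * (1 + 1 / a + 1 / a ^ 2)

lemma k0_pos {s : ℝ} (hs : 0 < s) (x : ℝ) : 0 < k0 s x := by
  unfold k0; positivity

lemma k0_le {s : ℝ} (hs : 0 < s) (x : ℝ) : k0 s x ≤ (Real.sqrt (2 * Real.pi * s))⁻¹ := by
  unfold k0
  have : Real.exp (-x ^ 2 / (2 * s)) ≤ 1 := by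
    rw [Real.exp_le_one_iff]
    exact div_nonpos_of_nonpos_of_nonneg (by nlinarith [sq_nonneg x]) (by positivity)
  have h2 : 0 < (Real.sqrt (2 * Real.pi * s))⁻¹ := by positivity
  nlinarith

lemma k0_eq {s : ℝ} (hs : 0 < s) (x y : ℝ) :
    gaussianPDFReal y s.toNNReal x = k0 s (x - y) := by
  simp [gaussianPDFReal, k0, hs.le]

lemma W_nonneg (b x : ℝ) : 0 ≤ W b x := by unfold W; positivity

lemma Ac_pos {a : ℝ} (ha : 0 < a) : 0 < Ac a := by unfold Ac; positivity

lemma k0_le' {a b s : ℝ} (ha : 0 < a) (h1 : a ≤ s) (h2 : s ≤ b) (x : ℝ) :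
    k0 s x ≤ (Real.sqrt (2 * Real.pi * a))⁻¹ * Real.exp (-x ^ 2 / (2 * b)) := by
  have hs : 0 < s := ha.trans_le h1
  have hb : 0 < b := hs.trans_le h2
  unfold k0
  have e1 : (Real.sqrt (2 * Real.pi * s))⁻¹ ≤ (Real.sqrt (2 * Real.pi * a))⁻¹ := by
    gcongr
  have e2 : Real.exp (-x ^ 2 / (2 * s)) ≤ Real.exp (-x ^ 2 / (2 * b)) := by
    rw [Real.exp_le_exp, neg_div, neg_div]
    gcongr
  gcongr

lemma kbound_aux {a b s c : ℝ} (ha : 0 < a) (h1 : a ≤ s) (h2 : s ≤ b) (x : ℝ)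
    (hc : |c| ≤ (1 + 1 / a + 1 / a ^ 2) * (1 + x ^ 2)) :
    |c * k0 s x| ≤ Ac a * W b x := by
  have hs : 0 < s := ha.trans_le h1
  rw [abs_mul, abs_of_pos (k0_pos hs x)]
  have := k0_le' ha h1 h2 x
  calc |c| * k0 s x ≤ ((1 + 1 / a + 1 / a ^ 2) * (1 + x ^ 2)) *
        ((Real.sqrt (2 * Real.pi * a))⁻¹ * Real.exp (-x ^ 2 / (2 * b))) := by
        have := k0_pos hs x
        gcongr
    _ = _ := by unfold Ac W; ring

lemma k0_bd {a b s : ℝ} (ha : 0 < a) (h1 : a ≤ s) (h2 : s ≤ b) (x : ℝ) :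
    |k0 s x| ≤ Ac a * W b x := by
  have := kbound_aux (c := 1) ha h1 h2 x (by
    rw [abs_one]
    have : 0 < 1 / a := by positivity
    have : 0 < 1 / a ^ 2 := by positivity
    nlinarith [sq_nonneg x])
  simpa using this

lemma k1_bd {a b s : ℝ} (ha : 0 < a) (h1 : a ≤ s) (h2 : s ≤ b) (x : ℝ) :
    |k1 s x| ≤ Ac a * W b x := by
  refine kbound_aux ha h1 h2 x ?_
  have hs : 0 < s := ha.trans_le h1
  rw [abs_neg, abs_div, abs_of_pos hs]
  have e1 : |x| / s ≤ |x| * (1 / a) := by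
    rw [div_eq_mul_one_div]; gcongr
  have e2 : |x| ≤ 1 + x ^ 2 := by
    rw [← sq_abs]; nlinarith [sq_nonneg (|x| - 1), abs_nonneg x]
  have : 0 < 1 / a := by positivity
  have : 0 < 1 / a ^ 2 := by positivity
  nlinarith [sq_nonneg x]

lemma kq_bd {a b s : ℝ} (ha : 0 < a) (h1 : a ≤ s) (h2 : s ≤ b) (x : ℝ) :
    |kq s x| ≤ Ac a * W b x := by
  refine kbound_aux ha h1 h2 x ?_
  have hs : 0 < s := ha.trans_le h1
  rw [abs_of_nonneg (by positivity)]
  have e1 : x ^ 2 / s ^ 2 ≤ x ^ 2 * (1 / a ^ 2) := by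
    rw [div_eq_mul_one_div]; gcongr
  have : 0 < 1 / a := by positivity
  have : 0 < 1 / a ^ 2 := by positivity
  nlinarith [sq_nonneg x]

lemma k2_bd {a b s : ℝ} (ha : 0 < a) (h1 : a ≤ s) (h2 : s ≤ b) (x : ℝ) :
    |k2 s x| ≤ Ac a * W b x := by
  refine kbound_aux ha h1 h2 x ?_
  have hs : 0 < s := ha.trans_le h1
  have e1 : x ^ 2 / s ^ 2 ≤ x ^ 2 * (1 / a ^ 2) := by
    rw [div_eq_mul_one_div]; gcongr
  have e3 : 1 / s ≤ 1 / a := by gcongr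
  have : 0 < 1 / a := by positivity
  have : 0 < 1 / a ^ 2 := by positivity
  have : 0 < 1 / s := by positivity
  have : 0 ≤ x ^ 2 / s ^ 2 := by positivity
  rw [abs_le]
  constructor <;> nlinarith [sq_nonneg x]

lemma W_le {b : ℝ} (hb : 0 < b) (x : ℝ) : W b x ≤ 1 + 2 * b := by
  unfold W
  have h := Real.add_one_le_exp (x ^ 2 / (2 * b))
  rw [neg_div, Real.exp_neg]
  have hp := Real.exp_pos (x ^ 2 / (2 * b))
  rw [← div_eq_mul_inv, div_le_iff₀ hp]
  have h0 : 0 ≤ x ^ 2 / (2 * b) := by positivity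
  have h1 : x ^ 2 = 2 * b * (x ^ 2 / (2 * b)) := by field_simp
  set t := x ^ 2 / (2 * b)
  rw [h1]
  nlinarith

lemma cont_k0 (s : ℝ) : Continuous (k0 s) := by unfold k0; fun_prop
lemma cont_k1 (s : ℝ) : Continuous (k1 s) := by unfold k1 k0; fun_prop
lemma cont_k2 (s : ℝ) : Continuous (k2 s) := by unfold k2 k0; fun_prop
lemma cont_kq (s : ℝ) : Continuous (kq s) := by unfold kq k0; fun_prop
lemma cont_W (s : ℝ) : Continuous (W s) := by unfold W; fun_prop

lemma integrable_pow_exp {b : ℝ} (hb : 0 < b) (n : ℕ) :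
    Integrable (fun x : ℝ => x ^ n * Real.exp (-x ^ 2 / (2 * b))) := by
  have := integrable_rpow_mul_exp_neg_mul_sq (b := 1 / (2 * b)) (by positivity) (s := n)
    (by have : (0 : ℝ) ≤ n := by positivity
        linarith)
  refine this.congr (Eventually.of_forall fun x => ?_)
  simp only [Real.rpow_natCast]
  congr 2; ring

lemma integrable_W' {b : ℝ} (hb : 0 < b) : Integrable (fun x => (1 + x ^ 2) * W b x) := by
  have h := ((integrable_pow_exp hb 0).add ((integrable_pow_exp hb 2).const_mul 2)).add
    (integrable_pow_exp hb 4)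
  refine h.congr (Eventually.of_forall fun x => ?_)
  simp only [Pi.add_apply, W]; ring

lemma integrable_W {b : ℝ} (hb : 0 < b) : Integrable (W b) := by
  refine (integrable_W' hb).mono' (cont_W b).aestronglyMeasurable (Eventually.of_forall fun x => ?_)
  rw [Real.norm_eq_abs, abs_of_nonneg (W_nonneg _ _)]
  nlinarith [W_nonneg b x, sq_nonneg x]

lemma hasDerivAt_k0 {s : ℝ} (hs : 0 < s) (x : ℝ) : HasDerivAt (k0 s) (k1 s x) x := by
  have h : HasDerivAt (fun x : ℝ => -x ^ 2 / (2 * s)) (-(x / s)) x := by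
    have := ((hasDerivAt_pow 2 x).neg).div_const (2 * s)
    convert! this using 1
    field_simp; ring
  have := (h.exp).const_mul ((Real.sqrt (2 * Real.pi * s))⁻¹)
  convert! this using 1
  unfold k1 k0; ring

lemma hasDerivAt_k1 {s : ℝ} (hs : 0 < s) (x : ℝ) : HasDerivAt (k1 s) (k2 s x) x := by
  have h1 : HasDerivAt (fun x : ℝ => -(x / s)) (-(1 / s)) x := ((hasDerivAt_id x).div_const s).neg
  have := h1.mul (hasDerivAt_k0 hs x)
  convert! this using 1
  unfold k1 k2; ring

lemma hasDerivAt_k0_s {s : ℝ} (hs : 0 < s) (x : ℝ) :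
    HasDerivAt (fun s => k0 s x) (k2 s x / 2) s := by
  have hpi := Real.pi_pos
  have h1 : HasDerivAt (fun s : ℝ => 2 * Real.pi * s) (2 * Real.pi) s := by
    simpa using (hasDerivAt_id s).const_mul (2 * Real.pi)
  have hq : Real.sqrt (2 * Real.pi * s) ≠ 0 := by positivity
  have h2 := (h1.sqrt (by positivity)).inv hq
  have h3 : HasDerivAt (fun s : ℝ => -x ^ 2 / (2 * s)) (x ^ 2 / (2 * s ^ 2)) s := by
    have hh : HasDerivAt (fun s : ℝ => 2 * s) 2 s := by simpa using (hasDerivAt_id s).const_mul 2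
    have := (hasDerivAt_const s (-x ^ 2)).div hh (by positivity)
    convert! this using 1
    field_simp; ring
  have := h2.mul h3.exp
  convert! this using 1
  unfold k2 k0
  have hsq : Real.sqrt (2 * Real.pi * s) ^ 2 = 2 * Real.pi * s := Real.sq_sqrt (by positivity)
  rw [hsq]
  simp only [Pi.inv_apply]
  field_simp
  ring

end ECLT

namespace ECLT

/-- Convolution of a kernel with a measure. -/
noncomputable def dn (k : ℝ → ℝ) (P : Measure ℝ) (x : ℝ) : ℝ := ∫ y, k (x - y) ∂P

section
variable {P : Measure ℝ} [IsProbabilityMeasure P]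

lemma int_k {k : ℝ → ℝ} (hk : Continuous k) {C : ℝ} (hC : ∀ x, |k x| ≤ C) (x : ℝ) :
    Integrable (fun y => k (x - y)) P :=
  Integrable.of_bound (by fun_prop) C (Eventually.of_forall fun y => hC _)

lemma cont_dn {k : ℝ → ℝ} (hk : Continuous k) {C : ℝ} (hC : ∀ x, |k x| ≤ C) :
    Continuous (dn k P) := by
  unfold dn
  refine continuous_of_dominated (bound := fun _ => C) ?_ ?_ (integrable_const _) ?_
  · intro x; fun_prop
  · intro x; exact Eventually.of_forall fun y => hC _
  · exact Eventually.of_forall fun y => by fun_prop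

lemma hasDerivAt_dn {k k' : ℝ → ℝ} (hk : Continuous k) (hk' : Continuous k') {C C' : ℝ}
    (hC : ∀ x, |k x| ≤ C) (hC' : ∀ x, |k' x| ≤ C') (hd : ∀ x, HasDerivAt k (k' x) x) (x : ℝ) :
    HasDerivAt (dn k P) (dn k' P x) x := by
  unfold dn
  refine (hasDerivAt_integral_of_dominated_loc_of_deriv_le (bound := fun _ => C')
    (F := fun x y => k (x - y)) (F' := fun x y => k' (x - y)) (s := Set.univ) univ_mem
    ?_ (int_k hk hC x) ?_ ?_ (integrable_const _) ?_).2
  · exact Eventually.of_forall fun x => by fun_prop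
  · fun_prop
  · exact Eventually.of_forall fun y x _ => hC' _
  · refine Eventually.of_forall fun y x _ => ?_
    exact (hd (x - y)).comp_sub_const x y

lemma bdd_of {k : ℝ → ℝ} {a b : ℝ} (ha : 0 < a) (hb : 0 < b) (h : ∀ x, |k x| ≤ Ac a * W b x) (x : ℝ) :
    |k x| ≤ Ac a * (1 + 2 * b) := by
  have := W_le hb x
  have h2 := Ac_pos ha
  exact (h x).trans (by gcongr)

lemma bdd_k0 {s : ℝ} (hs : 0 < s) (x : ℝ) : |k0 s x| ≤ Ac s * (1 + 2 * s) :=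
  bdd_of hs hs (k0_bd hs le_rfl le_rfl) x
lemma bdd_k1 {s : ℝ} (hs : 0 < s) (x : ℝ) : |k1 s x| ≤ Ac s * (1 + 2 * s) :=
  bdd_of hs hs (k1_bd hs le_rfl le_rfl) x
lemma bdd_k2 {s : ℝ} (hs : 0 < s) (x : ℝ) : |k2 s x| ≤ Ac s * (1 + 2 * s) :=
  bdd_of hs hs (k2_bd hs le_rfl le_rfl) x
lemma bdd_kq {s : ℝ} (hs : 0 < s) (x : ℝ) : |kq s x| ≤ Ac s * (1 + 2 * s) :=
  bdd_of hs hs (kq_bd hs le_rfl le_rfl) x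
lemma bdd_W {s : ℝ} (hs : 0 < s) (x : ℝ) : |W s x| ≤ 1 + 2 * s := by
  rw [abs_of_nonneg (W_nonneg _ _)]; exact W_le hs x

lemma dn_pos {s : ℝ} (hs : 0 < s) (x : ℝ) : 0 < dn (k0 s) P x := by
  unfold dn
  rw [integral_pos_iff_support_of_nonneg (fun y => (k0_pos hs _).le)
    (int_k (cont_k0 s) (bdd_k0 hs) x)]
  have : Function.support (fun y => k0 s (x - y)) = Set.univ := by
    ext y; simp [(k0_pos hs (x - y)).ne']
  rw [this]; simp

lemma dn_k0_le {s : ℝ} (hs : 0 < s) (x : ℝ) : dn (k0 s) P x ≤ (Real.sqrt (2 * Real.pi * s))⁻¹ := by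
  unfold dn
  calc _ ≤ ∫ y, (Real.sqrt (2 * Real.pi * s))⁻¹ ∂P :=
        integral_mono (int_k (cont_k0 s) (bdd_k0 hs) x) (integrable_const _) fun y => k0_le hs _
    _ = _ := by simp

lemma dn_bd {k : ℝ → ℝ} {a b : ℝ} (hk : Continuous k) (ha : 0 < a) (hb : 0 < b)
    (h : ∀ x, |k x| ≤ Ac a * W b x) (x : ℝ) : |dn k P x| ≤ Ac a * dn (W b) P x := by
  unfold dn
  rw [← integral_const_mul]
  refine (abs_integral_le_integral_abs).trans ?_
  exact integral_mono (int_k hk (bdd_of ha hb h) x).abs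
    ((int_k (cont_W b) (bdd_W hb) x).const_mul _) fun y => h _

lemma dn_W_nonneg (b x : ℝ) : 0 ≤ dn (W b) P x := integral_nonneg fun _ => W_nonneg _ _

lemma integrable_prod_dn {k B : ℝ → ℝ} (hk : Integrable k) (hB : Integrable B P) :
    Integrable (fun p : ℝ × ℝ => B p.2 * k (p.1 - p.2)) (volume.prod P) := by
  have := Integrable.convolution_integrand (μ := (volume : Measure ℝ)) (ContinuousLinearMap.mul ℝ ℝ) hB hk
  simpa using this

lemma integrable_dn {k : ℝ → ℝ} (hk : Integrable k) : Integrable (dn k P) := by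
  have := (integrable_prod_dn (P := P) (B := fun _ => 1) hk (integrable_const _)).integral_prod_left
  simp only [one_mul] at this
  exact this

lemma integral_dn {k : ℝ → ℝ} (hk : Integrable k) : ∫ x, dn k P x = ∫ x, k x := by
  have h := integrable_prod_dn (P := P) (B := fun _ => 1) hk (integrable_const _)
  simp only [one_mul] at h
  unfold dn
  rw [integral_integral_swap (f := fun x y => k (x - y)) h]
  simp [integral_sub_right_eq_self]

lemma integrable_dn_W' {b : ℝ} (hb : 0 < b) (hP : Integrable (fun x => x ^ 2) P) :
    Integrable (fun x => (1 + x ^ 2) * dn (W b) P x) := by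
  have h := (integrable_prod_dn (P := P) (B := fun y => 2 * (1 + y ^ 2)) (integrable_W' hb)
    (((integrable_const 1).add hP).const_mul 2)).integral_prod_left
  refine h.mono' ?_ (Eventually.of_forall fun x => ?_)
  · have := cont_dn (P := P) (cont_W b) (bdd_W hb)
    fun_prop
  · rw [Real.norm_eq_abs, abs_of_nonneg (mul_nonneg (by positivity) (dn_W_nonneg _ _))]
    unfold dn
    rw [← integral_const_mul]
    have hi : Integrable (fun y => 2 * (1 + y ^ 2) * ((1 + (x - y) ^ 2) * W b (x - y))) P := by
      have hc := cont_W b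
      refine ((((integrable_const 1).add hP).const_mul 2).mul_bdd
        (c := (1 + 2 * (2 * b)) * (1 + 2 * (2 * b))) (g := fun y => ((1 + (x - y) ^ 2) * W b (x - y)))
        (by fun_prop) (Eventually.of_forall fun y => ?_))
      rw [Real.norm_eq_abs, abs_of_nonneg (mul_nonneg (by positivity) (W_nonneg _ _))]
      have e : (1 + (x - y) ^ 2) * W b (x - y) = W (2 * b) (x - y) * W (2 * b) (x - y) := by
        unfold W
        have : Real.exp (-(x - y) ^ 2 / (2 * b)) =
            Real.exp (-(x - y) ^ 2 / (2 * (2 * b))) * Real.exp (-(x - y) ^ 2 / (2 * (2 * b))) := by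
          rw [← Real.exp_add]; congr 1; field_simp; ring
        rw [this]; ring
      rw [e]
      have := W_le (b := 2 * b) (by positivity) (x - y)
      have := W_nonneg (2 * b) (x - y)
      gcongr
    refine integral_mono ((int_k (cont_W b) (bdd_W hb) x).const_mul _) hi fun y => ?_
    simp only
    have h0 := W_nonneg b (x - y)
    have : 1 + x ^ 2 ≤ 2 * (1 + y ^ 2) * (1 + (x - y) ^ 2) := by
      nlinarith [sq_nonneg (x - 2 * y), sq_nonneg (y * (x - y))]
    calc _ ≤ (2 * (1 + y ^ 2) * (1 + (x - y) ^ 2)) * W b (x - y) := by gcongr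
      _ = _ := by ring

lemma conv_gaussian {s : ℝ} (hs : 0 < s) :
    P ∗ gaussianReal 0 s.toNNReal =
      volume.withDensity (fun x => ENNReal.ofReal (dn (k0 s) P x)) := by
  have hs' : s.toNNReal ≠ 0 := by simpa using hs
  refine Measure.ext_of_lintegral _ fun f hf => ?_
  rw [Measure.lintegral_conv hf]
  have hmk : Measurable (fun x => ENNReal.ofReal (dn (k0 s) P x)) :=
    ENNReal.measurable_ofReal.comp (cont_dn (cont_k0 s) (bdd_k0 hs)).measurable
  rw [lintegral_withDensity_eq_lintegral_mul _ hmk hf]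
  have h1 : ∀ x, ∫⁻ y, f (x + y) ∂(gaussianReal 0 s.toNNReal) =
      ∫⁻ y, ENNReal.ofReal (k0 s (y - x)) * f y := by
    intro x
    rw [gaussianReal_of_var_ne_zero _ hs', lintegral_withDensity_eq_lintegral_mul _
      (measurable_gaussianPDF _ _) (by fun_prop),
      ← lintegral_add_left_eq_self (fun y => ENNReal.ofReal (k0 s (y - x)) * f y) x]
    refine lintegral_congr fun y => ?_
    simp [gaussianPDF, k0_eq hs]
  simp_rw [h1]
  have hc := (cont_k0 s).measurable
  rw [lintegral_lintegral_swap (by fun_prop)]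
  refine lintegral_congr fun x => ?_
  rw [lintegral_mul_const _ (by fun_prop), Pi.mul_apply, dn,
    ofReal_integral_eq_lintegral_ofReal (int_k (cont_k0 s) (bdd_k0 hs) x)
      (Eventually.of_forall fun y => (k0_pos hs _).le)]

end
end ECLT

namespace ECLT

lemma conv_withDensity {ν : Measure ℝ} [IsProbabilityMeasure ν] {f : ℝ → ℝ} (hf : Continuous f)
    {C : ℝ} (hC : ∀ x, |f x| ≤ C) (h0 : ∀ x, 0 ≤ f x) :
    ν ∗ volume.withDensity (fun x => ENNReal.ofReal (f x)) =
      volume.withDensity (fun x => ENNReal.ofReal (dn f ν x)) := by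
  refine Measure.ext_of_lintegral _ fun g hg => ?_
  rw [Measure.lintegral_conv hg]
  have hmk : Measurable (fun x => ENNReal.ofReal (dn f ν x)) :=
    ENNReal.measurable_ofReal.comp (cont_dn hf hC).measurable
  rw [lintegral_withDensity_eq_lintegral_mul _ hmk hg]
  have hc := hf.measurable
  have h1 : ∀ x, ∫⁻ y, g (x + y) ∂(volume.withDensity (fun x => ENNReal.ofReal (f x))) =
      ∫⁻ y, ENNReal.ofReal (f (y - x)) * g y := by
    intro x
    rw [lintegral_withDensity_eq_lintegral_mul _ (by fun_prop) (by fun_prop),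
      ← lintegral_add_left_eq_self (fun y => ENNReal.ofReal (f (y - x)) * g y) x]
    refine lintegral_congr fun y => ?_
    simp
  simp_rw [h1]
  rw [lintegral_lintegral_swap (by fun_prop)]
  refine lintegral_congr fun x => ?_
  rw [lintegral_mul_const _ (by fun_prop), Pi.mul_apply, dn,
    ofReal_integral_eq_lintegral_ofReal (int_k hf hC x)
      (Eventually.of_forall fun y => h0 _)]

lemma integral_wd {f g : ℝ → ℝ} (hf : Continuous f) (h0 : ∀ x, 0 ≤ f x) :
    ∫ x, g x ∂(volume.withDensity (fun x => ENNReal.ofReal (f x))) = ∫ x, f x * g x := by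
  have hm : Measurable (fun x => ENNReal.ofReal (f x)) := by
    have := hf.measurable
    fun_prop
  rw [integral_withDensity_eq_integral_toReal_smul hm (Eventually.of_forall fun x => by simp)]
  refine integral_congr_ae (Eventually.of_forall fun x => ?_)
  simp [h0]

lemma integrable_wd {f g : ℝ → ℝ} (hf : Continuous f) (h0 : ∀ x, 0 ≤ f x) :
    Integrable g (volume.withDensity (fun x => ENNReal.ofReal (f x))) ↔
      Integrable (fun x => f x * g x) := by
  have hm : Measurable (fun x => ENNReal.ofReal (f x)) := by
    have := hf.measurable
    fun_prop
  rw [integrable_withDensity_iff hm (Eventually.of_forall fun x => by simp)]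
  simp [h0, mul_comm]

/-- Fisher information of `P ∗ N(0,s)`. -/
noncomputable def Jf (P : Measure ℝ) (s : ℝ) : ℝ := ∫ x, dn (k1 s) P x ^ 2 / dn (k0 s) P x

section
variable {P : Measure ℝ} [IsProbabilityMeasure P] {s : ℝ}

lemma fisher_le (hs : 0 < s) (x : ℝ) : dn (k1 s) P x ^ 2 / dn (k0 s) P x ≤ dn (kq s) P x := by
  have hp := dn_pos (P := P) hs x
  set c := dn (k1 s) P x / dn (k0 s) P x with hc
  have i0 := int_k (P := P) (cont_k0 s) (bdd_k0 hs) x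
  have i1 := int_k (P := P) (cont_k1 s) (bdd_k1 hs) x
  have iq := int_k (P := P) (cont_kq s) (bdd_kq hs) x
  have h : 0 ≤ ∫ y, (kq s (x - y) - 2 * c * k1 s (x - y) + c ^ 2 * k0 s (x - y)) ∂P := by
    refine integral_nonneg fun y => ?_
    have e : kq s (x - y) - 2 * c * k1 s (x - y) + c ^ 2 * k0 s (x - y) =
        ((x - y) / s + c) ^ 2 * k0 s (x - y) := by
      unfold kq k1; ring
    simp only [Pi.zero_apply]
    rw [e]
    have := k0_pos hs (x - y)
    positivity
  have i3 : Integrable (fun y => kq s (x - y) - 2 * c * k1 s (x - y)) P :=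
    iq.sub (i1.const_mul _)
  rw [integral_add i3 (i0.const_mul _), integral_sub iq (i1.const_mul _), integral_const_mul,
    integral_const_mul] at h
  change 0 ≤ dn (kq s) P x - 2 * c * dn (k1 s) P x + c ^ 2 * dn (k0 s) P x at h
  have e1 : c * dn (k0 s) P x = dn (k1 s) P x := by rw [hc]; field_simp
  have e2 : dn (k1 s) P x ^ 2 / dn (k0 s) P x = c * dn (k1 s) P x := by rw [hc]; ring
  rw [e2]
  have e3 : c ^ 2 * dn (k0 s) P x = c * dn (k1 s) P x := by rw [← e1]; ring
  linarith

lemma integrable_kk {k : ℝ → ℝ} (hk : Continuous k) (hs : 0 < s) (h : ∀ x, |k x| ≤ Ac s * W s x) :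
    Integrable k :=
  ((integrable_W hs).const_mul (Ac s)).mono' hk.aestronglyMeasurable (Eventually.of_forall h)

lemma integrable_kq (hs : 0 < s) : Integrable (kq s) :=
  integrable_kk (cont_kq s) hs (kq_bd hs le_rfl le_rfl)
lemma integrable_k0 (hs : 0 < s) : Integrable (k0 s) :=
  integrable_kk (cont_k0 s) hs (k0_bd hs le_rfl le_rfl)
lemma integrable_k1 (hs : 0 < s) : Integrable (k1 s) :=
  integrable_kk (cont_k1 s) hs (k1_bd hs le_rfl le_rfl)
lemma integrable_k2 (hs : 0 < s) : Integrable (k2 s) :=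
  integrable_kk (cont_k2 s) hs (k2_bd hs le_rfl le_rfl)

lemma cont_d0 (hs : 0 < s) : Continuous (dn (k0 s) P) := cont_dn (cont_k0 s) (bdd_k0 hs)
lemma cont_d1 (hs : 0 < s) : Continuous (dn (k1 s) P) := cont_dn (cont_k1 s) (bdd_k1 hs)
lemma cont_d2 (hs : 0 < s) : Continuous (dn (k2 s) P) := cont_dn (cont_k2 s) (bdd_k2 hs)
lemma cont_dq (hs : 0 < s) : Continuous (dn (kq s) P) := cont_dn (cont_kq s) (bdd_kq hs)

lemma fisher_nonneg (hs : 0 < s) (x : ℝ) : 0 ≤ dn (k1 s) P x ^ 2 / dn (k0 s) P x :=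
  div_nonneg (sq_nonneg _) (dn_pos hs x).le

lemma cont_fisher (hs : 0 < s) : Continuous (fun x => dn (k1 s) P x ^ 2 / dn (k0 s) P x) :=
  ((cont_d1 hs).pow 2).div (cont_d0 hs) fun x => (dn_pos hs x).ne'

lemma integrable_fisher (hs : 0 < s) :
    Integrable (fun x => dn (k1 s) P x ^ 2 / dn (k0 s) P x) := by
  refine (integrable_dn (P := P) (integrable_kq hs)).mono'
    (cont_fisher hs).aestronglyMeasurable (Eventually.of_forall fun x => ?_)
  rw [Real.norm_eq_abs, abs_of_nonneg (fisher_nonneg hs x)]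
  exact fisher_le hs x

lemma deriv_d0 (hs : 0 < s) (x : ℝ) : HasDerivAt (dn (k0 s) P) (dn (k1 s) P x) x :=
  hasDerivAt_dn (cont_k0 s) (cont_k1 s) (bdd_k0 hs) (bdd_k1 hs) (hasDerivAt_k0 hs) x

lemma deriv_d1 (hs : 0 < s) (x : ℝ) : HasDerivAt (dn (k1 s) P) (dn (k2 s) P x) x :=
  hasDerivAt_dn (cont_k1 s) (cont_k2 s) (bdd_k1 hs) (bdd_k2 hs) (hasDerivAt_k1 hs) x

lemma integral_d1 (hs : 0 < s) : ∫ x, dn (k1 s) P x = 0 :=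
  integral_eq_zero_of_hasDerivAt_of_integrable (deriv_d0 hs) (integrable_dn (integrable_k1 hs))
    (integrable_dn (integrable_k0 hs))

lemma integral_d2 (hs : 0 < s) : ∫ x, dn (k2 s) P x = 0 :=
  integral_eq_zero_of_hasDerivAt_of_integrable (deriv_d1 hs) (integrable_dn (integrable_k2 hs))
    (integrable_dn (integrable_k1 hs))

lemma bdd_dn {k : ℝ → ℝ} {C : ℝ} (hC : ∀ x, |k x| ≤ C) (x : ℝ) : |dn k P x| ≤ C := by
  unfold dn
  have := norm_integral_le_of_norm_le_const (μ := P) (f := fun y => k (x - y)) (C := C)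
    (Eventually.of_forall fun y => hC _)
  simpa using this

end

lemma cp_gauss (μ : Measure ℝ) [IsProbabilityMeasure μ] {s : ℝ} (hs : 0 < s) (n : ℕ) :
    cp (μ ∗ gaussianReal 0 s.toNNReal) n = cp μ n ∗ gaussianReal 0 (n * s).toNNReal := by
  induction n with
  | zero => simp [cp]
  | succ n ih =>
    have e : (((n + 1 : ℕ) : ℝ) * s).toNNReal = (n * s).toNNReal + s.toNNReal := by
      rw [← Real.toNNReal_add (by positivity) hs.le]; congr 1; push_cast; ring
    have e2 : gaussianReal 0 ((n * s).toNNReal + s.toNNReal) =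
        gaussianReal 0 (n * s).toNNReal ∗ gaussianReal 0 s.toNNReal := by
      rw [gaussianReal_conv_gaussianReal]; simp
    change cp _ n ∗ _ = (cp μ n ∗ μ) ∗ _
    rw [ih, e, e2, Measure.conv_assoc, Measure.conv_assoc,
      ← Measure.conv_assoc (gaussianReal 0 (n * s).toNNReal) μ,
      Measure.conv_comm (gaussianReal 0 (n * s).toNNReal) μ, Measure.conv_assoc μ]

section mono
variable (μ : Measure ℝ) [IsProbabilityMeasure μ] {s : ℝ}

lemma dens_succ (hs : 0 < s) {n : ℕ} (hn : 1 ≤ n) :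
    dn (k0 ((n + 1 : ℕ) * s)) (cp μ (n + 1)) =
      dn (dn (k0 (n * s)) (cp μ n)) (μ ∗ gaussianReal 0 s.toNNReal) := by
  have hn' : 0 < (n : ℝ) * s := by positivity
  have hn1 : 0 < ((n + 1 : ℕ) : ℝ) * s := by positivity
  set ν := μ ∗ gaussianReal 0 s.toNNReal with hν
  have h1 : cp ν (n + 1) = volume.withDensity
      (fun x => ENNReal.ofReal (dn (k0 ((n + 1 : ℕ) * s)) (cp μ (n + 1)) x)) := by
    rw [hν, cp_gauss μ hs, conv_gaussian hn1]
  have h2 : cp ν (n + 1) = volume.withDensity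
      (fun x => ENNReal.ofReal (dn (dn (k0 (n * s)) (cp μ n)) ν x)) := by
    change cp ν n ∗ ν = _
    rw [Measure.conv_comm, hν, cp_gauss μ hs, conv_gaussian hn',
      conv_withDensity (cont_d0 hn') (bdd_dn (bdd_k0 hn')) (fun x => (dn_pos hn' x).le)]
  have c1 : Continuous (dn (k0 ((n + 1 : ℕ) * s)) (cp μ (n + 1))) := cont_d0 hn1
  have c2 : Continuous (dn (dn (k0 (n * s)) (cp μ n)) ν) :=
    cont_dn (cont_d0 hn') (bdd_dn (bdd_k0 hn'))
  rw [h1] at h2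
  have h3 := (withDensity_eq_iff_of_sigmaFinite
    (ENNReal.measurable_ofReal.comp c1.measurable).aemeasurable
    (ENNReal.measurable_ofReal.comp c2.measurable).aemeasurable).1 h2
  refine (Continuous.ae_eq_iff_eq volume c1 c2).1 ?_
  filter_upwards [h3] with x hx
  refine (ENNReal.ofReal_eq_ofReal_iff (dn_pos hn1 x).le ?_).1 hx
  exact integral_nonneg fun y => (dn_pos hn' _).le

lemma dens1_succ (hs : 0 < s) {n : ℕ} (hn : 1 ≤ n) (x : ℝ) :
    dn (k1 ((n + 1 : ℕ) * s)) (cp μ (n + 1)) x =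
      dn (dn (k1 (n * s)) (cp μ n)) (μ ∗ gaussianReal 0 s.toNNReal) x := by
  have hn' : 0 < (n : ℝ) * s := by positivity
  have hn1 : 0 < ((n + 1 : ℕ) : ℝ) * s := by positivity
  have h1 := deriv_d0 (P := cp μ (n + 1)) hn1 x
  rw [dens_succ μ hs hn] at h1
  refine h1.unique (hasDerivAt_dn (cont_d0 hn') (cont_d1 hn') (bdd_dn (bdd_k0 hn'))
    (bdd_dn (bdd_k1 hn')) (deriv_d0 hn') x)

lemma Jf_mono_aux (hs : 0 < s) {n : ℕ} (hn : 1 ≤ n) :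
    ((n : ℝ) + 1) * Jf (cp μ (n + 1)) ((n + 1 : ℕ) * s) ≤ n * Jf (cp μ n) (n * s) := by
  have hn' : 0 < (n : ℝ) * s := by positivity
  have hn1 : 0 < ((n + 1 : ℕ) : ℝ) * s := by positivity
  set ν := μ ∗ gaussianReal 0 s.toNNReal with hν
  set f := dn (k0 (n * s)) (cp μ n) with hf
  set f' := dn (k1 (n * s)) (cp μ n) with hf'
  set g := dn (k0 ((n + 1 : ℕ) * s)) (cp μ (n + 1)) with hg
  set g' := dn (k1 ((n + 1 : ℕ) * s)) (cp μ (n + 1)) with hg'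
  have cf : Continuous f := cont_d0 hn'
  have cf' : Continuous f' := cont_d1 hn'
  have cg : Continuous g := cont_d0 hn1
  have cg' : Continuous g' := cont_d1 hn1
  have pf : ∀ x, 0 < f x := dn_pos hn'
  have pg : ∀ x, 0 < g x := dn_pos hn1
  have eg : g = dn f ν := dens_succ μ hs hn
  have eg' : ∀ x, g' x = dn f' ν x := dens1_succ μ hs hn
  set ρ := fun x => g' x / g x with hρ
  have cρ : Continuous ρ := cg'.div cg fun x => (pg x).ne'
  have hcpn : cp ν n = volume.withDensity (fun x => ENNReal.ofReal (f x)) := by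
    rw [hν, cp_gauss μ hs, conv_gaussian hn']
  have hcpn1 : cp ν (n + 1) = volume.withDensity (fun x => ENNReal.ofReal (g x)) := by
    rw [hν, cp_gauss μ hs, conv_gaussian hn1]
  have iJg : Integrable (fun x => g' x ^ 2 / g x) := integrable_fisher hn1
  have iJf : Integrable (fun x => f' x ^ 2 / f x) := integrable_fisher hn'
  have eρ : ∀ x, g x * ρ x ^ 2 = g' x ^ 2 / g x := fun x => by
    have := (pg x).ne'
    simp only [hρ]; field_simp
  -- second moment of the score
  have iρ2 : Integrable (fun x => ρ x ^ 2) (cp ν (n + 1)) := by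
    rw [hcpn1, integrable_wd cg fun x => (pg x).le]
    simpa only [eρ] using iJg
  have hA : ∫ x, ρ x ^ 2 ∂(cp ν (n + 1)) = Jf (cp μ (n + 1)) ((n + 1 : ℕ) * s) := by
    rw [hcpn1, integral_wd cg fun x => (pg x).le]
    simp only [eρ]; rfl
  have hM : ∫ x, ρ x ∂(cp ν (n + 1)) = 0 := by
    rw [hcpn1, integral_wd cg fun x => (pg x).le, ← integral_d1 (P := cp μ (n + 1)) hn1]
    refine integral_congr_ae (Eventually.of_forall fun x => ?_)
    have := (pg x).ne'
    simp only [hρ]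
    field_simp
    rfl
  have hdks := dks ν n ρ cρ.measurable iρ2
  rw [hM, hA] at hdks
  set h := fun w => ∫ y, ρ (w + y) ∂ν with hh
  have hm : Measurable h := by
    have : Measurable (fun p : ℝ × ℝ => ρ (p.1 + p.2)) := cρ.measurable.comp (by fun_prop)
    exact (this.stronglyMeasurable.integral_prod_right').measurable
  have ih2 : Integrable (fun w => h w ^ 2) (cp ν n) :=
    integrable_sq_integral (F := fun p : ℝ × ℝ => ρ (p.1 + p.2)) (cρ.measurable.comp (by fun_prop))
      (integrable_conv_prod iρ2)
  have ih2' : Integrable (fun w => f w * h w ^ 2) := by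
    rw [hcpn, integrable_wd cf fun x => (pf x).le] at ih2
    exact ih2
  have eB : ∫ w, h w ^ 2 ∂(cp ν n) = ∫ w, f w * h w ^ 2 := by
    rw [hcpn, integral_wd cf fun x => (pf x).le]
  -- Fubini
  have iF : Integrable (fun p : ℝ × ℝ => ρ p.1 * f' (p.1 - p.2)) (volume.prod ν) := by
    have i1 : Integrable (fun p : ℝ × ℝ => ρ p.1 ^ 2 * f (p.1 - p.2)) (volume.prod ν) := by
      rw [integrable_prod_iff (by
        refine Continuous.aestronglyMeasurable ?_
        fun_prop)]
      refine ⟨Eventually.of_forall fun x => ?_, ?_⟩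
      · have := (int_k (P := ν) cf (bdd_dn (bdd_k0 hn')) x).const_mul (ρ x ^ 2)
        exact this
      refine iJg.congr (Eventually.of_forall fun x => ?_)
      simp only
      rw [← eρ x, eg, dn, mul_comm, ← integral_const_mul]
      refine integral_congr_ae (Eventually.of_forall fun y => ?_)
      simp only [Real.norm_eq_abs]
      rw [abs_of_nonneg (mul_nonneg (sq_nonneg _) (pf _).le)]
    have i2 := integrable_prod_dn (P := ν) (B := fun _ => 1) iJf (integrable_const _)
    refine (i1.add i2).mono' (Continuous.aestronglyMeasurable (by fun_prop))
      (Eventually.of_forall fun p => ?_)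
    simp only [Pi.add_apply, one_mul, Real.norm_eq_abs]
    have hp := pf (p.1 - p.2)
    set a := ρ p.1
    set b := f' (p.1 - p.2)
    set c := f (p.1 - p.2)
    have e : a ^ 2 * c + b ^ 2 / c = (|a| * c - |b|) ^ 2 / c + 2 * |a * b| := by
      rw [abs_mul]; field_simp; rw [← sq_abs a, ← sq_abs b]; ring
    rw [e]
    have : 0 ≤ (|a| * c - |b|) ^ 2 / c := by positivity
    have := abs_nonneg (a * b)
    linarith
  have iF2 : Integrable (fun p : ℝ × ℝ => ρ (p.2 + p.1) * f' p.2) (ν.prod volume) := by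
    have hmp : MeasurePreserving (fun p : ℝ × ℝ => (p.1, p.2 + p.1)) (ν.prod volume)
        (ν.prod volume) :=
      MeasurePreserving.skew_product (g := fun a b => b + a) (MeasurePreserving.id ν) (by fun_prop)
        (Eventually.of_forall fun a => map_add_right_eq_self volume a)
    have := hmp.integrable_comp_of_integrable iF.swap
    refine this.congr (Eventually.of_forall fun p => ?_)
    simp
  have hJ : Jf (cp μ (n + 1)) ((n + 1 : ℕ) * s) = ∫ u, h u * f' u := by
    have e1 : Jf (cp μ (n + 1)) ((n + 1 : ℕ) * s) = ∫ x, ∫ y, ρ x * f' (x - y) ∂ν := by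
      unfold Jf
      refine integral_congr_ae (Eventually.of_forall fun x => ?_)
      change g' x ^ 2 / g x = ∫ y, ρ x * f' (x - y) ∂ν
      rw [integral_const_mul]
      change _ = ρ x * dn f' ν x
      rw [← eg' x]; simp only [hρ]; ring
    rw [e1, integral_integral_swap (f := fun x y => ρ x * f' (x - y)) iF]
    have e2 : ∀ y, ∫ x, ρ x * f' (x - y) = ∫ u, ρ (u + y) * f' u := fun y => by
      rw [← integral_add_right_eq_self (fun x => ρ x * f' (x - y)) y]
      simp
    simp_rw [e2]
    rw [integral_integral_swap (f := fun y u => ρ (u + y) * f' u) iF2]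
    refine integral_congr_ae (Eventually.of_forall fun u => ?_)
    simp only [hh]
    rw [integral_mul_const]
  -- AM-GM
  have hn0 : (0 : ℝ) < n := by positivity
  set c : ℝ := (n + 1) / n with hc
  have hc0 : 0 < c := by positivity
  have hfin : ∫ u, h u * f' u ≤ ∫ u, (c / 2 * (f u * h u ^ 2) + 1 / (2 * c) * (f' u ^ 2 / f u)) := by
    have iR := (ih2'.const_mul (c / 2)).add (iJf.const_mul (1 / (2 * c)))
    have hpt : ∀ u, |h u * f' u| ≤ c / 2 * (f u * h u ^ 2) + 1 / (2 * c) * (f' u ^ 2 / f u) := by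
      intro u
      have hp := pf u
      have e : c / 2 * (f u * h u ^ 2) + 1 / (2 * c) * (f' u ^ 2 / f u) =
          (c * f u * |h u| - |f' u|) ^ 2 / (2 * c * f u) + |h u * f' u| := by
        rw [abs_mul]; field_simp; rw [← sq_abs (h u), ← sq_abs (f' u)]; ring
      rw [e]
      have : 0 ≤ (c * f u * |h u| - |f' u|) ^ 2 / (2 * c * f u) := by positivity
      linarith
    refine integral_mono (iR.mono' ?_ (Eventually.of_forall hpt)) iR fun u =>
      (le_abs_self _).trans (hpt u)
    exact (hm.mul cf'.measurable).aestronglyMeasurable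
  rw [integral_add (ih2'.const_mul _) (iJf.const_mul _), integral_const_mul, integral_const_mul,
    ← eB, ← hJ] at hfin
  change _ ≤ c / 2 * _ + 1 / (2 * c) * Jf (cp μ n) (n * s) at hfin
  set A := Jf (cp μ (n + 1)) ((n + 1 : ℕ) * s)
  set B := ∫ w, h w ^ 2 ∂(cp ν n)
  set D := Jf (cp μ n) (n * s)
  have hB : c * B ≤ A := by
    rw [hc, div_mul_eq_mul_div, div_le_iff₀ hn0]
    linarith
  have h5 : A ≤ 1 / c * D := by
    have : 1 / (2 * c) * D = 1 / c * D / 2 := by field_simp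
    linarith
  have h6 : 1 / c = n / (n + 1) := by rw [hc]; simp
  rw [h6, div_mul_eq_mul_div, le_div_iff₀ (by positivity)] at h5
  linarith

end mono
end ECLT

namespace ECLT

lemma log_k0 {s : ℝ} (hs : 0 < s) (x : ℝ) :
    Real.log (k0 s x) = -(1 / 2) * Real.log (2 * Real.pi * s) - x ^ 2 / (2 * s) := by
  have hpi := Real.pi_pos
  unfold k0
  rw [Real.log_mul (by positivity) (by positivity), Real.log_exp, Real.log_inv, Real.log_sqrt (by positivity)]
  ring

lemma integral_k0 {s : ℝ} (hs : 0 < s) : ∫ x, k0 s x = 1 := by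
  have h := integral_gaussianPDFReal_eq_one 0 (v := s.toNNReal) (by simpa using hs)
  simpa [k0_eq hs] using h

lemma integral_k2 {s : ℝ} (hs : 0 < s) : ∫ x, k2 s x = 0 :=
  integral_eq_zero_of_hasDerivAt_of_integrable (hasDerivAt_k1 hs) (integrable_k2 hs)
    (integrable_k1 hs)

lemma integral_kq {s : ℝ} (hs : 0 < s) : ∫ x, kq s x = 1 / s := by
  have h := integral_k2 hs
  have e : ∀ x, k2 s x = kq s x - 1 / s * k0 s x := fun x => by unfold k2 kq; ring
  simp_rw [e] at h
  rw [integral_sub (integrable_kq hs) ((integrable_k0 hs).const_mul _), integral_const_mul,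
    integral_k0 hs] at h
  linarith

section
variable {P : Measure ℝ} [IsProbabilityMeasure P]

lemma dn_lower {s : ℝ} (hs : 0 < s) (h1 : ∫ x, x ∂P = 0) (h2 : ∫ x, x ^ 2 ∂P = 1) (x : ℝ) :
    (Real.sqrt (2 * Real.pi * s))⁻¹ * Real.exp (-(x ^ 2 + 1) / (2 * s)) ≤ dn (k0 s) P x := by
  have hpi := Real.pi_pos
  have i2 : Integrable (fun x => x ^ 2) P := by
    by_contra h
    rw [integral_undef h] at h2; norm_num at h2
  have i1 : Integrable (fun x => x) P := integrable_of_sq (by fun_prop) i2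
  set c := (Real.sqrt (2 * Real.pi * s))⁻¹ with hc
  have hc0 : 0 < c := by positivity
  set m := -(x ^ 2 + 1) / (2 * s) with hm
  have hpt : ∀ y, c * Real.exp m * (1 + ((x * y) / s - y ^ 2 / (2 * s) + 1 / (2 * s))) ≤ k0 s (x - y) := by
    intro y
    have := Real.add_one_le_exp (-(x - y) ^ 2 / (2 * s) - m)
    unfold k0
    rw [← hc]
    have e : Real.exp (-(x - y) ^ 2 / (2 * s)) = Real.exp m * Real.exp (-(x - y) ^ 2 / (2 * s) - m) := by
      rw [← Real.exp_add]; congr 1; ring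
    rw [e, ← mul_assoc]
    gcongr
    refine le_trans (le_of_eq ?_) this
    rw [hm]; field_simp; ring
  have ia : Integrable (fun y => x * y / s) P := (i1.const_mul x).div_const s
  have ib : Integrable (fun y => y ^ 2 / (2 * s)) P := i2.div_const _
  have ic : Integrable (fun y => x * y / s - y ^ 2 / (2 * s)) P := ia.sub ib
  have id' : Integrable (fun y => x * y / s - y ^ 2 / (2 * s) + 1 / (2 * s)) P :=
    ic.add (integrable_const _)
  have ie : Integrable (fun y => 1 + (x * y / s - y ^ 2 / (2 * s) + 1 / (2 * s))) P :=
    (integrable_const _).add id'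
  have := integral_mono (ie.const_mul (c * Real.exp m)) (int_k (cont_k0 s) (bdd_k0 hs) x) hpt
  refine le_trans (le_of_eq ?_) this
  rw [integral_const_mul, integral_add (integrable_const _) id', integral_add ic (integrable_const _),
    integral_sub ia ib, integral_div, integral_div, integral_const_mul, h1, h2]
  simp

lemma log_bd {a b : ℝ} (ha : 0 < a) (h1 : ∫ x, x ∂P = 0) (h2 : ∫ x, x ^ 2 ∂P = 1) :
    ∃ C, 0 ≤ C ∧ ∀ s, a ≤ s → s ≤ b → ∀ x, |Real.log (dn (k0 s) P x)| ≤ C * (1 + x ^ 2) := by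
  have hpi := Real.pi_pos
  refine ⟨|Real.log (2 * Real.pi * a)| + |Real.log (2 * Real.pi * b)| + 1 / (2 * a), by positivity, ?_⟩
  intro s has hsb x
  have hs : 0 < s := ha.trans_le has
  have hb : 0 < b := hs.trans_le hsb
  have l1 : Real.log (2 * Real.pi * a) ≤ Real.log (2 * Real.pi * s) :=
    Real.log_le_log (by positivity) (by gcongr)
  have l2 : Real.log (2 * Real.pi * s) ≤ Real.log (2 * Real.pi * b) :=
    Real.log_le_log (by positivity) (by gcongr)
  have hup := Real.log_le_log (dn_pos (P := P) hs x) (dn_k0_le hs x)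
  have hlo := Real.log_le_log (by positivity) (dn_lower hs h1 h2 x)
  rw [Real.log_inv, Real.log_sqrt (by positivity)] at hup
  rw [Real.log_mul (by positivity) (by positivity), Real.log_exp, Real.log_inv,
    Real.log_sqrt (by positivity)] at hlo
  have a1 := neg_abs_le (Real.log (2 * Real.pi * a))
  have a2 := le_abs_self (Real.log (2 * Real.pi * b))
  have a3 := abs_nonneg (Real.log (2 * Real.pi * a))
  have a4 := abs_nonneg (Real.log (2 * Real.pi * b))
  have e : -(1 / (2 * a) * (1 + x ^ 2)) ≤ -(x ^ 2 + 1) / (2 * s) := by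
    rw [neg_div, neg_le_neg_iff, div_eq_mul_one_div, mul_comm, add_comm]
    gcongr
  have p1 : 0 ≤ |Real.log (2 * Real.pi * a)| * x ^ 2 := by positivity
  have p2 : 0 ≤ |Real.log (2 * Real.pi * b)| * x ^ 2 := by positivity
  have p3 : 0 ≤ 1 / (2 * a) * (1 + x ^ 2) := by positivity
  rw [abs_le]
  constructor <;> nlinarith

/-- Negative differential entropy of `P ∗ N(0,s)`. -/
noncomputable def Hf (P : Measure ℝ) (s : ℝ) : ℝ :=
  ∫ x, dn (k0 s) P x * Real.log (dn (k0 s) P x)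

lemma cont_log {s : ℝ} (hs : 0 < s) : Continuous (fun x => Real.log (dn (k0 s) P x)) :=
  (cont_d0 hs).log fun x => (dn_pos hs x).ne'

lemma sq_int (h2 : ∫ x, x ^ 2 ∂P = 1) : Integrable (fun x => x ^ 2) P := by
  by_contra h
  rw [integral_undef h] at h2; norm_num at h2

lemma integrable_k_log {k : ℝ → ℝ} {s : ℝ} (hs : 0 < s) (h1 : ∫ x, x ∂P = 0)
    (h2 : ∫ x, x ^ 2 ∂P = 1) (hk : Continuous k) (h : ∀ x, |k x| ≤ Ac s * W s x) :
    Integrable (fun x => dn k P x * Real.log (dn (k0 s) P x)) := by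
  obtain ⟨C, hC, hb⟩ := log_bd (P := P) (b := s) hs h1 h2
  refine ((integrable_dn_W' hs (sq_int h2)).const_mul (Ac s * C)).mono' ?_
    (Eventually.of_forall fun x => ?_)
  · exact ((cont_dn hk (bdd_of hs hs h)).mul (cont_log hs)).aestronglyMeasurable
  · rw [Real.norm_eq_abs, abs_mul]
    have e1 := dn_bd (P := P) hk hs hs h x
    have e2 := hb s le_rfl le_rfl x
    calc _ ≤ (Ac s * dn (W s) P x) * (C * (1 + x ^ 2)) := by
          gcongr
          exact (abs_nonneg _).trans e1
      _ = _ := by ring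

lemma deriv_d0_s {s : ℝ} (hs : 0 < s) (x : ℝ) :
    HasDerivAt (fun s => dn (k0 s) P x) (dn (k2 s) P x / 2) s := by
  unfold dn
  rw [← integral_div]
  have ha : 0 < s / 2 := by positivity
  have hb : 0 < 2 * s := by positivity
  refine (hasDerivAt_integral_of_dominated_loc_of_deriv_le
    (bound := fun _ => Ac (s / 2) * (1 + 2 * (2 * s)))
    (F := fun s y => k0 s (x - y)) (F' := fun s y => k2 s (x - y) / 2)
    (s := Set.Icc (s / 2) (2 * s)) (Icc_mem_nhds (by linarith) (by linarith))
    ?_ (int_k (cont_k0 s) (bdd_k0 hs) x) ?_ ?_ (integrable_const _) ?_).2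
  · refine Eventually.of_forall fun t => ?_
    have := cont_k0 t
    fun_prop
  · have := cont_k2 s
    fun_prop
  · refine Eventually.of_forall fun y t ht => ?_
    have := bdd_of ha hb (k2_bd ha ht.1 ht.2) (x - y)
    rw [Real.norm_eq_abs, abs_div, abs_two]
    have := abs_nonneg (k2 t (x - y))
    linarith
  · exact Eventually.of_forall fun y t ht => hasDerivAt_k0_s (ha.trans_le ht.1) _

lemma deriv_Hf {s : ℝ} (hs : 0 < s) (h1 : ∫ x, x ∂P = 0) (h2 : ∫ x, x ^ 2 ∂P = 1) :
    HasDerivAt (Hf P) (-(1 / 2) * Jf P s) s := by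
  have ha : 0 < s / 2 := by positivity
  have hb : 0 < 2 * s := by positivity
  obtain ⟨C, hC, hlog⟩ := log_bd (P := P) (b := 2 * s) ha h1 h2
  have key := hasDerivAt_integral_of_dominated_loc_of_deriv_le (μ := (volume : Measure ℝ))
    (bound := fun x => (Ac (s / 2) * (C + 1)) * ((1 + x ^ 2) * dn (W (2 * s)) P x))
    (F := fun s x => dn (k0 s) P x * Real.log (dn (k0 s) P x))
    (F' := fun s x => dn (k2 s) P x / 2 * (Real.log (dn (k0 s) P x) + 1))
    (x₀ := s) (s := Set.Icc (s / 2) (2 * s)) (Icc_mem_nhds (by linarith) (by linarith))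
    ?_ (integrable_k_log hs h1 h2 (cont_k0 s) (k0_bd hs le_rfl le_rfl)) ?_ ?_
    ((integrable_dn_W' hb (sq_int h2)).const_mul _) ?_
  · have hd := key.2
    change HasDerivAt (Hf P) _ s at hd
    convert! hd using 1
    have i2l := integrable_k_log hs h1 h2 (cont_k2 s) (k2_bd hs le_rfl le_rfl)
    have i1l := integrable_k_log hs h1 h2 (cont_k1 s) (k1_bd hs le_rfl le_rfl)
    have i2 := integrable_dn (P := P) (integrable_k2 hs)
    have e : ∀ x, dn (k2 s) P x / 2 * (Real.log (dn (k0 s) P x) + 1) =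
        1 / 2 * (dn (k2 s) P x * Real.log (dn (k0 s) P x)) + 1 / 2 * dn (k2 s) P x := fun x => by ring
    simp_rw [e]
    rw [integral_add (i2l.const_mul _) (i2.const_mul _), integral_const_mul, integral_const_mul,
      integral_d2 hs]
    have ibp := integral_mul_deriv_eq_deriv_mul_of_integrable
      (u := fun x => Real.log (dn (k0 s) P x)) (v := dn (k1 s) P)
      (u' := fun x => dn (k1 s) P x / dn (k0 s) P x) (v' := dn (k2 s) P)
      (fun x _ => (deriv_d0 hs x).log (dn_pos hs x).ne') (fun x _ => deriv_d1 hs x)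
      (i2l.congr (Eventually.of_forall fun x => by simp [mul_comm]))
      ((integrable_fisher hs).congr (Eventually.of_forall fun x => by
        simp only [Pi.mul_apply]; ring))
      (i1l.congr (Eventually.of_forall fun x => by simp [mul_comm]))
    have e2 : ∫ x, dn (k2 s) P x * Real.log (dn (k0 s) P x) = - Jf P s := by
      rw [Jf]
      simp_rw [mul_comm (dn (k2 s) P _)]
      rw [ibp]
      congr 2; ext x; ring
    rw [e2]; ring
  · filter_upwards [lt_mem_nhds hs] with t ht
    exact ((cont_d0 ht).mul (cont_log ht)).aestronglyMeasurable
  · exact (((cont_d2 hs).div_const 2).mul ((cont_log hs).add continuous_const)).aestronglyMeasurable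
  · refine Eventually.of_forall fun x t ht => ?_
    have b1 := dn_bd (P := P) (cont_k2 t) ha hb (k2_bd ha ht.1 ht.2) x
    have b2 := hlog t ht.1 ht.2 x
    have b3 := dn_W_nonneg (P := P) (2 * s) x
    have b4 := Ac_pos ha
    have b5 : |Real.log (dn (k0 t) P x) + 1| ≤ (C + 1) * (1 + x ^ 2) := by
      refine (abs_add_le _ _).trans ?_
      rw [abs_one]
      nlinarith [sq_nonneg x]
    rw [Real.norm_eq_abs, abs_mul, abs_div, abs_two]
    calc _ ≤ (Ac (s / 2) * dn (W (2 * s)) P x) * ((C + 1) * (1 + x ^ 2)) := by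
          gcongr
          have := abs_nonneg (dn (k2 t) P x)
          linarith
      _ = _ := by ring
  · refine Eventually.of_forall fun x t ht => ?_
    have ht0 : 0 < t := ha.trans_le ht.1
    have d := deriv_d0_s (P := P) ht0 x
    have hp := (dn_pos (P := P) ht0 x).ne'
    have := d.mul (d.log hp)
    convert! this using 1
    field_simp

lemma Hf_le {s : ℝ} (hs : 0 < s) (h1 : ∫ x, x ∂P = 0) (h2 : ∫ x, x ^ 2 ∂P = 1) :
    Hf P s ≤ -(1 / 2) * Real.log (2 * Real.pi * s) - 1 / 2 := by
  set L := Real.log (2 * Real.pi * s) with hL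
  set kl := fun x => -(1 / 2) * L * k0 s x - s / 2 * kq s x with hkl
  have ekl : ∀ x, kl x = k0 s x * Real.log (k0 s x) := fun x => by
    rw [log_k0 hs, ← hL]; simp only [hkl, kq]; field_simp
  have ikl : Integrable kl := ((integrable_k0 hs).const_mul _).sub ((integrable_kq hs).const_mul _)
  have hI : ∫ x, kl x = -(1 / 2) * L - 1 / 2 := by
    simp only [hkl]
    rw [integral_sub ((integrable_k0 hs).const_mul _) ((integrable_kq hs).const_mul _),
      integral_const_mul, integral_const_mul, integral_k0 hs, integral_kq hs]
    field_simp
  rw [← hI, ← integral_dn (P := P) ikl]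
  refine integral_mono (integrable_k_log hs h1 h2 (cont_k0 s) (k0_bd hs le_rfl le_rfl))
    (integrable_dn ikl) fun x => ?_
  have hp := dn_pos (P := P) hs x
  have i0 := int_k (P := P) (cont_k0 s) (bdd_k0 hs) x
  have iq := int_k (P := P) (cont_kq s) (bdd_kq hs) x
  set A := dn (k0 s) P x with hA
  have hpt : ∀ y, (Real.log A + 1) * k0 s (x - y) - A ≤ kl (x - y) := by
    intro y
    rw [ekl]
    have hb := k0_pos hs (x - y)
    set b := k0 s (x - y)
    have := Real.log_le_sub_one_of_pos (div_pos hp hb)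
    rw [Real.log_div hp.ne' hb.ne'] at this
    have h3 : b * (Real.log A - Real.log b) ≤ b * (A / b - 1) := by gcongr
    have h4 : b * (A / b - 1) = A - b := by field_simp
    nlinarith
  have i3 : Integrable (fun y => (Real.log A + 1) * k0 s (x - y) - A) P :=
    (i0.const_mul _).sub (integrable_const _)
  have i4 : Integrable (fun y => kl (x - y)) P := (i0.const_mul _).sub (iq.const_mul _)
  have := integral_mono i3 i4 hpt
  rw [integral_sub (i0.const_mul _) (integrable_const _), integral_const_mul] at this
  change (Real.log A + 1) * A - _ ≤ dn kl P x at this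
  simp only [integral_const, probReal_univ, one_smul] at this
  simp only
  linarith

end
end ECLT

namespace ECLT

lemma k0_scale {c s : ℝ} (hc : 0 < c) (hs : 0 < s) (x : ℝ) :
    k0 s (x / c) = c * k0 (c ^ 2 * s) x := by
  have hpi := Real.pi_pos
  unfold k0
  have e : Real.sqrt (2 * Real.pi * (c ^ 2 * s)) = c * Real.sqrt (2 * Real.pi * s) := by
    rw [show 2 * Real.pi * (c ^ 2 * s) = c ^ 2 * (2 * Real.pi * s) by ring,
      Real.sqrt_mul (by positivity), Real.sqrt_sq hc.le]
  have e2 : -(x / c) ^ 2 / (2 * s) = -x ^ 2 / (2 * (c ^ 2 * s)) := by field_simp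
  rw [e, e2]
  have : Real.sqrt (2 * Real.pi * s) ≠ 0 := by positivity
  field_simp

lemma k1_scale {c s : ℝ} (hc : 0 < c) (hs : 0 < s) (x : ℝ) :
    k1 s (x / c) = c ^ 2 * k1 (c ^ 2 * s) x := by
  unfold k1
  rw [k0_scale hc hs]
  field_simp

lemma Jf_scale {P : Measure ℝ} [IsProbabilityMeasure P] {c s : ℝ} (hc : 0 < c) (hs : 0 < s) :
    Jf (P.map (fun x => x / c)) s = c ^ 2 * Jf P (c ^ 2 * s) := by
  have hm : Measurable (fun x : ℝ => x / c) := by fun_prop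
  have e0 : ∀ x, dn (k0 s) (P.map (fun x => x / c)) x = c * dn (k0 (c ^ 2 * s)) P (c * x) := by
    intro x
    unfold dn
    rw [integral_map hm.aemeasurable
      (Continuous.aestronglyMeasurable (by have := cont_k0 s; fun_prop)), ← integral_const_mul]
    refine integral_congr_ae (Eventually.of_forall fun y => ?_)
    simp only
    rw [← k0_scale hc hs]
    congr 1; field_simp
  have e1 : ∀ x, dn (k1 s) (P.map (fun x => x / c)) x = c ^ 2 * dn (k1 (c ^ 2 * s)) P (c * x) := by
    intro x
    unfold dn
    rw [integral_map hm.aemeasurable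
      (Continuous.aestronglyMeasurable (by have := cont_k1 s; fun_prop)), ← integral_const_mul]
    refine integral_congr_ae (Eventually.of_forall fun y => ?_)
    simp only
    rw [← k1_scale hc hs]
    congr 1; field_simp
  unfold Jf
  simp_rw [e0, e1]
  have e2 : ∀ x, (c ^ 2 * dn (k1 (c ^ 2 * s)) P (c * x)) ^ 2 / (c * dn (k0 (c ^ 2 * s)) P (c * x)) =
      c ^ 3 * (fun z => dn (k1 (c ^ 2 * s)) P z ^ 2 / dn (k0 (c ^ 2 * s)) P z) (c * x) := by
    intro x
    have := (dn_pos (P := P) (s := c ^ 2 * s) (by positivity) (c * x)).ne'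
    simp only
    field_simp
  simp_rw [e2]
  rw [integral_const_mul, Measure.integral_comp_mul_left
    (fun z => dn (k1 (c ^ 2 * s)) P z ^ 2 / dn (k0 (c ^ 2 * s)) P z), abs_of_pos (by positivity : 0 < c⁻¹)]
  simp only [smul_eq_mul]
  field_simp

/-- Law of the normalized sum, via convolution powers. -/
noncomputable def Q (μ : Measure ℝ) (m : ℕ) : Measure ℝ := (cp μ m).map (fun x => x / Real.sqrt m)

section
variable (μ : Measure ℝ) [IsProbabilityMeasure μ]

instance Q_prob (m : ℕ) : IsProbabilityMeasure (Q μ m) :=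
  Measure.isProbabilityMeasure_map (by fun_prop)

lemma Jf_Q {m : ℕ} (hm : 1 ≤ m) {s : ℝ} (hs : 0 < s) :
    Jf (Q μ m) s = m * Jf (cp μ m) (m * s) := by
  have hm' : (0 : ℝ) < m := by exact_mod_cast hm
  rw [Q, Jf_scale (by positivity) hs, Real.sq_sqrt hm'.le]

lemma Jf_Q_mono {m : ℕ} (hm : 1 ≤ m) {s : ℝ} (hs : 0 < s) : Jf (Q μ (m + 1)) s ≤ Jf (Q μ m) s := by
  rw [Jf_Q μ hm hs, Jf_Q μ (by omega) hs]
  have := Jf_mono_aux μ hs hm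
  push_cast at this ⊢
  exact this

lemma charFun_cp (m : ℕ) (t : ℝ) : charFun (cp μ m) t = charFun μ t ^ m := by
  induction m with
  | zero => simp [cp]
  | succ n ih => rw [cp, charFun_conv, ih, pow_succ]

lemma pi_sum_law (m : ℕ) :
    (Measure.pi fun _ : Fin m => μ).map (fun z => ∑ i, z i) = cp μ m := by
  have : IsProbabilityMeasure ((Measure.pi fun _ : Fin m => μ).map (fun z => ∑ i, z i)) :=
    Measure.isProbabilityMeasure_map (by fun_prop)
  refine Measure.ext_of_charFun ?_
  ext t
  rw [charFun_cp, charFun_map_sum_pi_eq_prod]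
  simp

lemma nsl_eq (m : ℕ) :
    Measure.map (fun z : Fin m → ℝ => (∑ i, z i) / Real.sqrt m) (Measure.pi fun _ : Fin m => μ) =
      Q μ m := by
  rw [Q, ← pi_sum_law, Measure.map_map (by fun_prop) (by fun_prop)]
  rfl

lemma conv_moments {α β : Measure ℝ} [IsProbabilityMeasure α] [IsProbabilityMeasure β]
    (j2 : Integrable (fun x => x ^ 2) α) (m1 : ∫ x, x ∂α = 0)
    (i2 : Integrable (fun x => x ^ 2) β) (h1 : ∫ x, x ∂β = 0) :
    Integrable (fun x => x ^ 2) (α ∗ β) ∧ ∫ x, x ∂(α ∗ β) = 0 ∧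
      ∫ x, x ^ 2 ∂(α ∗ β) = ∫ x, x ^ 2 ∂α + ∫ x, x ^ 2 ∂β := by
  have i1 : Integrable (fun x => x) β := integrable_of_sq (by fun_prop) i2
  have j1 : Integrable (fun x => x) α := integrable_of_sq (by fun_prop) j2
  have p1 : Integrable (fun p : ℝ × ℝ => p.1) (α.prod β) := j1.comp_fst β
  have p2 : Integrable (fun p : ℝ × ℝ => p.2) (α.prod β) := i1.comp_snd _
  have p11 : Integrable (fun p : ℝ × ℝ => p.1 ^ 2) (α.prod β) := j2.comp_fst β
  have p22 : Integrable (fun p : ℝ × ℝ => p.2 ^ 2) (α.prod β) := i2.comp_snd _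
  have p12 : Integrable (fun p : ℝ × ℝ => p.1 * p.2) (α.prod β) := j1.mul_prod i1
  have ha : Integrable (fun p : ℝ × ℝ => p.1 ^ 2 + 2 * (p.1 * p.2)) (α.prod β) :=
    p11.add (p12.const_mul 2)
  have hb : Integrable (fun p : ℝ × ℝ => p.1 ^ 2 + 2 * (p.1 * p.2) + p.2 ^ 2) (α.prod β) :=
    ha.add p22
  have hadd : Measurable (fun p : ℝ × ℝ => p.1 + p.2) := by fun_prop
  have ecp : α ∗ β = (α.prod β).map (fun p => p.1 + p.2) := rfl
  have esq : ∀ p : ℝ × ℝ, (p.1 + p.2) ^ 2 = p.1 ^ 2 + 2 * (p.1 * p.2) + p.2 ^ 2 :=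
    fun p => by ring
  rw [ecp]
  refine ⟨?_, ?_, ?_⟩
  · rw [integrable_map_measure (by fun_prop) hadd.aemeasurable]
    exact hb.congr (Eventually.of_forall fun p => (esq p).symm)
  · rw [integral_map hadd.aemeasurable (by fun_prop), integral_add p1 p2]
    rw [integral_fun_fst (f := fun x : ℝ => x), integral_fun_snd (f := fun x : ℝ => x)]
    simp [m1, h1]
  · rw [integral_map hadd.aemeasurable (by fun_prop)]
    simp_rw [esq]
    rw [integral_add ha p22, integral_add p11 (p12.const_mul 2), integral_const_mul,
      integral_prod_mul (fun x : ℝ => x) (fun x : ℝ => x),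
      integral_fun_fst (f := fun x : ℝ => x ^ 2), integral_fun_snd (f := fun x : ℝ => x ^ 2)]
    simp [m1, h1]

lemma cp_moments (h1 : ∫ x, x ∂μ = 0) (h2 : ∫ x, x ^ 2 ∂μ = 1) (n : ℕ) :
    Integrable (fun x => x ^ 2) (cp μ n) ∧ ∫ x, x ∂(cp μ n) = 0 ∧ ∫ x, x ^ 2 ∂(cp μ n) = n := by
  induction n with
  | zero =>
    have : cp μ 0 = Measure.dirac 0 := rfl
    rw [this]
    refine ⟨integrable_dirac (by simp), by simp, by simp⟩
  | succ n ih =>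
    obtain ⟨j2, m1, m2⟩ := ih
    have := conv_moments j2 m1 (sq_int h2) h1
    refine ⟨this.1, this.2.1, ?_⟩
    rw [cp, this.2.2, m2, h2]; simp

lemma Q_mean (h1 : ∫ x, x ∂μ = 0) (h2 : ∫ x, x ^ 2 ∂μ = 1) (n : ℕ) : ∫ x, x ∂(Q μ n) = 0 := by
  rw [Q, integral_map (by fun_prop) (by fun_prop), integral_div, (cp_moments μ h1 h2 n).2.1]
  simp

lemma Q_var (h1 : ∫ x, x ∂μ = 0) (h2 : ∫ x, x ^ 2 ∂μ = 1) {n : ℕ} (hn : 1 ≤ n) :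
    ∫ x, x ^ 2 ∂(Q μ n) = 1 := by
  have hm' : (0 : ℝ) < n := by exact_mod_cast hn
  rw [Q, integral_map (by fun_prop) (by fun_prop)]
  simp_rw [div_pow]
  rw [integral_div, (cp_moments μ h1 h2 n).2.2, Real.sq_sqrt hm'.le, div_self hm'.ne']

noncomputable def toPM (P : Measure ℝ) [h : IsProbabilityMeasure P] : ProbabilityMeasure ℝ := ⟨P, h⟩

lemma Q_tendsto (h1 : ∫ x, x ∂μ = 0) (h2 : ∫ x, x ^ 2 ∂μ = 1) :
    Tendsto (fun m => toPM (Q μ m)) atTop (𝓝 (toPM (gaussianReal 0 1))) := by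
  refine ProbabilityMeasure.tendsto_iff_tendsto_charFun.2 fun t => ?_
  have h := tendsto_charFun_inv_sqrt_mul_pow (P := μ) (X := id) aemeasurable_id
    (by simpa using h1) (by simpa using h2) t
  have e : ∀ n : ℕ, charFun (Q μ n) t = (charFun (μ.map id) ((Real.sqrt n)⁻¹ * t)) ^ n := by
    intro n
    have : (fun x : ℝ => x / Real.sqrt n) = fun x => (Real.sqrt n)⁻¹ * x := by
      ext x; rw [div_eq_inv_mul]
    rw [Q, this, charFun_map_mul, charFun_cp, Measure.map_id]
  simp only [toPM, ProbabilityMeasure.coe_mk, e]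
  convert! h using 2
  rw [charFun_gaussianReal]
  simp [neg_div]

end
end ECLT

namespace ECLT

lemma gauss_moments {s : ℝ} (hs : 0 < s) :
    Integrable (fun x => x ^ 2) (gaussianReal 0 s.toNNReal) ∧
    ∫ x, x ∂(gaussianReal 0 s.toNNReal) = 0 ∧ ∫ x, x ^ 2 ∂(gaussianReal 0 s.toNNReal) = s := by
  have h1 : ∫ x, x ∂(gaussianReal 0 s.toNNReal) = 0 := integral_id_gaussianReal
  refine ⟨(memLp_id_gaussianReal (μ := 0) (v := s.toNNReal) 2).integrable_sq, h1, ?_⟩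
  have h2 := variance_fun_id_gaussianReal (μ := 0) (v := s.toNNReal)
  rw [variance_of_integral_eq_zero (by fun_prop) h1] at h2
  rw [h2]; simp [hs.le]

section
variable {P : Measure ℝ} [IsProbabilityMeasure P]

lemma int_x2 {k : ℝ → ℝ} {s : ℝ} (hs : 0 < s) (h2 : ∫ x, x ^ 2 ∂P = 1) (hk : Continuous k)
    (h : ∀ x, |k x| ≤ Ac s * W s x) {g : ℝ → ℝ} (hg : Continuous g) (hg2 : ∀ x, |g x| ≤ 1 + x ^ 2) :
    Integrable (fun x => g x * dn k P x) := by
  refine ((integrable_dn_W' hs (sq_int h2)).const_mul (Ac s)).mono' ?_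
    (Eventually.of_forall fun x => ?_)
  · exact (hg.mul (cont_dn hk (bdd_of hs hs h))).aestronglyMeasurable
  · rw [Real.norm_eq_abs, abs_mul]
    have e1 := dn_bd (P := P) hk hs hs h x
    calc _ ≤ (1 + x ^ 2) * (Ac s * dn (W s) P x) := by
          gcongr
          exact hg2 x
      _ = _ := by ring

lemma second_moment {s : ℝ} (hs : 0 < s) (h1 : ∫ x, x ∂P = 0) (h2 : ∫ x, x ^ 2 ∂P = 1) :
    ∫ x, x ^ 2 * dn (k0 s) P x = 1 + s := by
  obtain ⟨a, b, c⟩ := gauss_moments hs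
  have := (conv_moments (sq_int h2) h1 a b).2.2
  rw [h2, c, conv_gaussian hs, integral_wd (cont_d0 hs) fun x => (dn_pos hs x).le] at this
  rw [← this]
  simp_rw [mul_comm]

lemma abs_le_q (x : ℝ) : |x| ≤ 1 + x ^ 2 := by
  rw [← sq_abs]; nlinarith [sq_nonneg (|x| - 1), abs_nonneg x]

lemma first_moment_d1 {s : ℝ} (hs : 0 < s) (h2 : ∫ x, x ^ 2 ∂P = 1) :
    ∫ x, x * dn (k1 s) P x = -1 := by
  have ibp := integral_mul_deriv_eq_deriv_mul_of_integrable
      (u := fun x : ℝ => x) (v := dn (k0 s) P)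
      (u' := fun x => 1) (v' := dn (k1 s) P)
      (fun x _ => hasDerivAt_id x) (fun x _ => deriv_d0 hs x)
      (int_x2 hs h2 (cont_k1 s) (k1_bd hs le_rfl le_rfl) continuous_id abs_le_q)
      ((integrable_dn (P := P) (integrable_k0 hs)).congr (Eventually.of_forall fun x => by simp))
      (int_x2 hs h2 (cont_k0 s) (k0_bd hs le_rfl le_rfl) continuous_id abs_le_q)
  rw [ibp]
  simp [integral_dn (integrable_k0 hs), integral_k0 hs]

lemma cramer_rao {s : ℝ} (hs : 0 < s) (h1 : ∫ x, x ∂P = 0) (h2 : ∫ x, x ^ 2 ∂P = 1) :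
    1 / (1 + s) ≤ Jf P s := by
  set c := 1 / (1 + s) with hc
  have i1 : Integrable (fun x => x * dn (k1 s) P x) :=
    int_x2 hs h2 (cont_k1 s) (k1_bd hs le_rfl le_rfl) continuous_id abs_le_q
  have i0 : Integrable (fun x => x ^ 2 * dn (k0 s) P x) :=
    int_x2 hs h2 (cont_k0 s) (k0_bd hs le_rfl le_rfl) (by fun_prop) (fun x => by
      rw [abs_of_nonneg (sq_nonneg x)]; linarith)
  have iJ := integrable_fisher (P := P) hs
  have h : 0 ≤ ∫ x, (dn (k1 s) P x ^ 2 / dn (k0 s) P x + 2 * c * (x * dn (k1 s) P x) +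
      c ^ 2 * (x ^ 2 * dn (k0 s) P x)) := by
    refine integral_nonneg fun x => ?_
    have hp := dn_pos (P := P) hs x
    have e : dn (k1 s) P x ^ 2 / dn (k0 s) P x + 2 * c * (x * dn (k1 s) P x) +
      c ^ 2 * (x ^ 2 * dn (k0 s) P x) = (dn (k1 s) P x + c * x * dn (k0 s) P x) ^ 2 / dn (k0 s) P x := by
      field_simp; ring
    simp only [Pi.zero_apply]
    rw [e]; positivity
  have i3 : Integrable (fun x => dn (k1 s) P x ^ 2 / dn (k0 s) P x + 2 * c * (x * dn (k1 s) P x)) :=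
    iJ.add (i1.const_mul _)
  rw [integral_add i3 (i0.const_mul _), integral_add iJ (i1.const_mul _), integral_const_mul,
    integral_const_mul, first_moment_d1 hs h2, second_moment hs h1 h2] at h
  change 0 ≤ Jf P s + _ + _ at h
  have e : c ^ 2 * (1 + s) = c := by rw [hc]; field_simp
  linarith

end

lemma dn_gauss {s : ℝ} (hs : 0 < s) : dn (k0 s) (gaussianReal 0 1) = k0 (1 + s) := by
  have hs1 : 0 < 1 + s := by linarith
  have c1 : Continuous (dn (k0 s) (gaussianReal 0 1)) := cont_d0 hs
  have h1 : gaussianReal 0 1 ∗ gaussianReal 0 s.toNNReal = gaussianReal 0 (1 + s).toNNReal := by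
    rw [gaussianReal_conv_gaussianReal, Real.toNNReal_add (by norm_num) hs.le]; simp
  have h2 : gaussianReal 0 (1 + s).toNNReal = volume.withDensity (fun x => ENNReal.ofReal (k0 (1 + s) x)) := by
    rw [gaussianReal_of_var_ne_zero _ (by simpa using hs1)]
    congr 1; ext x
    simp [gaussianPDF, k0_eq hs1]
  rw [conv_gaussian hs, h2] at h1
  have c2 := cont_k0 (1 + s)
  have h3 := (withDensity_eq_iff_of_sigmaFinite
    (ENNReal.measurable_ofReal.comp c1.measurable).aemeasurable
    (ENNReal.measurable_ofReal.comp c2.measurable).aemeasurable).1 h1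
  refine (Continuous.ae_eq_iff_eq volume c1 c2).1 ?_
  filter_upwards [h3] with x hx
  exact (ENNReal.ofReal_eq_ofReal_iff (dn_pos hs x).le (k0_pos hs1 x).le).1 hx

lemma Jf_gauss {s : ℝ} (hs : 0 < s) : Jf (gaussianReal 0 1) s = 1 / (1 + s) := by
  have hs1 : 0 < 1 + s := by linarith
  have e1 : ∀ x, dn (k1 s) (gaussianReal 0 1) x = k1 (1 + s) x := fun x => by
    have h1 := deriv_d0 (P := gaussianReal 0 1) hs x
    rw [dn_gauss hs] at h1
    exact h1.unique (hasDerivAt_k0 hs1 x)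
  unfold Jf
  rw [← integral_kq hs1, dn_gauss hs]
  simp_rw [e1]
  congr 1; ext x
  have := k0_pos hs1 x
  unfold k1 kq
  field_simp

lemma tendsto_dn {k : ℝ → ℝ} (hk : Continuous k) {C : ℝ} (hC : ∀ x, |k x| ≤ C) {ι : Type*}
    {l : Filter ι} {R : ι → ProbabilityMeasure ℝ} {R0 : ProbabilityMeasure ℝ}
    (h : Tendsto R l (𝓝 R0)) (x : ℝ) :
    Tendsto (fun i => dn k (R i) x) l (𝓝 (dn k R0 x)) := by
  have := (ProbabilityMeasure.tendsto_iff_forall_integral_tendsto.1 h)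
    (BoundedContinuousFunction.ofNormedAddCommGroup (fun y => k (x - y)) (by fun_prop) C
      (fun y => hC _))
  exact this

lemma Jf_tendsto (μ : Measure ℝ) [IsProbabilityMeasure μ] (h1 : ∫ x, x ∂μ = 0)
    (h2 : ∫ x, x ^ 2 ∂μ = 1) {s : ℝ} (hs : 0 < s) :
    Tendsto (fun m => Jf (Q μ m) s) atTop (𝓝 (1 / (1 + s))) := by
  have hT := Q_tendsto μ h1 h2
  set γ := gaussianReal 0 1 with hγ
  set D := fun (P : Measure ℝ) x => dn (kq s) P x - dn (k1 s) P x ^ 2 / dn (k0 s) P x with hD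
  have hDm : ∀ (P : Measure ℝ) [IsProbabilityMeasure P], Continuous (D P) := fun P _ =>
    (cont_dq hs).sub (cont_fisher hs)
  have hDi : ∀ (P : Measure ℝ) [IsProbabilityMeasure P], Integrable (D P) := fun P _ =>
    (integrable_dn (integrable_kq hs)).sub (integrable_fisher hs)
  have hD0 : ∀ (P : Measure ℝ) [IsProbabilityMeasure P] x, 0 ≤ D P x := fun P _ x =>
    sub_nonneg.2 (fisher_le hs x)
  have hDI : ∀ (P : Measure ℝ) [IsProbabilityMeasure P],
      ∫⁻ x, ENNReal.ofReal (D P x) = ENNReal.ofReal (1 / s - Jf P s) := fun P _ => by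
    rw [← ofReal_integral_eq_lintegral_ofReal (hDi P) (Eventually.of_forall (hD0 P))]
    simp only [hD]
    rw [integral_sub (integrable_dn (integrable_kq hs)) (integrable_fisher hs),
      integral_dn (integrable_kq hs), integral_kq hs]
    rfl
  have hpt : ∀ x, Tendsto (fun m => ENNReal.ofReal (D (Q μ m) x)) atTop
      (𝓝 (ENNReal.ofReal (D γ x))) := by
    intro x
    refine ENNReal.tendsto_ofReal ?_
    refine (tendsto_dn (cont_kq s) (bdd_kq hs) hT x).sub
      (((tendsto_dn (cont_k1 s) (bdd_k1 hs) hT x).pow 2).div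
      (tendsto_dn (cont_k0 s) (bdd_k0 hs) hT x) (dn_pos (P := γ) hs x).ne')
  have hF := lintegral_liminf_le (μ := (volume : Measure ℝ)) (u := atTop)
    (f := fun m x => ENNReal.ofReal (D (Q μ m) x))
    (fun m => (by have := (hDm (Q μ m)).measurable; fun_prop))
  have e1 : ∫⁻ x, liminf (fun m => ENNReal.ofReal (D (Q μ m) x)) atTop =
      ENNReal.ofReal (1 / s - 1 / (1 + s)) := by
    rw [← Jf_gauss hs, ← hDI]
    exact lintegral_congr fun x => (hpt x).liminf_eq
  rw [e1] at hF
  simp_rw [hDI] at hF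
  have hCR : ∀ᶠ m in atTop, 1 / (1 + s) ≤ Jf (Q μ m) s := by
    filter_upwards [eventually_ge_atTop 1] with m hm
    exact cramer_rao hs (Q_mean μ h1 h2 m) (Q_var μ h1 h2 hm)
  have hlt : 0 < 1 / s - 1 / (1 + s) := by
    rw [sub_pos]; gcongr; linarith
  have hlim : Tendsto (fun m => ENNReal.ofReal (1 / s - Jf (Q μ m) s)) atTop
      (𝓝 (ENNReal.ofReal (1 / s - 1 / (1 + s)))) := by
    refine tendsto_of_le_liminf_of_limsup_le hF ?_
    refine limsup_le_of_le (by isBoundedDefault) ?_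
    filter_upwards [hCR] with m hm
    exact ENNReal.ofReal_le_ofReal (by linarith)
  have h3 := (ENNReal.tendsto_toReal ENNReal.ofReal_ne_top).comp hlim
  rw [ENNReal.toReal_ofReal hlt.le] at h3
  have h4 : Tendsto (fun m => 1 / s - Jf (Q μ m) s) atTop (𝓝 (1 / s - 1 / (1 + s))) := by
    refine h3.congr' ?_
    filter_upwards [h3.eventually (lt_mem_nhds hlt)] with m hm
    simp only [Function.comp] at hm ⊢
    rw [ENNReal.toReal_ofReal]
    by_contra hc
    rw [ENNReal.ofReal_of_nonpos (not_le.1 hc).le] at hm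
    simp at hm
  have h5 := h4.const_sub (1 / s)
  simpa using h5

end ECLT

namespace ECLT

/-- Relative entropy of `P ∗ N(0,s)` with respect to `N(0,1+s)`. -/
noncomputable def Kf (P : Measure ℝ) (s : ℝ) : ℝ :=
  Hf P s + (1 / 2 * Real.log (2 * Real.pi * (1 + s)) + 1 / 2)

lemma gauss_conv_density {s : ℝ} (hs : 0 < s) :
    gaussianReal 0 1 ∗ gaussianReal 0 s.toNNReal =
      volume.withDensity (fun x => ENNReal.ofReal (k0 (1 + s) x)) := by
  rw [conv_gaussian hs, dn_gauss hs]

section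
variable {P : Measure ℝ} [IsProbabilityMeasure P]

lemma kl_conv {s : ℝ} (hs : 0 < s) (h1 : ∫ x, x ∂P = 0) (h2 : ∫ x, x ^ 2 ∂P = 1) :
    0 ≤ Kf P s ∧ InformationTheory.klDiv (P ∗ gaussianReal 0 s.toNNReal)
      (gaussianReal 0 1 ∗ gaussianReal 0 s.toNNReal) = ENNReal.ofReal (Kf P s) := by
  have hs1 : 0 < 1 + s := by linarith
  set A := P ∗ gaussianReal 0 s.toNNReal with hA
  set B := gaussianReal 0 1 ∗ gaussianReal 0 s.toNNReal with hB
  set f := dn (k0 s) P with hf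
  set g := k0 (1 + s) with hg
  have cf : Continuous f := cont_d0 hs
  have cg : Continuous g := cont_k0 _
  have pf : ∀ x, 0 < f x := dn_pos hs
  have pg : ∀ x, 0 < g x := k0_pos hs1
  have mf := cf.measurable
  have mg := cg.measurable
  have eA : A = volume.withDensity (fun x => ENNReal.ofReal (f x)) := conv_gaussian hs
  have eB : B = volume.withDensity (fun x => ENNReal.ofReal (g x)) := gauss_conv_density hs
  have hm : Measurable (fun x => ENNReal.ofReal (f x / g x)) := by fun_prop
  have eAB : A = B.withDensity (fun x => ENNReal.ofReal (f x / g x)) := by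
    rw [eB, ← withDensity_mul _ (by fun_prop) hm, eA]
    congr 1; ext x
    simp only [Pi.mul_apply]
    rw [← ENNReal.ofReal_mul (pg x).le]
    congr 1
    have := (pg x).ne'
    field_simp
  have hac : A ≪ B := by rw [eAB]; exact withDensity_absolutelyContinuous _ _
  have hrn : A.rnDeriv B =ᵐ[B] fun x => ENNReal.ofReal (f x / g x) := by
    conv_lhs => rw [eAB]
    exact Measure.rnDeriv_withDensity B hm
  set c := 1 / 2 * Real.log (2 * Real.pi * (1 + s)) with hc
  have hllr : llr A B =ᵐ[A] fun x => Real.log (f x) + c + x ^ 2 / (2 * (1 + s)) := by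
    filter_upwards [hac.ae_le hrn] with x hx
    rw [llr, hx, ENNReal.toReal_ofReal (div_nonneg (pf x).le (pg x).le),
      Real.log_div (pf x).ne' (pg x).ne', hg, log_k0 hs1, hc]
    ring
  have i1 : Integrable (fun x => f x * Real.log (f x)) :=
    integrable_k_log hs h1 h2 (cont_k0 s) (k0_bd hs le_rfl le_rfl)
  have i2 : Integrable (fun x => x ^ 2 * f x) :=
    int_x2 hs h2 (cont_k0 s) (k0_bd hs le_rfl le_rfl) (by fun_prop) (fun x => by
      rw [abs_of_nonneg (sq_nonneg x)]; linarith)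
  have i0 : Integrable f := integrable_dn (integrable_k0 hs)
  have e : ∀ x, f x * (Real.log (f x) + c + x ^ 2 / (2 * (1 + s))) =
      f x * Real.log (f x) + c * f x + 1 / (2 * (1 + s)) * (x ^ 2 * f x) := fun x => by
    field_simp
  have i3 : Integrable (fun x => f x * Real.log (f x) + c * f x) := i1.add (i0.const_mul c)
  have hint : Integrable (llr A B) A := by
    rw [integrable_congr hllr, eA, integrable_wd cf fun x => (pf x).le]
    simp_rw [e]
    exact i3.add (i2.const_mul _)
  have hK : ∫ x, llr A B x ∂A = Kf P s := by
    rw [integral_congr_ae hllr, eA, integral_wd cf fun x => (pf x).le]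
    simp_rw [e]
    rw [integral_add i3 (i2.const_mul _), integral_add i1 (i0.const_mul _), integral_const_mul,
      integral_const_mul, second_moment hs h1 h2, integral_dn (integrable_k0 hs), integral_k0 hs]
    rw [Kf, Hf, add_assoc]
    congr 1
    rw [hc]; field_simp
  have ht := InformationTheory.toReal_klDiv_of_measure_eq hac (by simp [A, B])
  rw [hK] at ht
  refine ⟨ht ▸ ENNReal.toReal_nonneg, ?_⟩
  rw [← ht, ENNReal.ofReal_toReal (InformationTheory.klDiv_ne_top hac hint)]

lemma deriv_Kf {s : ℝ} (hs : 0 < s) (h1 : ∫ x, x ∂P = 0) (h2 : ∫ x, x ^ 2 ∂P = 1) :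
    HasDerivAt (Kf P) (-(1 / 2) * (Jf P s - 1 / (1 + s))) s := by
  have hpi := Real.pi_pos
  have hl : HasDerivAt (fun s : ℝ => 2 * Real.pi * (1 + s)) (2 * Real.pi) s := by
    simpa using ((hasDerivAt_id s).const_add 1).const_mul (2 * Real.pi)
  have := (deriv_Hf hs h1 h2).add (((hl.log (by positivity)).const_mul (1 / 2)).add_const (1 / 2))
  convert! this using 1
  field_simp
  ring

lemma Kf_tendsto (h1 : ∫ x, x ∂P = 0) (h2 : ∫ x, x ^ 2 ∂P = 1) :
    Tendsto (Kf P) atTop (𝓝 0) := by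
  have hpi := Real.pi_pos
  have hlim : Tendsto (fun s : ℝ => 1 / (2 * s)) atTop (𝓝 0) := by
    have h := (tendsto_inv_atTop_zero (𝕜 := ℝ)).const_mul (1 / 2)
    simp only [mul_zero] at h
    exact h.congr fun s => by rw [one_div, one_div, mul_inv]
  refine tendsto_of_tendsto_of_tendsto_of_le_of_le' tendsto_const_nhds hlim ?_ ?_
  · filter_upwards [eventually_gt_atTop 0] with s hs
    exact (kl_conv hs h1 h2).1
  · filter_upwards [eventually_gt_atTop 0] with s hs
    have := Hf_le hs h1 h2
    have hl := Real.log_le_sub_one_of_pos (show 0 < (1 + s) / s by positivity)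
    have e : Real.log ((1 + s) / s) =
        Real.log (2 * Real.pi * (1 + s)) - Real.log (2 * Real.pi * s) := by
      rw [← Real.log_div (by positivity) (by positivity)]; congr 1; field_simp
    have e2 : (1 + s) / s - 1 = 1 / s := by field_simp; ring
    have e3 : 1 / (2 * s) = 1 / 2 * (1 / s) := by field_simp
    rw [e, e2] at hl
    rw [e3, Kf]
    linarith

lemma Kf_eq {s : ℝ} (hs : 0 < s) (h1 : ∫ x, x ∂P = 0) (h2 : ∫ x, x ^ 2 ∂P = 1) :
    ENNReal.ofReal (Kf P s) =
      ∫⁻ u in Set.Ioi s, ENNReal.ofReal (1 / 2 * (Jf P u - 1 / (1 + u))) := by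
  have hd : ∀ x ∈ Set.Ici s, HasDerivAt (Kf P) (-(1 / 2) * (Jf P x - 1 / (1 + x))) x :=
    fun x hx => deriv_Kf (hs.trans_le hx) h1 h2
  have hq : ∀ x ∈ Set.Ioi s, 0 ≤ 1 / 2 * (Jf P x - 1 / (1 + x)) := fun x hx => by
    have := cramer_rao (hs.trans hx) h1 h2
    linarith
  have hn : ∀ x ∈ Set.Ioi s, -(1 / 2) * (Jf P x - 1 / (1 + x)) ≤ 0 := fun x hx => by
    have := hq x hx
    linarith
  have hi := integrableOn_Ioi_deriv_of_nonpos' hd hn (Kf_tendsto h1 h2)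
  have hI := integral_Ioi_of_hasDerivAt_of_nonpos' hd hn (Kf_tendsto h1 h2)
  have e : ∀ x, -(1 / 2) * (Jf P x - 1 / (1 + x)) = -(1 / 2 * (Jf P x - 1 / (1 + x))) :=
    fun x => by ring
  simp_rw [e] at hi hI
  rw [integral_neg, zero_sub, neg_inj] at hI
  rw [← hI]
  refine ofReal_integral_eq_lintegral_ofReal ?_ ?_
  · have h := Integrable.neg hi
    refine h.congr (Eventually.of_forall fun x => ?_)
    simp only [Pi.neg_apply, neg_neg]
  · rw [Filter.EventuallyLE, ae_restrict_iff' measurableSet_Ioi]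
    exact Eventually.of_forall hq

/-- The integrated Fisher information gap. -/
noncomputable def Lf (P : Measure ℝ) : ℝ≥0∞ :=
  ∫⁻ u in Set.Ioi 0, ENNReal.ofReal (1 / 2 * (Jf P u - 1 / (1 + u)))

lemma meas_q (h1 : ∫ x, x ∂P = 0) (h2 : ∫ x, x ^ 2 ∂P = 1) :
    AEMeasurable (fun u => ENNReal.ofReal (1 / 2 * (Jf P u - 1 / (1 + u))))
      (volume.restrict (Set.Ioi 0)) := by
  have hm : Measurable (fun u => ENNReal.ofReal (-deriv (Kf P) u)) := by
    have := measurable_deriv (Kf P)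
    fun_prop
  refine hm.aemeasurable.congr ?_
  rw [Filter.EventuallyEq, ae_restrict_iff' measurableSet_Ioi]
  refine Eventually.of_forall fun u hu => ?_
  rw [(deriv_Kf hu h1 h2).deriv]
  congr 1; ring

lemma Kf_le_Lf {s : ℝ} (hs : 0 < s) (h1 : ∫ x, x ∂P = 0) (h2 : ∫ x, x ^ 2 ∂P = 1) :
    ENNReal.ofReal (Kf P s) ≤ Lf P := by
  rw [Kf_eq hs h1 h2]
  exact lintegral_mono_set (Set.Ioi_subset_Ioi hs.le)

lemma Lf_le {D : ℝ≥0∞} (h1 : ∫ x, x ∂P = 0) (h2 : ∫ x, x ^ 2 ∂P = 1)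
    (h : ∀ s, 0 < s → ENNReal.ofReal (Kf P s) ≤ D) : Lf P ≤ D := by
  have e : Set.Ioi (0 : ℝ) = ⋃ n : ℕ, Set.Ioi (1 / ((n : ℝ) + 1)) := by
    ext x
    simp only [Set.mem_Ioi, Set.mem_iUnion]
    constructor
    · exact fun hx => exists_nat_one_div_lt hx
    · rintro ⟨n, hn⟩
      exact lt_trans (by positivity) hn
  have hmono : Monotone fun n : ℕ => Set.Ioi (1 / ((n : ℝ) + 1)) := by
    intro a b hab
    refine Set.Ioi_subset_Ioi ?_
    have : (a : ℝ) ≤ b := by exact_mod_cast hab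
    gcongr
  rw [Lf, e, setLIntegral_iUnion_of_directed _ hmono.directed_le]
  refine iSup_le fun n => ?_
  rw [← Kf_eq (by positivity) h1 h2]
  exact h _ (by positivity)

lemma data_proc (s : ℝ) :
    InformationTheory.klDiv (P ∗ gaussianReal 0 s.toNNReal)
      (gaussianReal 0 1 ∗ gaussianReal 0 s.toNNReal) ≤ InformationTheory.klDiv P (gaussianReal 0 1) := by
  have hadd : Measurable (fun p : ℝ × ℝ => p.1 + p.2) := by fun_prop
  have h := InformationTheory.klDiv_map_le (P.prod (gaussianReal 0 s.toNNReal))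
    ((gaussianReal 0 1).prod (gaussianReal 0 s.toNNReal)) hadd
  refine h.trans (le_of_eq ?_)
  rw [← Measure.compProd_const, ← Measure.compProd_const, InformationTheory.klDiv_compProd_left]

lemma Lf_le_kl (h1 : ∫ x, x ∂P = 0) (h2 : ∫ x, x ^ 2 ∂P = 1) :
    Lf P ≤ InformationTheory.klDiv P (gaussianReal 0 1) :=
  Lf_le h1 h2 fun s hs => by
    rw [← (kl_conv hs h1 h2).2]
    exact data_proc s

end
end ECLT

namespace ECLT

lemma bdd_int {A : Measure ℝ} [IsFiniteMeasure A] {f : ℝ → ℝ} {N : ℝ} (hf : Measurable f)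
    (hb : ∀ x, |f x| ≤ N) : Integrable f A :=
  Integrable.of_bound hf.aestronglyMeasurable N (Eventually.of_forall hb)

lemma bdd_int_exp {A : Measure ℝ} [IsFiniteMeasure A] {f : ℝ → ℝ} {N : ℝ} (hf : Measurable f)
    (hb : ∀ x, |f x| ≤ N) : Integrable (fun x => Real.exp (f x)) A :=
  Integrable.of_bound (Real.measurable_exp.comp hf).aestronglyMeasurable (Real.exp N)
    (Eventually.of_forall fun x => by
      rw [Real.norm_eq_abs, abs_of_pos (Real.exp_pos _)]
      exact Real.exp_le_exp.2 (le_of_abs_le (hb x)))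

lemma young {r p : ℝ} (hr : 0 ≤ r) : r * p - (Real.exp p - 1) ≤ InformationTheory.klFun r := by
  rw [InformationTheory.klFun_apply]
  rcases hr.eq_or_lt with rfl | h
  · simp [Real.exp_nonneg]
  · have h1 := Real.add_one_le_exp (p - Real.log r)
    rw [Real.exp_sub, Real.exp_log h, le_div_iff₀ h] at h1
    nlinarith

lemma int_as_dens {A R : Measure ℝ} [IsProbabilityMeasure A] [IsProbabilityMeasure R] (hac : A ≪ R)
    {f : ℝ → ℝ} {N : ℝ} (hf : Measurable f) (hb : ∀ x, |f x| ≤ N) :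
    Integrable (fun x => (A.rnDeriv R x).toReal * f x) R ∧
      ∫ x, (A.rnDeriv R x).toReal * f x ∂(R) = ∫ x, f x ∂A := by
  constructor
  · have := (integrable_rnDeriv_smul_iff hac (f := f)).2 (bdd_int hf hb)
    simpa using this
  · have := integral_rnDeriv_smul hac (f := f)
    simpa using this

lemma dv {A R : Measure ℝ} [IsProbabilityMeasure A] [IsProbabilityMeasure R] {B : ℝ} (hB : 0 ≤ B)
    (hK : InformationTheory.klDiv A R ≤ ENNReal.ofReal B)
    {f : ℝ → ℝ} {N : ℝ} (hf : Measurable f) (hb : ∀ x, |f x| ≤ N) :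
    ∫ x, f x ∂A - ∫ x, (Real.exp (f x) - 1) ∂(R) ≤ B := by
  obtain ⟨hac, hi⟩ := InformationTheory.klDiv_ne_top_iff.1 (ne_top_of_le_ne_top ENNReal.ofReal_ne_top hK)
  have h1 : (InformationTheory.klDiv A R).toReal ≤ B := ENNReal.toReal_le_of_le_ofReal hB hK
  rw [InformationTheory.toReal_klDiv_eq_integral_klFun hac] at h1
  refine le_trans ?_ h1
  obtain ⟨i1, e1⟩ := int_as_dens hac hf hb
  have i2 : Integrable (fun x => Real.exp (f x) - 1) R :=
    (bdd_int_exp hf hb).sub (integrable_const 1)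
  rw [← e1, ← integral_sub i1 i2]
  refine integral_mono (i1.sub i2) ((InformationTheory.integrable_klFun_rnDeriv_iff hac).2 hi) ?_
  intro x
  exact young ENNReal.toReal_nonneg

lemma smooth_tendsto (P : Measure ℝ) [IsProbabilityMeasure P] :
    Tendsto (fun n : ℕ => toPM (P ∗ gaussianReal 0 (1 / ((n : ℝ) + 1)).toNNReal)) atTop
      (𝓝 (toPM P)) := by
  refine ProbabilityMeasure.tendsto_iff_tendsto_charFun.2 fun t => ?_
  simp only [toPM, ProbabilityMeasure.coe_mk, charFun_conv, charFun_gaussianReal]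
  have h0 : Tendsto (fun n : ℕ => 1 / ((n : ℝ) + 1)) atTop (𝓝 0) :=
    tendsto_one_div_add_atTop_nhds_zero_nat
  have h : Tendsto (fun n : ℕ => charFun P t * Complex.exp (t * ((0 : ℝ) : ℂ) * Complex.I
      - ((1 / ((n : ℝ) + 1) : ℝ) : ℂ) * t ^ 2 / 2)) atTop
      (𝓝 (charFun P t * Complex.exp (t * ((0 : ℝ) : ℂ) * Complex.I - ((0 : ℝ) : ℂ) * t ^ 2 / 2))) := by
    have h0' := (Complex.continuous_ofReal.tendsto 0).comp h0
    refine Tendsto.const_mul _ ?_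
    refine (Complex.continuous_exp.tendsto _).comp ?_
    refine tendsto_const_nhds.sub ?_
    exact (h0'.mul_const _).div_const _
  have e : charFun P t = charFun P t * Complex.exp (t * ((0 : ℝ) : ℂ) * Complex.I
      - ((0 : ℝ) : ℂ) * t ^ 2 / 2) := by simp
  rw [← e] at h
  refine h.congr fun n => ?_
  have hp : (0 : ℝ) ≤ 1 / ((n : ℝ) + 1) := by positivity
  rw [Real.coe_toNNReal _ hp]

section
variable {P : Measure ℝ} [IsProbabilityMeasure P] {B : ℝ}

lemma dv_cont (hB : 0 ≤ B)
    (hK : ∀ s : ℝ, 0 < s → InformationTheory.klDiv (P ∗ gaussianReal 0 s.toNNReal)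
      (gaussianReal 0 1 ∗ gaussianReal 0 s.toNNReal) ≤ ENNReal.ofReal B)
    {f : ℝ → ℝ} {N : ℝ} (hf : Continuous f) (hb : ∀ x, |f x| ≤ N) :
    ∫ x, f x ∂P - ∫ x, (Real.exp (f x) - 1) ∂(gaussianReal 0 1) ≤ B := by
  let F : BoundedContinuousFunction ℝ ℝ := BoundedContinuousFunction.ofNormedAddCommGroup f hf N hb
  have hbe : ∀ x, ‖Real.exp (f x) - 1‖ ≤ Real.exp N + 1 := fun x => by
    refine (norm_sub_le _ _).trans ?_
    rw [Real.norm_eq_abs, abs_of_pos (Real.exp_pos _), norm_one]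
    gcongr
    exact le_of_abs_le (hb x)
  let G : BoundedContinuousFunction ℝ ℝ := BoundedContinuousFunction.ofNormedAddCommGroup
    (fun x => Real.exp (f x) - 1) (by fun_prop) _ hbe
  have t1 := ProbabilityMeasure.tendsto_iff_forall_integral_tendsto.1 (smooth_tendsto P) F
  have t2 := ProbabilityMeasure.tendsto_iff_forall_integral_tendsto.1
    (smooth_tendsto (gaussianReal 0 1)) G
  have t3 := t1.sub t2
  refine le_of_tendsto t3 (Eventually.of_forall fun n => ?_)
  exact dv hB (hK (1 / ((n : ℝ) + 1)) (by positivity)) hf.measurable hb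

lemma exp_lip {a b N : ℝ} (ha : |a| ≤ N) (hb : |b| ≤ N) :
    |Real.exp a - Real.exp b| ≤ Real.exp N * |a - b| := by
  have key : ∀ a b : ℝ, |a| ≤ N → b ≤ a → Real.exp a - Real.exp b ≤ Real.exp N * (a - b) := by
    intro a b ha hab
    have h1 := Real.add_one_le_exp (b - a)
    have h2 : Real.exp b = Real.exp a * Real.exp (b - a) := by rw [← Real.exp_add]; congr 1; ring
    have h3 : Real.exp a ≤ Real.exp N := Real.exp_le_exp.2 (le_of_abs_le ha)
    have h4 := Real.exp_pos a
    rw [h2]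
    nlinarith [mul_le_mul_of_nonneg_left h1 h4.le, mul_le_mul_of_nonneg_right h3 (sub_nonneg.2 hab)]
  rcases le_total b a with h | h
  · rw [abs_of_nonneg (sub_nonneg.2 h), abs_of_nonneg (sub_nonneg.2 (Real.exp_le_exp.2 h))]
    exact key a b ha h
  · rw [abs_sub_comm, abs_sub_comm a b, abs_of_nonneg (sub_nonneg.2 h),
      abs_of_nonneg (sub_nonneg.2 (Real.exp_le_exp.2 h))]
    exact key b a hb h

lemma clip_abs {a N : ℝ} (hN : 0 ≤ N) : |max (-N) (min a N)| ≤ N := by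
  rw [abs_le]
  exact ⟨le_max_left _ _, max_le (by linarith) (min_le_right _ _)⟩

lemma clip_dist {a b N : ℝ} (hb : |b| ≤ N) : |b - max (-N) (min a N)| ≤ |b - a| := by
  obtain ⟨h1, h2⟩ := abs_le.1 hb
  have e : b = max (-N) (min b N) := by rw [min_eq_left h2, max_eq_right h1]
  have h3 := abs_max_sub_max_le_abs (min b N) (min a N) (-N)
  have h4 := abs_min_sub_min_le_max b N a N
  rw [sub_self, abs_zero, max_eq_left (abs_nonneg _)] at h4
  calc |b - max (-N) (min a N)| = |max (min b N) (-N) - max (min a N) (-N)| := by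
        rw [max_comm (min b N), ← e, max_comm (-N)]
    _ ≤ _ := h3.trans h4

lemma dv_meas (hB : 0 ≤ B)
    (hK : ∀ s : ℝ, 0 < s → InformationTheory.klDiv (P ∗ gaussianReal 0 s.toNNReal)
      (gaussianReal 0 1 ∗ gaussianReal 0 s.toNNReal) ≤ ENNReal.ofReal B)
    {f : ℝ → ℝ} {N : ℝ} (hf : Measurable f) (hb : ∀ x, |f x| ≤ N) :
    ∫ x, f x ∂P - ∫ x, (Real.exp (f x) - 1) ∂(gaussianReal 0 1) ≤ B := by
  have hN : 0 ≤ N := (abs_nonneg _).trans (hb 0)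
  refine le_of_forall_pos_le_add fun ε hε => ?_
  set δ : ℝ := ε / (1 + Real.exp N) with hδ
  have hc : 0 < 1 + Real.exp N := by positivity
  have hδ0 : 0 < δ := by positivity
  obtain ⟨g, hg, -⟩ := Integrable.exists_boundedContinuous_integral_sub_le
    (bdd_int (A := P + gaussianReal 0 1) hf hb) hδ0
  set h : ℝ → ℝ := fun x => max (-N) (min (g x) N) with hh
  have hcont : Continuous h := by fun_prop
  have hhb : ∀ x, |h x| ≤ N := fun x => clip_abs hN
  have hd : ∀ x, |f x - h x| ≤ ‖f x - g x‖ := fun x => clip_dist (hb x)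
  have ifg : Integrable (fun x => ‖f x - g x‖) (P + gaussianReal 0 1) :=
    ((bdd_int hf hb).sub (BoundedContinuousFunction.integrable _ g)).norm
  have ip := ifg.left_of_add_measure
  have ig := ifg.right_of_add_measure
  rw [integral_add_measure ip ig] at hg
  have p0 : 0 ≤ ∫ x, ‖f x - g x‖ ∂P := integral_nonneg fun _ => norm_nonneg _
  have g0 : 0 ≤ ∫ x, ‖f x - g x‖ ∂(gaussianReal 0 1) := integral_nonneg fun _ => norm_nonneg _
  have main := dv_cont hB hK hcont hhb
  have a1 : ∫ x, f x ∂P - ∫ x, h x ∂P ≤ ∫ x, ‖f x - g x‖ ∂P := by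
    rw [← integral_sub (bdd_int hf hb) (bdd_int hcont.measurable hhb)]
    exact integral_mono ((bdd_int hf hb).sub (bdd_int hcont.measurable hhb)) ip
      fun x => (le_abs_self _).trans (hd x)
  have j1 : Integrable (fun x => Real.exp (f x) - 1) (gaussianReal 0 1) :=
    (bdd_int_exp hf hb).sub (integrable_const 1)
  have j2 : Integrable (fun x => Real.exp (h x) - 1) (gaussianReal 0 1) :=
    (bdd_int_exp hcont.measurable hhb).sub (integrable_const 1)
  have a2 : ∫ x, (Real.exp (h x) - 1) ∂(gaussianReal 0 1) - ∫ x, (Real.exp (f x) - 1) ∂(gaussianReal 0 1)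
      ≤ Real.exp N * ∫ x, ‖f x - g x‖ ∂(gaussianReal 0 1) := by
    rw [← integral_sub j2 j1, ← integral_const_mul]
    refine integral_mono (j2.sub j1) (ig.const_mul _) fun x => ?_
    have l := exp_lip (hhb x) (hb x)
    rw [abs_sub_comm (h x)] at l
    have l2 := mul_le_mul_of_nonneg_left (hd x) (Real.exp_pos N).le
    have l3 := le_abs_self (Real.exp (h x) - Real.exp (f x))
    simp only
    linarith
  have hE := Real.exp_pos N
  have e3 : δ * (1 + Real.exp N) = ε := div_mul_cancel₀ _ hc.ne'
  nlinarith [mul_le_mul_of_nonneg_left hg hE.le, mul_nonneg hE.le p0]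

lemma lsc (hac : P ≪ gaussianReal 0 1) (hB : 0 ≤ B)
    (hK : ∀ s : ℝ, 0 < s → InformationTheory.klDiv (P ∗ gaussianReal 0 s.toNNReal)
      (gaussianReal 0 1 ∗ gaussianReal 0 s.toNNReal) ≤ ENNReal.ofReal B) :
    InformationTheory.klDiv P (gaussianReal 0 1) ≤ ENNReal.ofReal B := by
  rw [InformationTheory.klDiv_eq_lintegral_klFun_of_ac hac]
  set r : ℝ → ℝ := fun x => (P.rnDeriv (gaussianReal 0 1) x).toReal with hr
  have hrm : Measurable r := (Measure.measurable_rnDeriv _ _).ennreal_toReal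
  have hr0 : ∀ x, 0 ≤ r x := fun x => ENNReal.toReal_nonneg
  let c : ℕ → ℝ → ℝ := fun n x => max (Real.exp (-n)) (min (r x) (Real.exp n))
  have hcm : ∀ n, Measurable (c n) := fun n => by fun_prop
  have hc0 : ∀ n x, 0 < c n x := fun n x => lt_of_lt_of_le (Real.exp_pos _) (le_max_left _ _)
  have hE : ∀ n : ℕ, Real.exp (-n) ≤ 1 ∧ 1 ≤ Real.exp n := fun n =>
    ⟨by rw [Real.exp_le_one_iff]; simp, by rw [Real.one_le_exp_iff]; simp⟩
  have hfm : ∀ n, Measurable fun x => Real.log (c n x) := fun n => Real.measurable_log.comp (hcm n)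
  have hfb : ∀ (n : ℕ) x, |Real.log (c n x)| ≤ (n : ℝ) := by
    intro n x
    rw [abs_le]
    constructor
    · rw [Real.le_log_iff_exp_le (hc0 n x)]; exact le_max_left _ _
    · rw [Real.log_le_iff_le_exp (hc0 n x)]
      exact max_le ((hE n).1.trans (hE n).2) (min_le_right _ _)
  let g : ℕ → ℝ → ℝ := fun n x => r x * Real.log (c n x) - (Real.exp (Real.log (c n x)) - 1)
  have hgm : ∀ n, Measurable (g n) := fun n =>
    (hrm.mul (hfm n)).sub ((Real.measurable_exp.comp (hfm n)).sub measurable_const)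
  have hg0 : ∀ n x, 0 ≤ g n x := by
    intro n x
    have h1 : 0 ≤ (r x - c n x) * Real.log (c n x) := by
      rcases le_total (r x) (Real.exp (-n)) with h | h
      · have e : c n x = Real.exp (-n) := max_eq_left ((min_le_left _ _).trans h)
        rw [e, Real.log_exp]
        nlinarith [Nat.cast_nonneg (α := ℝ) n]
      · rcases le_total (r x) (Real.exp n) with h' | h'
        · have e : c n x = r x := by
            change max _ (min _ _) = _
            rw [min_eq_left h', max_eq_right h]
          rw [e]; simp
        · have e : c n x = Real.exp n := by
            change max _ (min _ _) = _
            rw [min_eq_right h', max_eq_right ((hE n).1.trans (hE n).2)]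
          rw [e, Real.log_exp]
          nlinarith [Nat.cast_nonneg (α := ℝ) n]
    have h2 := InformationTheory.klFun_nonneg (hc0 n x).le
    rw [InformationTheory.klFun_apply] at h2
    change 0 ≤ r x * Real.log (c n x) - (Real.exp (Real.log (c n x)) - 1)
    rw [Real.exp_log (hc0 n x)]
    nlinarith
  have hgt : ∀ x, Tendsto (fun n => g n x) atTop (𝓝 (InformationTheory.klFun (r x))) := by
    intro x
    have te : Tendsto (fun n : ℕ => Real.exp (-(n : ℝ))) atTop (𝓝 0) :=
      Real.tendsto_exp_neg_atTop_nhds_zero.comp tendsto_natCast_atTop_atTop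
    have tE : Tendsto (fun n : ℕ => Real.exp (n : ℝ)) atTop atTop :=
      Real.tendsto_exp_atTop.comp tendsto_natCast_atTop_atTop
    rcases (hr0 x).eq_or_lt with h | h
    · rw [← h, InformationTheory.klFun_zero]
      have : Tendsto (fun n : ℕ => 1 - Real.exp (-(n : ℝ))) atTop (𝓝 (1 - 0)) :=
        tendsto_const_nhds.sub te
      rw [sub_zero] at this
      refine this.congr fun n => ?_
      have e : c n x = Real.exp (-n) := max_eq_left ((min_le_left _ _).trans
        (by rw [← h]; exact (Real.exp_pos _).le))
      change _ = r x * Real.log (c n x) - (Real.exp (Real.log (c n x)) - 1)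
      rw [Real.exp_log (hc0 n x), e, ← h]
      ring
    · refine tendsto_const_nhds.congr' ?_
      filter_upwards [te.eventually (gt_mem_nhds h), tE.eventually_ge_atTop (r x)] with n h1 h2
      have e : c n x = r x := by
        change max _ (min _ _) = _
        rw [min_eq_left h2, max_eq_right h1.le]
      change _ = r x * Real.log (c n x) - (Real.exp (Real.log (c n x)) - 1)
      rw [Real.exp_log (hc0 n x), e, InformationTheory.klFun_apply]
      ring
  have hbound : ∀ n, ∫⁻ x, ENNReal.ofReal (g n x) ∂(gaussianReal 0 1) ≤ ENNReal.ofReal B := by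
    intro n
    obtain ⟨i1, e1⟩ := int_as_dens hac (hfm n) (hfb n)
    have i2 : Integrable (fun x => Real.exp (Real.log (c n x)) - 1) (gaussianReal 0 1) :=
      (bdd_int_exp (hfm n) (hfb n)).sub (integrable_const 1)
    have e2 : ∫ x, g n x ∂(gaussianReal 0 1) = ∫ x, Real.log (c n x) ∂P
        - ∫ x, (Real.exp (Real.log (c n x)) - 1) ∂(gaussianReal 0 1) := by
      rw [← e1]; exact integral_sub i1 i2
    have i3 : Integrable (g n) (gaussianReal 0 1) := i1.sub i2
    rw [← ofReal_integral_eq_lintegral_ofReal i3 (Eventually.of_forall (hg0 n))]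
    refine ENNReal.ofReal_le_ofReal ?_
    exact (le_of_eq e2).trans (dv_meas hB hK (hfm n) (hfb n))
  calc ∫⁻ x, ENNReal.ofReal (InformationTheory.klFun (r x)) ∂(gaussianReal 0 1)
      = ∫⁻ x, liminf (fun n => ENNReal.ofReal (g n x)) atTop ∂(gaussianReal 0 1) :=
        lintegral_congr fun x =>
          (((ENNReal.continuous_ofReal.tendsto _).comp (hgt x)).liminf_eq).symm
    _ ≤ liminf (fun n => ∫⁻ x, ENNReal.ofReal (g n x) ∂(gaussianReal 0 1)) atTop :=
        lintegral_liminf_le fun n => (hgm n).ennreal_ofReal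
    _ ≤ liminf (fun _ : ℕ => ENNReal.ofReal B) atTop :=
        liminf_le_liminf (Eventually.of_forall hbound)
    _ = ENNReal.ofReal B := by simp

lemma kl_eq_Lf (hac : P ≪ gaussianReal 0 1) (h1 : ∫ x, x ∂P = 0) (h2 : ∫ x, x ^ 2 ∂P = 1) :
    InformationTheory.klDiv P (gaussianReal 0 1) = Lf P := by
  refine le_antisymm ?_ (Lf_le_kl h1 h2)
  by_cases ht : Lf P = ⊤
  · rw [ht]; exact le_top
  · rw [← ENNReal.ofReal_toReal ht]
    refine lsc hac ENNReal.toReal_nonneg fun s hs => ?_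
    rw [ENNReal.ofReal_toReal ht, (kl_conv hs h1 h2).2]
    exact Kf_le_Lf hs h1 h2

end
end ECLT

namespace ECLT

section
variable (μ : Measure ℝ) [IsProbabilityMeasure μ]

lemma Q_one : Q μ 1 = μ := by
  simp [Q, cp_one]

lemma cp_ac (hac : μ ≪ volume) (m : ℕ) : cp μ (m + 1) ≪ volume := by
  change cp μ m ∗ μ ≪ volume
  exact Measure.conv_absolutelyContinuous hac

lemma Q_ac (hac : μ ≪ gaussianReal 0 1) {m : ℕ} (hm : 1 ≤ m) : Q μ m ≪ gaussianReal 0 1 := by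
  have hv : μ ≪ volume := hac.trans (gaussianReal_absolutelyContinuous 0 one_ne_zero)
  obtain ⟨k, rfl⟩ : ∃ k, m = k + 1 := ⟨m - 1, by omega⟩
  refine Measure.AbsolutelyContinuous.trans ?_ (gaussianReal_absolutelyContinuous' 0 one_ne_zero)
  have hk : 0 < Real.sqrt ((k + 1 : ℕ) : ℝ) := Real.sqrt_pos.2 (by positivity)
  have h := (cp_ac μ hv k).map (f := fun x : ℝ => x / Real.sqrt ((k + 1 : ℕ) : ℝ)) (by fun_prop)
  refine h.trans ?_
  have e : (fun x : ℝ => x / Real.sqrt ((k + 1 : ℕ) : ℝ)) =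
      fun x => x * (Real.sqrt ((k + 1 : ℕ) : ℝ))⁻¹ := by
    ext x; rw [div_eq_mul_inv]
  rw [e]
  have e2 := Real.map_volume_mul_right (inv_ne_zero hk.ne')
  rw [e2]
  exact Measure.smul_absolutelyContinuous

lemma Lf_mono {m : ℕ} (hm : 1 ≤ m) : Lf (Q μ (m + 1)) ≤ Lf (Q μ m) := by
  refine setLIntegral_mono' measurableSet_Ioi fun u hu => ?_
  refine ENNReal.ofReal_le_ofReal ?_
  have := Jf_Q_mono μ hm hu
  linarith

lemma Lf_tendsto (h1 : ∫ x, x ∂μ = 0) (h2 : ∫ x, x ^ 2 ∂μ = 1) (hL : Lf μ ≠ ⊤) :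
    Tendsto (fun m => Lf (Q μ m)) atTop (𝓝 0) := by
  rw [← tendsto_add_atTop_iff_nat 1]
  have h := tendsto_lintegral_of_dominated_convergence' (μ := volume.restrict (Set.Ioi (0 : ℝ)))
    (F := fun (m : ℕ) u => ENNReal.ofReal (1 / 2 * (Jf (Q μ (m + 1)) u - 1 / (1 + u))))
    (f := fun _ => 0)
    (fun u => ENNReal.ofReal (1 / 2 * (Jf μ u - 1 / (1 + u))))
    (fun m => meas_q (Q_mean μ h1 h2 _) (Q_var μ h1 h2 (by omega))) ?_ hL ?_
  · simpa [Lf] using h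
  · intro m
    rw [Filter.EventuallyLE, ae_restrict_iff' measurableSet_Ioi]
    refine Eventually.of_forall fun u hu => ENNReal.ofReal_le_ofReal ?_
    have : Jf (Q μ (m + 1)) u ≤ Jf μ u := by
      induction m with
      | zero => rw [zero_add, Q_one]
      | succ k ih => exact (Jf_Q_mono μ (by omega) hu).trans ih
    linarith
  · rw [ae_restrict_iff' measurableSet_Ioi]
    refine Eventually.of_forall fun u hu => ?_
    have t := (tendsto_add_atTop_iff_nat 1).2 (Jf_tendsto μ h1 h2 hu)
    have t2 := (t.sub_const (1 / (1 + u))).const_mul (1 / 2)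
    rw [sub_self, mul_zero] at t2
    have t3 := (ENNReal.continuous_ofReal.tendsto _).comp t2
    rw [ENNReal.ofReal_zero] at t3
    exact t3

end

lemma kl_eq_mathlib (P R : Measure ℝ) [IsProbabilityMeasure P] [IsProbabilityMeasure R] :
    klDiv P R = InformationTheory.klDiv P R := by
  by_cases h : P ≪ R ∧ Integrable (fun x => Real.log (P.rnDeriv R x).toReal) P
  · have e := InformationTheory.klDiv_of_ac_of_integrable h.1 h.2
    rw [e, klDiv, if_pos h]
    simp [llr]
  · rw [klDiv, if_neg h]
    symm
    rw [InformationTheory.klDiv_eq_top_iff]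
    exact fun ha hi => h ⟨ha, hi⟩

end ECLT

/-- The entropic central limit theorem: if `μ` has mean 0, variance 1 and finite relative
entropy with respect to the standard Gaussian `γ₁`, then `KL(law(S_m) ‖ γ₁) → 0`, and
the convergence is monotone: `KL(law(S_{m+1}) ‖ γ₁) ≤ KL(law(S_m) ‖ γ₁)` for all `m ≥ 1`
(equivalently, the entropy of `S_m` increases monotonically to that of the Gaussian). -/
theorem entropic_clt (μ : Measure ℝ) [IsProbabilityMeasure μ]
    (hmean : ∫ x, x ∂μ = 0) (hvar : ∫ x, x ^ 2 ∂μ = 1)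
    (hKL : klDiv μ (gaussianReal 0 1) ≠ ⊤) :
    Tendsto (fun m => klDiv (normalizedSumLaw μ m) (gaussianReal 0 1)) atTop (𝓝 0) ∧
    ∀ m : ℕ, 1 ≤ m →
      klDiv (normalizedSumLaw μ (m + 1)) (gaussianReal 0 1)
        ≤ klDiv (normalizedSumLaw μ m) (gaussianReal 0 1) := by
  have hac : μ ≪ gaussianReal 0 1 := by
    by_contra h
    exact hKL (by rw [klDiv, if_neg fun h' => h h'.1])
  have e : ∀ m, 1 ≤ m → klDiv (normalizedSumLaw μ m) (gaussianReal 0 1) = ECLT.Lf (ECLT.Q μ m) := by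
    intro m hm
    rw [normalizedSumLaw, ECLT.nsl_eq, ECLT.kl_eq_mathlib]
    exact ECLT.kl_eq_Lf (ECLT.Q_ac μ hac hm) (ECLT.Q_mean μ hmean hvar m) (ECLT.Q_var μ hmean hvar hm)
  refine ⟨?_, ?_⟩
  · rw [ECLT.kl_eq_mathlib, ECLT.kl_eq_Lf hac hmean hvar] at hKL
    refine (ECLT.Lf_tendsto μ hmean hvar hKL).congr' ?_
    filter_upwards [eventually_ge_atTop 1] with m hm
    exact (e m hm).symm
  · intro m hm
    rw [e m hm, e (m + 1) (by omega)]
    exact ECLT.Lf_mono μ hm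
end

section
/- Blachman–Stam inequality: let Y₁,…,Y_d be independent real-valued random variables, where each Y_i has an absolutely continuous density f_i with finite Fisher information I(f_i) = ∫ (f_i′)²/f_i. Let a ∈ ℝ^d with ‖a‖₂ = 1, and let h denote the density of ∑_{i=1}^d a_i·Y_i. Then I(h) ≤ ∑_{i=1}^d a_i²·I(f_i). -/
open MeasureTheory
open scoped BigOperators ENNReal

/-- The Fisher information `I(g) = ∫_{g>0} (g')²/g` of a density `g` with derivative `g'`. -/
noncomputable def fisherInfo (g g' : ℝ → ℝ) : ℝ :=
  ∫ x in {x | 0 < g x}, (g' x) ^ 2 / g x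

lemma bs_int_wd {f : ℝ → ℝ} (hf : Measurable f) (g : ℝ → ℝ) :
    ∫ x, g x ∂(volume.withDensity (fun x => ENNReal.ofReal (f x))) = ∫ x, max (f x) 0 * g x := by
  rw [integral_withDensity_eq_integral_toReal_smul (by fun_prop) (by simp)]
  simp [ENNReal.toReal_ofReal']

lemma bs_intble_wd {f : ℝ → ℝ} (hf : Measurable f) (g : ℝ → ℝ) :
    Integrable g (volume.withDensity (fun x => ENNReal.ofReal (f x))) ↔
      Integrable (fun x => max (f x) 0 * g x) := by
  rw [integrable_withDensity_iff_integrable_smul' (by fun_prop) (by simp)]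
  simp [ENNReal.toReal_ofReal']

section single
variable {f f' : ℝ → ℝ}

lemma bs_meas (hderiv : ∀ x, HasDerivAt f (f' x) x) : Measurable f :=
  (continuous_iff_continuousAt.2 fun x => (hderiv x).continuousAt).measurable

lemma bs_meas' (hderiv : ∀ x, HasDerivAt f (f' x) x) : Measurable f' := by
  have : f' = deriv f := funext fun x => (hderiv x).deriv.symm
  rw [this]; exact measurable_deriv f

lemma bs_zero (hderiv : ∀ x, HasDerivAt f (f' x) x) (hnn : ∀ x, 0 ≤ f x) {x : ℝ}
    (hx : f x = 0) : f' x = 0 := by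
  refine IsLocalMin.hasDerivAt_eq_zero (Filter.Eventually.of_forall fun y => ?_) (hderiv x)
  rw [hx]; exact hnn y

lemma bs_mul (hderiv : ∀ x, HasDerivAt f (f' x) x) (hnn : ∀ x, 0 ≤ f x) (x : ℝ) :
    f x * (f' x / f x) = f' x := by
  by_cases hx : f x = 0
  · rw [hx, bs_zero hderiv hnn hx]; simp
  · field_simp

lemma bs_integrable (hmass : ∫ x, f x = 1) : Integrable f := by
  by_contra h
  rw [integral_undef h] at hmass
  simp at hmass

lemma bs_sq_integrable (hnn : ∀ x, 0 ≤ f x)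
    (hfin : IntegrableOn (fun x => (f' x) ^ 2 / f x) {x | 0 < f x}) :
    Integrable (fun x => (f' x) ^ 2 / f x) := by
  refine (integrableOn_iff_integrable_of_support_subset ?_).1 hfin
  intro x hx
  refine lt_of_le_of_ne (hnn x) fun h => hx ?_
  simp [← h]

lemma bs_sq_integral (hnn : ∀ x, 0 ≤ f x) :
    fisherInfo f f' = ∫ x, (f' x) ^ 2 / f x := by
  refine setIntegral_eq_integral_of_forall_compl_eq_zero fun x hx => ?_
  have : f x = 0 := le_antisymm (not_lt.1 hx) (hnn x)
  simp [this]

lemma bs_integrable' (hderiv : ∀ x, HasDerivAt f (f' x) x) (hnn : ∀ x, 0 ≤ f x)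
    (hmass : ∫ x, f x = 1)
    (hfin : IntegrableOn (fun x => (f' x) ^ 2 / f x) {x | 0 < f x}) : Integrable f' := by
  refine ((bs_sq_integrable hnn hfin).add (bs_integrable hmass)).mono'
    (bs_meas' hderiv).aestronglyMeasurable (Filter.Eventually.of_forall fun x => ?_)
  simp only [Pi.add_apply, Real.norm_eq_abs]
  rcases (hnn x).eq_or_lt with h | h
  · rw [bs_zero hderiv hnn h.symm, ← h]; simp
  · rw [div_add' _ _ _ h.ne', le_div_iff₀ h]
    nlinarith [sq_nonneg (|f' x| - f x), sq_abs (f' x), abs_nonneg (f' x), mul_nonneg (abs_nonneg (f' x)) h.le]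

lemma bs_prob (hnn : ∀ x, 0 ≤ f x) (hmass : ∫ x, f x = 1) :
    IsProbabilityMeasure (volume.withDensity (fun x => ENNReal.ofReal (f x))) := by
  constructor
  rw [withDensity_apply _ MeasurableSet.univ, Measure.restrict_univ,
    ← ofReal_integral_eq_lintegral_ofReal (bs_integrable hmass) (Filter.Eventually.of_forall hnn),
    hmass, ENNReal.ofReal_one]

lemma bs_sq_eq (f f' : ℝ → ℝ) (x : ℝ) : f x * (f' x / f x) ^ 2 = (f' x) ^ 2 / f x := by
  by_cases hx : f x = 0
  · simp [hx]
  · field_simp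

lemma bs_memLp (hderiv : ∀ x, HasDerivAt f (f' x) x) (hnn : ∀ x, 0 ≤ f x)
    (hfin : IntegrableOn (fun x => (f' x) ^ 2 / f x) {x | 0 < f x}) :
    MemLp (fun x => f' x / f x) 2 (volume.withDensity (fun x => ENNReal.ofReal (f x))) := by
  rw [memLp_two_iff_integrable_sq (by
    exact ((bs_meas' hderiv).div (bs_meas hderiv)).aestronglyMeasurable), bs_intble_wd (bs_meas hderiv)]
  simp only [max_eq_left (hnn _), bs_sq_eq]
  exact bs_sq_integrable hnn hfin

lemma bs_sq (hderiv : ∀ x, HasDerivAt f (f' x) x) (hnn : ∀ x, 0 ≤ f x) :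
    ∫ x, (f' x / f x) ^ 2 ∂(volume.withDensity (fun x => ENNReal.ofReal (f x)))
      = fisherInfo f f' := by
  rw [bs_int_wd (bs_meas hderiv), bs_sq_integral hnn]
  simp only [max_eq_left (hnn _), bs_sq_eq]

lemma bs_mean (hderiv : ∀ x, HasDerivAt f (f' x) x) (hnn : ∀ x, 0 ≤ f x)
    (hmass : ∫ x, f x = 1)
    (hfin : IntegrableOn (fun x => (f' x) ^ 2 / f x) {x | 0 < f x}) :
    ∫ x, f' x / f x ∂(volume.withDensity (fun x => ENNReal.ofReal (f x))) = 0 := by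
  rw [bs_int_wd (bs_meas hderiv)]
  simp only [max_eq_left (hnn _), bs_mul hderiv hnn]
  exact integral_eq_zero_of_hasDerivAt_of_integrable hderiv (bs_integrable' hderiv hnn hmass hfin)
    (bs_integrable hmass)

lemma bs_ibp (hderiv : ∀ x, HasDerivAt f (f' x) x) (hnn : ∀ x, 0 ≤ f x)
    (hmass : ∫ x, f x = 1)
    (hfin : IntegrableOn (fun x => (f' x) ^ 2 / f x) {x | 0 < f x})
    {φ ψ : ℝ → ℝ} (hφ : ∀ x, HasDerivAt φ (ψ x) x) (hψ : Continuous ψ) {C D : ℝ}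
    (hC : ∀ x, |φ x| ≤ C) (hD : ∀ x, |ψ x| ≤ D) (a c : ℝ) :
    ∫ x, φ (c + a * x) * (f' x / f x) ∂(volume.withDensity (fun x => ENNReal.ofReal (f x)))
      = - (a * ∫ x, ψ (c + a * x) ∂(volume.withDensity (fun x => ENNReal.ofReal (f x)))) := by
  rw [bs_int_wd (bs_meas hderiv), bs_int_wd (bs_meas hderiv)]
  simp only [max_eq_left (hnn _)]
  have e : ∀ x, f x * (φ (c + a * x) * (f' x / f x)) = φ (c + a * x) * f' x := fun x => by
    rw [mul_left_comm, bs_mul hderiv hnn]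
  simp only [e]
  have hφc : Continuous φ := continuous_iff_continuousAt.2 fun x => (hφ x).continuousAt
  have key := integral_mul_deriv_eq_deriv_mul_of_integrable
    (u := fun x => φ (c + a * x)) (u' := fun x => ψ (c + a * x) * a) (v := f) (v' := f')
    (fun x _ => by
      have h1 : HasDerivAt (fun x : ℝ => c + a * x) a x := by
        simpa using ((hasDerivAt_id x).const_mul a).const_add c
      exact (hφ (c + a * x)).comp x h1) (fun x _ => hderiv x)
    ((bs_integrable' hderiv hnn hmass hfin).bdd_mul (c := C)
      (by fun_prop : Continuous fun x => φ (c + a * x)).aestronglyMeasurable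
      (Filter.Eventually.of_forall fun x => hC _))
    ((bs_integrable hmass).bdd_mul (c := D * |a|)
      (by fun_prop : Continuous fun x => ψ (c + a * x) * a).aestronglyMeasurable
      (Filter.Eventually.of_forall fun x => by
        rw [norm_mul]; exact mul_le_mul_of_nonneg_right (hD _) (abs_nonneg a)))
    ((bs_integrable hmass).bdd_mul (c := C)
      (by fun_prop : Continuous fun x => φ (c + a * x)).aestronglyMeasurable
      (Filter.Eventually.of_forall fun x => hC _))
  rw [key, ← integral_const_mul]
  congr 1
  refine integral_congr_ae (Filter.Eventually.of_forall fun x => ?_)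
  simp only; ring

end single

lemma bs_endgame {p k : ℝ → ℝ} (hp : Continuous p) (hpi : Integrable p) (hk : Integrable k)
    (H : ∀ ψ : ℝ → ℝ, Continuous ψ → HasCompactSupport ψ →
      ∫ t, p t * ψ t = - ∫ s, (∫ t in Set.Iic s, ψ t) * k s) :
    ∀ᵐ x, HasDerivAt p (k x) x := by
  set K : ℝ → ℝ := fun t => ∫ s in Set.Ici t, k s with hK
  have hK' : ∀ t, K t = K 0 - ∫ s in (0:ℝ)..t, k s := by
    intro t
    have h1 : K t = ∫ s in Set.Ioi t, k s := integral_Ici_eq_integral_Ioi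
    have h2 : K 0 = ∫ s in Set.Ioi 0, k s := integral_Ici_eq_integral_Ioi
    have h3 := intervalIntegral.integral_Iic_sub_Iic (a := 0) (b := t) (f := k) (μ := volume)
      hk.integrableOn hk.integrableOn
    have h4 := intervalIntegral.integral_Iic_add_Ioi (b := t) (f := k) (μ := volume)
      hk.integrableOn hk.integrableOn
    have h5 := intervalIntegral.integral_Iic_add_Ioi (b := (0:ℝ)) (f := k) (μ := volume)
      hk.integrableOn hk.integrableOn
    linarith
  have hKc : Continuous K := by
    have : K = fun t => K 0 - ∫ s in (0:ℝ)..t, k s := funext hK'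
    rw [this]
    exact continuous_const.sub (intervalIntegral.continuous_primitive
      (fun a b => hk.intervalIntegrable) 0)
  have hae : ∀ᵐ x, p x + K x = 0 := by
    refine ae_eq_zero_of_integral_contDiff_smul_eq_zero
      ((hp.add hKc).locallyIntegrable) fun ψ hψ hψc => ?_
    have hψi : Integrable ψ := hψ.continuous.integrable_of_hasCompactSupport hψc
    have h1 := H ψ hψ.continuous hψc
    have h2 : ∫ s, (∫ t in Set.Iic s, ψ t) * k s = ∫ t, ψ t * K t := by
      have e1 : ∀ s, (∫ t in Set.Iic s, ψ t) * k s
          = ∫ t, Set.indicator {q : ℝ × ℝ | q.2 ≤ q.1} (fun q => k q.1 * ψ q.2) (s, t) := by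
        intro s
        rw [← integral_indicator measurableSet_Iic, mul_comm, ← integral_const_mul]
        congr 1; ext t
        simp only [Set.indicator, Set.mem_Iic, Set.mem_ofPred_eq]
        split_ifs <;> simp
      have e2 : ∀ t, ψ t * K t
          = ∫ s, Set.indicator {q : ℝ × ℝ | q.2 ≤ q.1} (fun q => k q.1 * ψ q.2) (s, t) := by
        intro t
        rw [hK]; simp only
        rw [← integral_indicator measurableSet_Ici, ← integral_const_mul]
        congr 1; ext s
        simp only [Set.indicator, Set.mem_Ici, Set.mem_ofPred_eq]
        split_ifs <;> simp [mul_comm]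
      simp only [e1, e2]
      refine integral_integral_swap (f := fun s t => Set.indicator {q : ℝ × ℝ | q.2 ≤ q.1} (fun q => k q.1 * ψ q.2) (s, t)) ?_
      exact (hk.mul_prod hψi).indicator (measurableSet_le measurable_snd measurable_fst)
    have i1 : Integrable (fun x => p x * ψ x) := by
      exact (hp.mul hψ.continuous).integrable_of_hasCompactSupport hψc.mul_left
    have i2 : Integrable (fun x => ψ x * K x) := by
      exact (hψ.continuous.mul hKc).integrable_of_hasCompactSupport hψc.mul_right
    have : ∀ x, ψ x • (p x + K x) = p x * ψ x + ψ x * K x := fun x => by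
      simp only [smul_eq_mul]; ring
    simp only [this]
    rw [integral_add i1 i2, h1, h2]; ring
  have heq : (fun x => p x + K x) = fun _ => 0 :=
    (Continuous.ae_eq_iff_eq volume (hp.add hKc) continuous_const).1 hae
  have hpeq : p = fun t => (∫ s in (0:ℝ)..t, k s) - K 0 := by
    ext t
    have : p t + K t = 0 := congrFun heq t
    rw [hK' t] at this
    linarith
  filter_upwards [LocallyIntegrable.ae_hasDerivAt_integral hk.locallyIntegrable] with x hx
  rw [hpeq]
  exact (hx 0).sub_const _

lemma bs_split {d : ℕ} (P : Fin d → Measure ℝ) [∀ i, IsProbabilityMeasure (P i)]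
    (a : Fin d → ℝ) (i : Fin d) :
    ∃ ν : Measure ℝ, IsProbabilityMeasure ν ∧ ∀ F : ℝ × ℝ → ℝ, Integrable F (ν.prod (P i)) →
      ∫ y, F ((∑ j ∈ Finset.univ.erase i, a j * y j), y i) ∂(Measure.pi P)
        = ∫ z, ∫ x, F (z, x) ∂(P i) ∂ν := by
  set Z : (Fin d → ℝ) → ℝ := fun y => ∑ j ∈ Finset.univ.erase i, a j * y j with hZ
  have hZm : Measurable Z := by fun_prop
  have hind : ProbabilityTheory.IndepFun Z (fun y : Fin d → ℝ => y i) (Measure.pi P) := by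
    have h1 := ProbabilityTheory.iIndepFun_pi (μ := P)
      (X := fun j x => Function.update a i 1 j * x) (fun j => by fun_prop)
    have h2 := h1.indepFun_finsetSum_of_notMem (fun j => by fun_prop)
      (Finset.notMem_erase i Finset.univ)
    convert h2 using 1
    · ext y
      simp only [hZ, Finset.sum_apply]
      refine Finset.sum_congr rfl fun j hj => ?_
      rw [Function.update_of_ne (Finset.ne_of_mem_erase hj)]
    · ext y; simp
  have hmap := hind.map_prod_eq_prod_map_map hZm.aemeasurable (measurable_pi_apply i).aemeasurable
  rw [(measurePreserving_eval P i).map_eq] at hmap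
  refine ⟨(Measure.pi P).map Z, Measure.isProbabilityMeasure_map hZm.aemeasurable, fun F hF => ?_⟩
  haveI := Measure.isProbabilityMeasure_map (μ := Measure.pi P) hZm.aemeasurable
  rw [← integral_prod F hF, ← hmap, integral_map (by fun_prop) (by rw [hmap]; exact hF.1)]

lemma bs_score {d : ℕ} (f f' : Fin d → ℝ → ℝ)
    (hderiv : ∀ i x, HasDerivAt (f i) (f' i x) x)
    (hnn : ∀ i x, 0 ≤ f i x)
    (hmass : ∀ i, ∫ x, f i x = 1)
    (hfin : ∀ i, IntegrableOn (fun x => (f' i x) ^ 2 / f i x) {x | 0 < f i x})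
    (a : Fin d → ℝ)
    {φ ψ : ℝ → ℝ} (hφ : ∀ x, HasDerivAt φ (ψ x) x) (hψ : Continuous ψ) {C D : ℝ}
    (hC : ∀ x, |φ x| ≤ C) (hD : ∀ x, |ψ x| ≤ D) (i : Fin d) :
    ∫ y, φ (∑ j, a j * y j) * (f' i (y i) / f i (y i)) ∂(Measure.pi fun i =>
        volume.withDensity (fun x => ENNReal.ofReal (f i x)))
      = - (a i * ∫ y, ψ (∑ j, a j * y j) ∂(Measure.pi fun i =>
        volume.withDensity (fun x => ENNReal.ofReal (f i x)))) := by
  haveI := fun i => bs_prob (hnn i) (hmass i)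
  have hφc : Continuous φ := continuous_iff_continuousAt.2 fun x => (hφ x).continuousAt
  obtain ⟨ν, hν, hs⟩ := bs_split
    (fun i => volume.withDensity (fun x => ENNReal.ofReal (f i x))) a i
  have e : ∀ y : Fin d → ℝ, ∑ j, a j * y j = (∑ j ∈ Finset.univ.erase i, a j * y j) + a i * y i :=
    fun y => (Finset.sum_erase_add _ _ (Finset.mem_univ i)).symm
  have i1 : Integrable (fun q : ℝ × ℝ => φ (q.1 + a i * q.2) * (f' i q.2 / f i q.2))
      (ν.prod (volume.withDensity (fun x => ENNReal.ofReal (f i x)))) := by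
    refine Integrable.bdd_mul (c := C) ?_ (by fun_prop : Continuous fun q : ℝ × ℝ => φ (q.1 + a i * q.2)).aestronglyMeasurable
      (Filter.Eventually.of_forall fun x => hC _)
    exact ((bs_memLp (hderiv i) (hnn i) (hfin i)).integrable one_le_two).comp_snd ν
  have i2 : Integrable (fun q : ℝ × ℝ => ψ (q.1 + a i * q.2))
      (ν.prod (volume.withDensity (fun x => ENNReal.ofReal (f i x)))) := by
    refine Integrable.of_bound (by fun_prop : Continuous fun q : ℝ × ℝ => ψ (q.1 + a i * q.2)).aestronglyMeasurable D
      (Filter.Eventually.of_forall fun x => hD _)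
  have h1 := hs _ i1
  have h2 := hs _ i2
  simp only at h1 h2
  simp only [e]
  rw [h1, h2, ← integral_const_mul, ← integral_neg]
  refine integral_congr_ae (Filter.Eventually.of_forall fun z => ?_)
  exact bs_ibp (hderiv i) (hnn i) (hmass i) (hfin i) hφ hψ hC hD (a i) z

lemma bs_hderivInt {ψ : ℝ → ℝ} (hψ : Continuous ψ) (hi : Integrable ψ) (x : ℝ) :
    HasDerivAt (fun s => ∫ t in Set.Iic s, ψ t) (ψ x) x := by
  have : (fun s => ∫ t in Set.Iic s, ψ t)
      = fun s => (∫ t in (0:ℝ)..s, ψ t) + ∫ t in Set.Iic 0, ψ t := by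
    ext s
    have h3 := intervalIntegral.integral_Iic_sub_Iic (a := 0) (b := s) (f := ψ) (μ := volume)
      hi.integrableOn hi.integrableOn
    linarith
  rw [this]
  exact (intervalIntegral.integral_hasDerivAt_right hi.intervalIntegrable
    hψ.stronglyMeasurable.stronglyMeasurableAtFilter hψ.continuousAt).add_const _

theorem blachman_stam (d : ℕ) (hd : 0 < d) (f f' : Fin d → ℝ → ℝ)
    (hderiv : ∀ i x, HasDerivAt (f i) (f' i x) x)
    (hnn : ∀ i x, 0 ≤ f i x)
    (hmass : ∀ i, ∫ x, f i x = 1)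
    (hfin : ∀ i, IntegrableOn (fun x => (f' i x) ^ 2 / f i x) {x | 0 < f i x})
    (a : Fin d → ℝ) (ha : ∑ i, (a i) ^ 2 = 1)
    (h h' : ℝ → ℝ) (hh : ∀ x, HasDerivAt h (h' x) x)
    (hdens : Measure.map (fun y : Fin d → ℝ => ∑ i, a i * y i)
        (Measure.pi fun i => volume.withDensity (fun x => ENNReal.ofReal (f i x)))
      = volume.withDensity (fun x => ENNReal.ofReal (h x))) :
    fisherInfo h h' ≤ ∑ i, (a i) ^ 2 * fisherInfo (f i) (f' i) := by
  haveI := fun i => bs_prob (hnn i) (hmass i)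
  have hscore := @bs_score d f f' hderiv hnn hmass hfin a
  have hL2 := fun i => bs_memLp (hderiv i) (hnn i) (hfin i)
  have hmean := fun i => bs_mean (hderiv i) (hnn i) (hmass i) (hfin i)
  have hsq := fun i => bs_sq (hderiv i) (hnn i)
  set P : Fin d → Measure ℝ := fun i => volume.withDensity (fun x => ENNReal.ofReal (f i x)) with hP
  set μ := Measure.pi P with hμ
  set T : (Fin d → ℝ) → ℝ := fun y => ∑ i, a i * y i with hT
  have hTm : Measurable T := by fun_prop
  have hhm : Measurable h := bs_meas hh
  have hhc : Continuous h := continuous_iff_continuousAt.2 fun x => (hh x).continuousAt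
  -- the total score
  have hXi : ∀ i, MemLp (fun y : Fin d → ℝ => a i * (f' i (y i) / f i (y i))) 2 μ := fun i =>
    ((hL2 i).comp_measurePreserving (measurePreserving_eval P i)).const_mul (a i)
  set R : (Fin d → ℝ) → ℝ := fun y => ∑ i, a i * (f' i (y i) / f i (y i)) with hR
  have hRL : MemLp R 2 μ := memLp_finsetSum _ fun i _ => hXi i
  have hRi : Integrable R μ := hRL.integrable one_le_two
  have hRmean : ∫ y, R y ∂μ = 0 := by
    rw [hR, integral_finsetSum _ fun i _ => (hXi i).integrable one_le_two]
    refine Finset.sum_eq_zero fun i _ => ?_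
    rw [integral_const_mul, integral_comp_eval (μ := P) (f := fun x => f' i x / f i x) (hL2 i).1,
      hmean i, mul_zero]
  have hRsq : ∫ y, R y ^ 2 ∂μ = ∑ i, (a i) ^ 2 * fisherInfo (f i) (f' i) := by
    have h1 := ProbabilityTheory.variance_sum_pi (μ := P)
      (X := fun i x => a i * (f' i x / f i x)) (fun i => (hL2 i).const_mul (a i))
    have e : (∑ i, fun y : Fin d → ℝ => a i * (f' i (y i) / f i (y i))) = R := by
      ext y; simp [hR]
    rw [e, ProbabilityTheory.variance_of_integral_eq_zero hRL.1.aemeasurable hRmean] at h1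
    rw [h1]
    refine Finset.sum_congr rfl fun i _ => ?_
    rw [ProbabilityTheory.variance_const_mul, ProbabilityTheory.variance_of_integral_eq_zero
      (hL2 i).1.aemeasurable (hmean i), hsq i]
  -- conditional expectation given `T`
  set m : MeasurableSpace (Fin d → ℝ) := MeasurableSpace.comap T inferInstance with hm
  have hmle : m ≤ MeasurableSpace.pi := hTm.comap_le
  obtain ⟨G, hGm, hG⟩ := (stronglyMeasurable_condExp (m := m) (f := R)
    (μ := μ)).exists_eq_measurable_comp
  have hGL : MemLp (G ∘ T) 2 μ := by rw [← hG]; exact hRL.condExp one_le_two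
  have hGle : ∫ y, G (T y) ^ 2 ∂μ ≤ ∫ y, R y ^ 2 ∂μ := by
    have h1 := ProbabilityTheory.integral_condVar_add_variance_condExp hmle hRL
    have h2 : 0 ≤ ∫ y, (ProbabilityTheory.condVar m R μ) y ∂μ :=
      integral_nonneg_of_ae (condExp_nonneg (Filter.Eventually.of_forall fun y => by
        simp only [Pi.pow_apply, Pi.zero_apply]; positivity))
    rw [ProbabilityTheory.variance_of_integral_eq_zero hRL.1.aemeasurable hRmean,
      ProbabilityTheory.variance_of_integral_eq_zero (hRL.condExp one_le_two).1.aemeasurable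
        (by rw [integral_condExp hmle, hRmean]), hG] at h1
    simp only [Function.comp_apply] at h1
    linarith
  have hpull : ∀ φ : ℝ → ℝ, Continuous φ → ∀ C : ℝ, (∀ x, |φ x| ≤ C) →
      ∫ y, φ (T y) * R y ∂μ = ∫ y, φ (T y) * G (T y) ∂μ := by
    intro φ hφ C hC
    have hTm' : Measurable[m] T := comap_measurable T
    have h1 := condExp_mul_of_stronglyMeasurable_left (m := m) (μ := μ)
      (f := fun y => φ (T y)) (g := R) (hφ.measurable.comp hTm').stronglyMeasurable
      (hRi.bdd_mul (c := C) (hφ.measurable.comp hTm).aestronglyMeasurable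
        (Filter.Eventually.of_forall fun x => hC _)) hRi
    rw [hG] at h1
    have h2 := integral_congr_ae h1
    rw [integral_condExp hmle] at h2
    exact h2
  -- transfer to the density of `T`
  have hpush : ∀ g : ℝ → ℝ, Measurable g → ∫ y, g (T y) ∂μ = ∫ x, max (h x) 0 * g x := by
    intro g hg
    rw [← bs_int_wd hhm, ← hdens, integral_map hTm.aemeasurable hg.aestronglyMeasurable]
  have hpushi : ∀ g : ℝ → ℝ, Measurable g → Integrable (fun y => g (T y)) μ →
      Integrable (fun x => max (h x) 0 * g x) := by
    intro g hg hi
    rw [← bs_intble_wd hhm, ← hdens, integrable_map_measure hg.aestronglyMeasurable hTm.aemeasurable]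
    exact hi
  have hpc : Continuous fun x => max (h x) 0 := hhc.max continuous_const
  have hpi : Integrable fun x => max (h x) 0 := by
    simpa using hpushi (fun _ => 1) measurable_const (integrable_const _)
  have hki : Integrable fun x => max (h x) 0 * G x :=
    hpushi G hGm.measurable (hGL.integrable one_le_two)
  have hae := bs_endgame hpc hpi hki (fun ψ hψ hψc => by
    have hψi : Integrable ψ := hψ.integrable_of_hasCompactSupport hψc
    have hφd := bs_hderivInt hψ hψi
    set φ : ℝ → ℝ := fun s => ∫ t in Set.Iic s, ψ t with hφ
    have hφc : Continuous φ := continuous_iff_continuousAt.2 fun x => (hφd x).continuousAt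
    have hC : ∀ x, |φ x| ≤ ∫ t, ‖ψ t‖ := fun x =>
      (norm_integral_le_integral_norm _).trans
        (setIntegral_le_integral hψi.norm (Filter.Eventually.of_forall fun t => norm_nonneg _))
    obtain ⟨D, hD⟩ := hψc.exists_bound_of_continuous hψ
    rw [← hpush ψ hψ.measurable]
    have e : ∫ s, φ s * (max (h s) 0 * G s) = ∫ y, φ (T y) * R y ∂μ := by
      rw [hpull φ hφc _ hC, hpush (fun x => φ x * G x) (hφc.measurable.mul hGm.measurable)]
      congr 1; ext x; ring
    rw [e]
    have e2 : ∫ y, φ (T y) * R y ∂μ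
        = ∑ i, a i * ∫ y, φ (T y) * (f' i (y i) / f i (y i)) ∂μ := by
      simp only [← integral_const_mul]
      rw [← integral_finsetSum]
      · congr 1; ext y
        rw [hR]; simp only [Finset.mul_sum]
        exact Finset.sum_congr rfl fun i _ => by ring
      · intro i _
        have := ((hXi i).integrable one_le_two).bdd_mul (c := ∫ t, ‖ψ t‖)
          (hφc.measurable.comp hTm).aestronglyMeasurable
          (Filter.Eventually.of_forall fun x => hC (T x))
        refine this.congr (Filter.Eventually.of_forall fun y => ?_)
        simp only [Function.comp_apply]; ring
    rw [e2]
    have e3 : ∀ i, ∫ y, φ (T y) * (f' i (y i) / f i (y i)) ∂μ = -(a i * ∫ y, ψ (T y) ∂μ) :=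
      fun i => hscore hφd hψ hC hD i
    simp only [e3]
    have e4 : ∀ i, a i * -(a i * ∫ y, ψ (T y) ∂μ) = -((a i) ^ 2 * ∫ y, ψ (T y) ∂μ) :=
      fun i => by ring
    simp only [e4, Finset.sum_neg_distrib, ← Finset.sum_mul, ha]
    ring)
  -- conclusion
  have hS : MeasurableSet {x | 0 < h x} := measurableSet_lt measurable_const hhm
  have hfin1 : fisherInfo h h' = ∫ x, max (h x) 0 * G x ^ 2 := by
    have h0 : ∫ x, max (h x) 0 * G x ^ 2 = ∫ x in {x | 0 < h x}, max (h x) 0 * G x ^ 2 := by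
      refine (setIntegral_eq_integral_of_forall_compl_eq_zero fun x hx => ?_).symm
      rw [max_eq_right (not_lt.1 hx), zero_mul]
    rw [h0, fisherInfo]
    refine setIntegral_congr_ae hS ?_
    filter_upwards [hae] with x hx hx0
    have hx0 : 0 < h x := hx0
    have hev : (fun x => max (h x) 0) =ᶠ[nhds x] h := by
      filter_upwards [hhc.continuousAt.eventually (lt_mem_nhds hx0)] with z hz
      exact max_eq_left (le_of_lt hz)
    have := (hx.congr_of_eventuallyEq hev.symm).unique (hh x)
    rw [max_eq_left hx0.le] at this ⊢
    rw [← this]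
    field_simp
  rw [hfin1, ← hpush (fun x => G x ^ 2) (hGm.measurable.pow_const 2), ← hRsq]
  exact hGle
end
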